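/- arXiv:1804.07076 — 2 statements merged into one kernel-verified Lean document; each statement's English description precedes it below -/
import Mathlib

section
/- For all real α, β > −1 and every δ ∈ (0, π/2) there exist constants C > 0 and N ∈ ℕ such that for all n ≥ N and all integers k with 1 ≤ k ≤ n for which θ₀ := (n + 1 − k + α/2 − 1/4)π/κ lies in [δ, π−δ] (where κ = n + (α+β+1)/2), there exists θ* ∈ (0, π) with P_n^{(α,β)}(cos θ*) = 0 and |θ* − θ₀ − θ₁/κ² − θ₂/κ⁴| ≤ C/κ⁶, where, with x = cos θ₀, θ₁ = −(2β²x + 2α²x − x − 2β² + 2α²)/(8 sin θ₀) and θ₂ = (1/(384 sin³θ₀))·(−33x − 36β²x² + 36α²x² + 24β⁴x² − 24α⁴x² + 2x³ + 84β²x − 60α⁴x − 60β⁴x + 84α²x + 4β⁴x³ + 4α⁴x³ − 8β²x³ + 40α² − 8α²x³ − 40β² + 32β⁴ − 32α⁴ + 24α²β²x³ − 24α²β²x). -/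
open Real

/-- The Jacobi polynomial `P_n^{(α,β)}(x)` defined by its explicit sum. -/
noncomputable def jacobiP (α β : ℝ) (n : ℕ) (x : ℝ) : ℝ :=
  ∑ ℓ ∈ Finset.range (n + 1),
    ((ascPochhammer ℝ ℓ).eval ((n : ℝ) + α + β + 1) *
        (ascPochhammer ℝ (n - ℓ)).eval (α + (ℓ : ℝ) + 1)) /
      ((Nat.factorial ℓ : ℝ) * (Nat.factorial (n - ℓ) : ℝ)) * ((x - 1) / 2) ^ ℓ

open Filter Topology

/-- The sine of the angle between the line spanned by `w` and the real axis. -/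
noncomputable def axisAngle (w : ℂ) : ℝ := |w.im| / ‖w‖

lemma axisAngle_sub_le {w z : ℂ} {η : ℝ} (hη : 0 ≤ η) (h : ‖w - z‖ ≤ η * ‖z‖) :
    |axisAngle w - axisAngle z| ≤ 2 * η := by
  unfold axisAngle
  rcases eq_or_ne z 0 with rfl | hz
  · have hw : w = 0 := by simpa using h
    simp [hw, hη]
  have hz' : 0 < ‖z‖ := norm_pos_iff.2 hz
  have hq : ‖w - z‖ / ‖z‖ ≤ η := (div_le_iff₀ hz').2 h
  have him : |(|w.im| - |z.im|)| ≤ ‖w - z‖ :=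
    (abs_abs_sub_abs_le _ _).trans (by simpa using Complex.abs_im_le_norm (w - z))
  rcases eq_or_ne w 0 with rfl | hw
  · have h1 : |z.im| / ‖z‖ ≤ 1 := (div_le_one hz').2 (Complex.abs_im_le_norm z)
    have h2 : (1 : ℝ) ≤ η := by simpa [hz] using hq
    have h3 : 0 ≤ |z.im| / ‖z‖ := by positivity
    simp only [Complex.zero_im, abs_zero, zero_div, zero_sub, abs_neg, abs_of_nonneg h3]
    linarith
  have hw' : 0 < ‖w‖ := norm_pos_iff.2 hw
  have e : |w.im| / ‖w‖ - |z.im| / ‖z‖ =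
      |w.im| / ‖w‖ * ((‖z‖ - ‖w‖) / ‖z‖) + (|w.im| - |z.im|) / ‖z‖ := by
    field_simp; ring
  have h1 : |w.im| / ‖w‖ ≤ 1 := (div_le_one hw').2 (Complex.abs_im_le_norm w)
  have h2 : |(‖z‖ - ‖w‖) / ‖z‖| ≤ η := by
    rw [abs_div, abs_of_pos hz']
    refine le_trans ?_ hq
    gcongr
    rw [norm_sub_rev]
    exact abs_norm_sub_norm_le z w
  have h3 : |(|w.im| - |z.im|) / ‖z‖| ≤ η := by
    rw [abs_div, abs_of_pos hz']
    exact le_trans (by gcongr) hq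
  rw [e]
  calc _ ≤ |(|w.im| / ‖w‖ * ((‖z‖ - ‖w‖) / ‖z‖))| + |(|w.im| - |z.im|) / ‖z‖| := abs_add_le _ _
    _ ≤ 1 * η + η := by
        rw [abs_mul, abs_of_nonneg (show 0 ≤ |w.im| / ‖w‖ by positivity)]
        gcongr
    _ = 2 * η := by ring

lemma axisAngle_real_mul {r : ℝ} (hr : r ≠ 0) (w : ℂ) : axisAngle (r * w) = axisAngle w := by
  unfold axisAngle
  rw [Complex.im_ofReal_mul, norm_mul, abs_mul, Complex.norm_real, Real.norm_eq_abs,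
    mul_div_mul_left _ _ (abs_ne_zero.2 hr)]

lemma axisAngle_conj (w : ℂ) : axisAngle (starRingEnd ℂ w) = axisAngle w := by
  simp [axisAngle]

lemma continuousAt_axisAngle {w : ℂ} (hw : w ≠ 0) : ContinuousAt axisAngle w :=
  (Complex.continuous_im.abs.continuousAt).div continuous_norm.continuousAt (norm_ne_zero_iff.2 hw)

lemma norm_le_exp_mul_of_norm_deriv_le {Z Z' : ℝ → ℂ} {H H' : ℝ → ℝ} {a b : ℝ} (hab : a ≤ b)
    (hZ : ∀ x ∈ Set.Icc a b, HasDerivAt Z (Z' x) x)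
    (hH : ∀ x ∈ Set.Icc a b, HasDerivAt H (H' x) x)
    (hb : ∀ x ∈ Set.Icc a b, ‖Z' x‖ ≤ H' x * ‖Z x‖) :
    ‖Z b‖ ≤ exp (H b - H a) * ‖Z a‖ := by
  have hd : ∀ x ∈ Set.Icc a b, HasDerivAt (fun x => ‖Z x‖ ^ 2 * exp (-(2 * H x)))
      (2 * inner ℝ (Z x) (Z' x) * exp (-(2 * H x)) +
        ‖Z x‖ ^ 2 * (exp (-(2 * H x)) * (-(2 * H' x)))) x := fun x hx =>
    ((hZ x hx).norm_sq).mul (((hH x hx).const_mul 2).neg.exp)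
  have hanti : AntitoneOn (fun x => ‖Z x‖ ^ 2 * exp (-(2 * H x))) (Set.Icc a b) := by
    refine antitoneOn_of_hasDerivWithinAt_nonpos (convex_Icc a b)
      (fun x hx => (hd x hx).continuousAt.continuousWithinAt)
      (fun x hx => (hd x (interior_subset hx)).hasDerivWithinAt) fun x hx => ?_
    have h1 := hb x (interior_subset hx)
    have h2 : inner ℝ (Z x) (Z' x) ≤ ‖Z x‖ * (H' x * ‖Z x‖) :=
      (real_inner_le_norm _ _).trans (by gcongr)
    have h3 := exp_pos (-(2 * H x))
    nlinarith
  have h := hanti (Set.left_mem_Icc.2 hab) (Set.right_mem_Icc.2 hab) hab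
  have h' : ‖Z b‖ ^ 2 ≤ (exp (H b - H a) * ‖Z a‖) ^ 2 := by
    have e : exp (H b - H a) ^ 2 = exp (-(2 * H a)) * exp (2 * H b) := by
      rw [← exp_nat_mul, ← exp_add]; congr 1; push_cast; ring
    have e' : exp (-(2 * H b)) * exp (2 * H b) = 1 := by rw [← exp_add]; simp
    rw [mul_pow, e]
    have := mul_le_mul_of_nonneg_right h (exp_pos (2 * H b)).le
    simp only at this
    calc ‖Z b‖ ^ 2 = ‖Z b‖ ^ 2 * exp (-(2 * H b)) * exp (2 * H b) := by rw [mul_assoc, e', mul_one]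
      _ ≤ _ := this
      _ = _ := by ring
  exact le_of_sq_le_sq h' (by positivity)

lemma norm_sub_le_of_norm_deriv_le {Z Z' : ℝ → ℂ} {H H' : ℝ → ℝ} {a b : ℝ} (hab : a ≤ b)
    (hZ : ∀ x ∈ Set.Icc a b, HasDerivAt Z (Z' x) x)
    (hH : ∀ x ∈ Set.Icc a b, HasDerivAt H (H' x) x)
    (hpos : ∀ x ∈ Set.Icc a b, 0 ≤ H' x)
    (hb : ∀ x ∈ Set.Icc a b, ‖Z' x‖ ≤ H' x * ‖Z x‖) :
    ‖Z b - Z a‖ ≤ (exp (H b - H a) - 1) * ‖Z a‖ := by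
  have key := image_norm_le_of_norm_deriv_right_le_deriv_boundary' (f := fun x => Z x - Z a)
    (f' := Z') (a := a) (b := b) (B := fun x => (exp (H x - H a) - 1) * ‖Z a‖)
    (B' := fun x => (exp (H x - H a) * H' x) * ‖Z a‖)
  refine key
    (fun x hx => ((hZ x hx).sub_const _).continuousAt.continuousWithinAt)
    (fun x hx => ((hZ x ⟨hx.1, hx.2.le⟩).sub_const _).hasDerivWithinAt) (by simp)
    ?_ ?_ ?_ (Set.right_mem_Icc.2 hab)
  · exact fun x hx => (((((hH x hx).sub_const _).exp).sub_const _).mul_const _).continuousAt.continuousWithinAt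
  · exact fun x hx => (((((hH x ⟨hx.1, hx.2.le⟩).sub_const _).exp).sub_const _).mul_const _).hasDerivWithinAt
  · intro x hx
    have hx' : x ∈ Set.Icc a b := ⟨hx.1, hx.2.le⟩
    have h1 := norm_le_exp_mul_of_norm_deriv_le hx.1
      (fun y hy => hZ y ⟨hy.1, hy.2.trans hx'.2⟩) (fun y hy => hH y ⟨hy.1, hy.2.trans hx'.2⟩)
      (fun y hy => hb y ⟨hy.1, hy.2.trans hx'.2⟩)
    calc _ ≤ H' x * ‖Z x‖ := hb x hx'
      _ ≤ H' x * (exp (H x - H a) * ‖Z a‖) := by gcongr; exact hpos x hx'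
      _ = _ := by ring

lemma norm_sub_le_of_norm_deriv_le' {Z Z' : ℝ → ℂ} {H H' : ℝ → ℝ} {a b : ℝ} (hab : a ≤ b)
    (hZ : ∀ x ∈ Set.Icc a b, HasDerivAt Z (Z' x) x)
    (hH : ∀ x ∈ Set.Icc a b, HasDerivAt H (H' x) x)
    (hpos : ∀ x ∈ Set.Icc a b, 0 ≤ H' x)
    (hb : ∀ x ∈ Set.Icc a b, ‖Z' x‖ ≤ H' x * ‖Z x‖) :
    ‖Z a - Z b‖ ≤ (exp (H b - H a) - 1) * ‖Z b‖ := by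
  have hm : ∀ x ∈ Set.Icc a b, a + b - x ∈ Set.Icc a b := fun x hx =>
    ⟨by linarith [hx.2], by linarith [hx.1]⟩
  have h := norm_sub_le_of_norm_deriv_le (Z := fun x => Z (a + b - x))
    (Z' := fun x => -Z' (a + b - x)) (H := fun x => -H (a + b - x))
    (H' := fun x => H' (a + b - x)) hab
    (fun x hx => (hZ _ (hm x hx)).comp_const_sub (a + b) x)
    (fun x hx => by
      have := ((hH _ (hm x hx)).comp_const_sub (a + b) x).neg
      rwa [neg_neg] at this)
    (fun x hx => hpos _ (hm x hx)) (fun x hx => by simpa using hb _ (hm x hx))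
  simpa [neg_add_eq_sub] using h

/-- For a solution `u` of `u'' + Q u = 0` and a function `E` with logarithmic derivative `φ`, the
derivative of `i (u φ - u') E` measures how far `φ` is from solving the Riccati equation. -/
lemma hasDerivAt_riccati {u u' : ℝ → ℝ} {φ E : ℝ → ℂ} {φ' : ℂ} {Q x : ℝ}
    (hu : HasDerivAt u (u' x) x) (hu' : HasDerivAt u' (-(Q * u x)) x)
    (hφ : HasDerivAt φ φ' x) (hE : HasDerivAt E (φ x * E x) x) :
    HasDerivAt (fun y => Complex.I * (u y * φ y - u' y) * E y)
      (Complex.I * u x * (φ' + φ x ^ 2 + Q) * E x) x := by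
  refine ((((hu.ofReal_comp.mul hφ).sub hu'.ofReal_comp).const_mul Complex.I).mul hE).congr_deriv ?_
  simp only [Pi.mul_apply, Pi.sub_apply]
  push_cast
  ring

lemma abs_mul_abs_im_le_norm (u u' : ℝ) (φ E : ℂ) :
    |u| * |φ.im| * ‖E‖ ≤ ‖Complex.I * (u * φ - u') * E‖ := by
  rw [norm_mul, norm_mul, Complex.norm_I, one_mul, ← abs_mul]
  gcongr
  simpa using Complex.abs_im_le_norm (u * φ - u')

lemma norm_riccati_le {u u' k : ℝ} {φ E r : ℂ} (h : ‖r‖ ≤ k * |φ.im|) (hk : 0 ≤ k) :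
    ‖Complex.I * u * r * E‖ ≤ k * ‖Complex.I * (u * φ - u') * E‖ := by
  have := abs_mul_abs_im_le_norm u u' φ E
  calc ‖Complex.I * u * r * E‖ = |u| * ‖r‖ * ‖E‖ := by simp
    _ ≤ |u| * (k * |φ.im|) * ‖E‖ := by gcongr
    _ = k * (|u| * |φ.im| * ‖E‖) := by ring
    _ ≤ _ := by gcongr

/-- The coefficients of `₂F₁(-n, n + α + β + 1; α + 1; -y)` in powers of `y`. -/
noncomputable def hyperCoeff (α β : ℝ) (n ℓ : ℕ) : ℝ :=
  ∏ j ∈ Finset.range ℓ, ((n - j) * (n + α + β + 1 + j)) / ((α + 1 + j) * (j + 1))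

lemma hyperCoeff_zero (α β : ℝ) (n : ℕ) : hyperCoeff α β n 0 = 1 := by simp [hyperCoeff]

lemma hyperCoeff_succ {α : ℝ} (hα : -1 < α) (β : ℝ) (n ℓ : ℕ) :
    hyperCoeff α β n (ℓ + 1) * ((α + 1 + ℓ) * (ℓ + 1)) =
      (n - ℓ) * (n + α + β + 1 + ℓ) * hyperCoeff α β n ℓ := by
  have h : 0 < (α + 1 + ℓ) := by have := ℓ.cast_nonneg (α := ℝ); linarith
  unfold hyperCoeff
  rw [Finset.prod_range_succ]
  field_simp

lemma hyperCoeff_eq_zero {α β : ℝ} {n ℓ : ℕ} (h : n < ℓ) : hyperCoeff α β n ℓ = 0 :=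
  Finset.prod_eq_zero (Finset.mem_range.2 h) (by simp)

/-- The Jacobi polynomial normalised to be `1` at `x = 1`, in the variable `(x - 1) / 2`. -/
noncomputable def normJacobi (α β : ℝ) (n : ℕ) : Polynomial ℝ :=
  ∑ ℓ ∈ Finset.range (n + 1), Polynomial.monomial ℓ (hyperCoeff α β n ℓ)

lemma coeff_normJacobi (α β : ℝ) (n ℓ : ℕ) :
    (normJacobi α β n).coeff ℓ = hyperCoeff α β n ℓ := by
  simp only [normJacobi, Polynomial.finsetSum_coeff, Polynomial.coeff_monomial,
    Finset.sum_ite_eq', Finset.mem_range]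
  split_ifs with h
  · rfl
  · exact (hyperCoeff_eq_zero (by omega)).symm

lemma eval_zero_normJacobi (α β : ℝ) (n : ℕ) : (normJacobi α β n).eval 0 = 1 := by
  rw [← Polynomial.coeff_zero_eq_eval_zero, coeff_normJacobi, hyperCoeff_zero]

lemma jacobiP_eq {α : ℝ} (hα : -1 < α) (β : ℝ) (n : ℕ) (x : ℝ) :
    jacobiP α β n x = (ascPochhammer ℝ n).eval (α + 1) / n.factorial *
      (normJacobi α β n).eval ((x - 1) / 2) := by
  unfold jacobiP normJacobi
  rw [Polynomial.eval_finsetSum, Finset.mul_sum]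
  refine Finset.sum_congr rfl fun ℓ hℓ => ?_
  rw [Polynomial.eval_monomial, ← mul_assoc]
  congr 1
  induction ℓ with
  | zero => simp [hyperCoeff_zero]
  | succ ℓ ih =>
    have hn : ℓ + 1 ≤ n := by simpa [Nat.lt_succ_iff] using hℓ
    specialize ih (Finset.mem_range.2 (by omega))
    obtain ⟨d, rfl⟩ := Nat.exists_eq_add_of_le hn
    have hp : 0 < α + 1 + ℓ := by have := ℓ.cast_nonneg (α := ℝ); linarith
    have hs := hyperCoeff_succ hα β (ℓ + 1 + d) ℓ
    rw [show ℓ + 1 + d - ℓ = d + 1 by omega] at ih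
    rw [show ℓ + 1 + d - (ℓ + 1) = d by omega]
    have e1 : (ascPochhammer ℝ (d + 1)).eval (α + (ℓ : ℝ) + 1) =
        (α + ℓ + 1) * (ascPochhammer ℝ d).eval (α + ((ℓ + 1 : ℕ) : ℝ) + 1) := by
      rw [ascPochhammer_succ_left, Polynomial.eval_mul, Polynomial.eval_X, Polynomial.eval_comp]
      simp only [Polynomial.eval_add, Polynomial.eval_X, Polynomial.eval_one]
      push_cast; ring_nf
    rw [e1, Nat.factorial_succ d] at ih
    rw [ascPochhammer_succ_eval, Nat.factorial_succ ℓ]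
    have hw : hyperCoeff α β (ℓ + 1 + d) (ℓ + 1) = (d + 1) * ((ℓ + 1 + d : ℕ) + α + β + 1 + ℓ) *
        hyperCoeff α β (ℓ + 1 + d) ℓ / ((α + 1 + ℓ) * (ℓ + 1)) := by
      rw [eq_div_iff (by positivity), hs]; push_cast; ring
    rw [hw]
    have : ∀ a b c d : ℝ, a * (b * c / d) = (a * c) * (b / d) := fun a b c d => by ring
    rw [this, ← ih]
    push_cast
    have hp' : α + ℓ + 1 ≠ 0 := by linarith
    have hp'' : α + 1 + ℓ ≠ 0 := by linarith
    field_simp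
    ring

lemma jacobi_ode_iff (α β : ℝ) (n : ℕ) (p : Polynomial ℝ) :
    Polynomial.X * p.derivative.derivative + Polynomial.X * (Polynomial.X * p.derivative.derivative)
      + Polynomial.C (α + 1) * p.derivative
      + Polynomial.C (α + β + 2) * (Polynomial.X * p.derivative)
      = Polynomial.C (n * (n + α + β + 1)) * p ↔
    ∀ ℓ : ℕ, p.coeff (ℓ + 1) * ((α + 1 + ℓ) * (ℓ + 1)) =
      (n - ℓ) * (n + α + β + 1 + ℓ) * p.coeff ℓ := by
  rw [Polynomial.ext_iff]
  refine forall_congr' fun ℓ => ?_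
  rcases ℓ with _ | _ | ℓ
  · simp [Polynomial.coeff_derivative]
    constructor <;> intro h <;> linarith
  · simp only [zero_add, Polynomial.coeff_add, Polynomial.coeff_C_mul, Polynomial.coeff_X_mul _ 0,
      Polynomial.coeff_derivative, Polynomial.coeff_X_mul_zero]
    push_cast
    constructor <;> intro h <;> linarith
  · simp only [Polynomial.coeff_add, Polynomial.coeff_C_mul, Polynomial.coeff_X_mul,
      Polynomial.coeff_derivative]
    push_cast
    constructor <;> intro h <;> linarith

lemma normJacobi_ode {α : ℝ} (hα : -1 < α) (β : ℝ) (n : ℕ) (y : ℝ) :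
    y * (1 + y) * (normJacobi α β n).derivative.derivative.eval y
      + (α + 1 + (α + β + 2) * y) * (normJacobi α β n).derivative.eval y
      = n * (n + α + β + 1) * (normJacobi α β n).eval y := by
  have h := (jacobi_ode_iff α β n (normJacobi α β n)).2 fun ℓ => by
    rw [coeff_normJacobi, coeff_normJacobi, hyperCoeff_succ hα]
  have h' := congrArg (Polynomial.eval y) h
  simp only [Polynomial.eval_add, Polynomial.eval_mul, Polynomial.eval_C, Polynomial.eval_X] at h'
  linarith

lemma exists_normJacobi_symm {α β : ℝ} (hα : -1 < α) (hβ : -1 < β) (n : ℕ) :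
    ∃ g : ℝ, g ≠ 0 ∧ ∀ y, (normJacobi β α n).eval (-1 - y) = g * (normJacobi α β n).eval y ∧
      (normJacobi β α n).derivative.eval (-1 - y) =
        -(g * (normJacobi α β n).derivative.eval y) := by
  set F := normJacobi β α n with hF
  set p := F.comp (-1 - Polynomial.X) with hp
  have hd : p.derivative = -(F.derivative.comp (-1 - Polynomial.X)) := by
    simp [hp, Polynomial.derivative_comp]
  have hdd : p.derivative.derivative = F.derivative.derivative.comp (-1 - Polynomial.X) := by
    simp [hd, Polynomial.derivative_comp]
  have hc := (jacobi_ode_iff α β n p).1 <| Polynomial.funext fun y => by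
    have h := normJacobi_ode hβ α n (-1 - y)
    have hpe : ∀ y, p.eval y = F.eval (-1 - y) := fun y => by simp [hp, Polynomial.eval_comp]
    rw [hdd, hd]
    simp only [hpe, Polynomial.eval_add, Polynomial.eval_mul, Polynomial.eval_neg,
      Polynomial.eval_C, Polynomial.eval_X, Polynomial.eval_comp, Polynomial.eval_sub,
      Polynomial.eval_one]
    linarith
  have hpF : p = Polynomial.C (p.coeff 0) * normJacobi α β n := by
    ext ℓ
    rw [Polynomial.coeff_C_mul, coeff_normJacobi]
    induction ℓ with
    | zero => rw [hyperCoeff_zero, mul_one]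
    | succ ℓ ih =>
      have h : 0 < (α + 1 + ℓ) * ((ℓ : ℝ) + 1) := by
        have := ℓ.cast_nonneg (α := ℝ)
        have : 0 < α + 1 + ℓ := by linarith
        positivity
      refine mul_right_cancel₀ h.ne' ?_
      rw [hc, mul_assoc (p.coeff 0), hyperCoeff_succ hα, ih]
      ring
  refine ⟨p.coeff 0, fun h0 => ?_, fun y => ⟨?_, ?_⟩⟩
  · rw [h0, Polynomial.C_0, zero_mul] at hpF
    have := congrArg (Polynomial.eval (-1)) hpF
    simp [hp, hF, Polynomial.eval_comp, eval_zero_normJacobi] at this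
  · have := congrArg (Polynomial.eval y) hpF
    simpa [hp, Polynomial.eval_comp] using this
  · have := congrArg (fun p => Polynomial.eval y (Polynomial.derivative p)) hpF
    simp only [hd] at this
    simp [Polynomial.eval_comp] at this
    linarith

lemma hyperCoeff_succ_left {α : ℝ} (hα : -1 < α) (β : ℝ) (n ℓ : ℕ) :
    (n + α + β + 1) * (n + 1 - ℓ) * hyperCoeff α β (n + 1) ℓ =
      (n + 1) * (n + α + β + 1 + ℓ) * hyperCoeff α β n ℓ := by
  induction ℓ with
  | zero => simp [hyperCoeff_zero]; ring
  | succ ℓ ih =>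
    have h : 0 < (α + 1 + ℓ) * ((ℓ : ℝ) + 1) := by
      have := ℓ.cast_nonneg (α := ℝ)
      have : 0 < α + 1 + ℓ := by linarith
      positivity
    refine mul_right_cancel₀ h.ne' ?_
    have h1 := hyperCoeff_succ hα β (n + 1) ℓ
    have h2 := hyperCoeff_succ hα β n ℓ
    push_cast at h1 ⊢
    linear_combination (n + α + β + 1) * (n + 1 - (ℓ + 1)) * h1
      - (n + 1) * (n + α + β + 1 + (ℓ + 1)) * h2 + (n - ℓ) * (n + 1 + α + β + 1 + ℓ) * ih

/-- The coefficients of the two contiguous relations that connect degrees `n` and `n + 1`. -/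
lemma hyperCoeff_ladder {α β : ℝ} (hα : -1 < α) {n : ℕ} (hn : 0 < n + α + β + 1) (ℓ : ℕ) :
    (n + α + β + 1) * (n + 1 + α) * hyperCoeff α β (n + 1) (ℓ + 1) =
      (n + α + β + 1) * (n + 1 + α) * hyperCoeff α β n (ℓ + 1) +
      (2 * n + α + β + 2) * ((ℓ + 1) * hyperCoeff α β n (ℓ + 1) +
        (n + α + β + 1 + ℓ) * hyperCoeff α β n ℓ) ∧
    -((2 * n + α + β + 2) * ((ℓ + 1) * hyperCoeff α β (n + 1) (ℓ + 1) +
        ℓ * hyperCoeff α β (n + 1) ℓ)) =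
      -((n + 1) * (n + 1 + β) * hyperCoeff α β (n + 1) (ℓ + 1)) -
      (n + 1) * (2 * n + α + β + 2) * hyperCoeff α β (n + 1) ℓ +
      (n + 1) * (n + 1 + β) * hyperCoeff α β n (ℓ + 1) := by
  have hl : 0 < (α + 1 + ℓ) * ((ℓ : ℝ) + 1) := by
    have := ℓ.cast_nonneg (α := ℝ)
    have : 0 < α + 1 + ℓ := by linarith
    positivity
  have h1 := hyperCoeff_succ hα β (n + 1) ℓ
  have h2 := hyperCoeff_succ hα β n ℓ
  have h3 := hyperCoeff_succ_left hα β n ℓ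
  push_cast at h1
  constructor
  · refine mul_right_cancel₀ hl.ne' ?_
    linear_combination (n + α + β + 1) * (n + 1 + α) * h1 - ((n + α + β + 1) * (n + 1 + α) +
      (2 * n + α + β + 2) * (ℓ + 1)) * h2 + (n + 1 + α) * (n + 1 + α + β + 1 + ℓ) * h3
  · refine mul_right_cancel₀ (mul_pos hn hl).ne' ?_
    linear_combination (n + α + β + 1) * (-((2 * n + α + β + 2) * (ℓ + 1)) + (n + 1) * (n + 1 + β)) * h1
      - (n + α + β + 1) * (n + 1) * (n + 1 + β) * h2 + ((2 * n + α + β + 2) * ((α + 1 + ℓ) * (ℓ + 1)) +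
        (-((2 * n + α + β + 2) * (ℓ + 1)) + (n + 1) * (n + 1 + β)) * (n + 1 + α + β + 1 + ℓ)) * h3

/-- The contiguous relations at `x = 0`, with `m = n + (α + β) / 2 + 1`, `τ = (α + β) / 2` and
`l = (α - β) / 2`. -/
lemma normJacobi_ladder {α β : ℝ} (hα : -1 < α) {n : ℕ} (hn : 0 < n + α + β + 1) {m τ l : ℝ}
    (hm : m = n + (α + β) / 2 + 1) (hτ : τ = (α + β) / 2) (hl : l = (α - β) / 2) :
    m * ((normJacobi α β n).derivative.eval (-1 / 2) / 2) = (m + τ) *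
      (l * (normJacobi α β n).eval (-1 / 2) - (m + l) * (normJacobi α β (n + 1)).eval (-1 / 2)) ∧
    m * ((normJacobi α β (n + 1)).derivative.eval (-1 / 2) / 2) = (m - τ) *
      (l * (normJacobi α β (n + 1)).eval (-1 / 2) + (m - l) * (normJacobi α β n).eval (-1 / 2)) := by
  subst hm hτ hl
  have h1 : Polynomial.C ((n + α + β + 1) * (n + 1 + α)) * normJacobi α β (n + 1) =
      Polynomial.C ((n + α + β + 1) * (n + 1 + α)) * normJacobi α β n +
      Polynomial.C (2 * n + α + β + 2) * (Polynomial.X * (normJacobi α β n).derivative +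
        Polynomial.X * (Polynomial.X * (normJacobi α β n).derivative) +
        Polynomial.C (n + α + β + 1) * (Polynomial.X * normJacobi α β n)) := by
    ext ℓ
    rcases ℓ with _ | _ | ℓ
    · simp only [Polynomial.coeff_add, Polynomial.coeff_C_mul, Polynomial.coeff_X_mul_zero,
        coeff_normJacobi, hyperCoeff_zero]
      ring
    · have h := (hyperCoeff_ladder hα hn 0).1
      simp only [zero_add, Polynomial.coeff_add, Polynomial.coeff_C_mul, Polynomial.coeff_X_mul _ 0,
        Polynomial.coeff_X_mul_zero, Polynomial.coeff_derivative, coeff_normJacobi]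
      push_cast at h ⊢
      linear_combination h
    · have h := (hyperCoeff_ladder hα hn (ℓ + 1)).1
      simp only [Polynomial.coeff_add, Polynomial.coeff_C_mul, Polynomial.coeff_X_mul,
        Polynomial.coeff_derivative, coeff_normJacobi]
      push_cast at h ⊢
      linear_combination h
  have h2 : Polynomial.C (2 * n + α + β + 2) * (Polynomial.X * (normJacobi α β (n + 1)).derivative +
        Polynomial.X * (Polynomial.X * (normJacobi α β (n + 1)).derivative)) =
      Polynomial.C ((n + 1) * (n + 1 + β)) * (normJacobi α β (n + 1) - normJacobi α β n) +
      Polynomial.C ((n + 1) * (2 * n + α + β + 2)) * (Polynomial.X * normJacobi α β (n + 1)) := by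
    ext ℓ
    rcases ℓ with _ | _ | ℓ
    · simp only [Polynomial.coeff_add, Polynomial.coeff_C_mul, Polynomial.coeff_X_mul_zero,
        Polynomial.coeff_sub, coeff_normJacobi, hyperCoeff_zero]
      ring
    · have h := (hyperCoeff_ladder hα hn 0).2
      simp only [zero_add, Polynomial.coeff_add, Polynomial.coeff_C_mul, Polynomial.coeff_X_mul _ 0,
        Polynomial.coeff_X_mul_zero, Polynomial.coeff_derivative, Polynomial.coeff_sub,
        coeff_normJacobi]
      push_cast at h ⊢
      linear_combination -h
    · have h := (hyperCoeff_ladder hα hn (ℓ + 1)).2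
      simp only [Polynomial.coeff_add, Polynomial.coeff_C_mul, Polynomial.coeff_X_mul,
        Polynomial.coeff_derivative, Polynomial.coeff_sub, coeff_normJacobi]
      push_cast at h ⊢
      linear_combination -h
  have e1 := congrArg (Polynomial.eval (-1 / 2)) h1
  have e2 := congrArg (Polynomial.eval (-1 / 2)) h2
  simp only [Polynomial.eval_add, Polynomial.eval_sub, Polynomial.eval_mul, Polynomial.eval_C,
    Polynomial.eval_X] at e1 e2
  constructor
  · linear_combination e1
  · linear_combination -e2

noncomputable def halfCot (θ : ℝ) : ℝ := cos (θ / 2) / sin (θ / 2)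

noncomputable def halfTan (θ : ℝ) : ℝ := sin (θ / 2) / cos (θ / 2)

lemma sin_half_pos {θ : ℝ} (h : θ ∈ Set.Ioo 0 π) : 0 < sin (θ / 2) :=
  sin_pos_of_pos_of_lt_pi (by linarith [h.1]) (by linarith [h.1, h.2])

lemma cos_half_pos {θ : ℝ} (h : θ ∈ Set.Ioo 0 π) : 0 < cos (θ / 2) :=
  cos_pos_of_mem_Ioo ⟨by linarith [h.1, pi_pos], by linarith [h.2]⟩

lemma hasDerivAt_sin_half (θ : ℝ) : HasDerivAt (fun θ => sin (θ / 2)) (cos (θ / 2) / 2) θ := by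
  refine ((hasDerivAt_id θ).div_const 2).sin.congr_deriv ?_
  simp only [id]; ring

lemma hasDerivAt_cos_half (θ : ℝ) : HasDerivAt (fun θ => cos (θ / 2)) (-sin (θ / 2) / 2) θ := by
  refine ((hasDerivAt_id θ).div_const 2).cos.congr_deriv ?_
  simp only [id]; ring

lemma hasDerivAt_halfCot {θ : ℝ} (h : θ ∈ Set.Ioo 0 π) :
    HasDerivAt halfCot (-(1 + halfCot θ ^ 2) / 2) θ := by
  have hs := (sin_half_pos h).ne'
  refine ((hasDerivAt_cos_half θ).div (hasDerivAt_sin_half θ) hs).congr_deriv ?_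
  unfold halfCot
  field_simp
  ring

lemma hasDerivAt_halfTan {θ : ℝ} (h : θ ∈ Set.Ioo 0 π) :
    HasDerivAt halfTan ((1 + halfTan θ ^ 2) / 2) θ := by
  have hc := (cos_half_pos h).ne'
  refine ((hasDerivAt_sin_half θ).div (hasDerivAt_cos_half θ) hc).congr_deriv ?_
  unfold halfTan
  field_simp
  ring

lemma halfCot_mul_halfTan {θ : ℝ} (h : θ ∈ Set.Ioo 0 π) : halfCot θ * halfTan θ = 1 := by
  have hs := (sin_half_pos h).ne'
  have hc := (cos_half_pos h).ne'
  unfold halfCot halfTan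
  field_simp

/-- The bounded part of the potential in Liouville's normal form of the Jacobi equation. -/
noncomputable def jacobiPot (α β θ : ℝ) : ℝ :=
  ((1 / 4 - α ^ 2) * (1 + halfCot θ ^ 2) + (1 / 4 - β ^ 2) * (1 + halfTan θ ^ 2)) / 4

noncomputable def jacobiFreq (α β : ℝ) (n : ℕ) : ℝ := n + (α + β + 1) / 2

noncomputable def liouWeight (α β θ : ℝ) : ℝ :=
  exp ((α + 1 / 2) * log (sin (θ / 2)) + (β + 1 / 2) * log (cos (θ / 2)))

noncomputable def liouLogDeriv (α β θ : ℝ) : ℝ :=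
  ((α + 1 / 2) * halfCot θ - (β + 1 / 2) * halfTan θ) / 2

/-- The Jacobi polynomial in Liouville's normal form. -/
noncomputable def liouJacobi (α β : ℝ) (n : ℕ) (θ : ℝ) : ℝ :=
  liouWeight α β θ * (normJacobi α β n).eval (-sin (θ / 2) ^ 2)

noncomputable def liouJacobiDeriv (α β : ℝ) (n : ℕ) (θ : ℝ) : ℝ :=
  liouWeight α β θ * (liouLogDeriv α β θ * (normJacobi α β n).eval (-sin (θ / 2) ^ 2) -
    sin (θ / 2) * cos (θ / 2) * (normJacobi α β n).derivative.eval (-sin (θ / 2) ^ 2))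

lemma hasDerivAt_liouWeight (α β : ℝ) {θ : ℝ} (h : θ ∈ Set.Ioo 0 π) :
    HasDerivAt (liouWeight α β) (liouWeight α β θ * liouLogDeriv α β θ) θ := by
  have hs := (sin_half_pos h).ne'
  have hc := (cos_half_pos h).ne'
  refine (((((hasDerivAt_sin_half θ).log hs).const_mul (α + 1 / 2)).add
    (((hasDerivAt_cos_half θ).log hc).const_mul (β + 1 / 2))).exp).congr_deriv ?_
  unfold liouWeight liouLogDeriv halfCot halfTan
  simp only [Pi.add_apply]
  congr 1
  field_simp
  ring

lemma hasDerivAt_neg_sin_half_sq (θ : ℝ) :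
    HasDerivAt (fun θ => -sin (θ / 2) ^ 2) (-(sin (θ / 2) * cos (θ / 2))) θ := by
  refine ((hasDerivAt_sin_half θ).pow 2).neg.congr_deriv ?_
  simp
  ring

lemma hasDerivAt_liouJacobi (α β : ℝ) (n : ℕ) {θ : ℝ} (h : θ ∈ Set.Ioo 0 π) :
    HasDerivAt (liouJacobi α β n) (liouJacobiDeriv α β n θ) θ := by
  refine ((hasDerivAt_liouWeight α β h).mul
    (((normJacobi α β n).hasDerivAt _).comp θ (hasDerivAt_neg_sin_half_sq θ))).congr_deriv ?_
  unfold liouJacobiDeriv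
  simp only [Function.comp]
  ring

lemma hasDerivAt_liouJacobiDeriv {α : ℝ} (hα : -1 < α) (β : ℝ) (n : ℕ) {θ : ℝ}
    (h : θ ∈ Set.Ioo 0 π) :
    HasDerivAt (liouJacobiDeriv α β n)
      (-((jacobiFreq α β n ^ 2 + jacobiPot α β θ) * liouJacobi α β n θ)) θ := by
  have hs := (sin_half_pos h).ne'
  have hc := (cos_half_pos h).ne'
  have hr : HasDerivAt (liouLogDeriv α β) (((α + 1 / 2) * (-(1 + halfCot θ ^ 2) / 2) -
      (β + 1 / 2) * ((1 + halfTan θ ^ 2) / 2)) / 2) θ :=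
    (((hasDerivAt_halfCot h).const_mul _).sub ((hasDerivAt_halfTan h).const_mul _)).div_const 2
  have hF := ((normJacobi α β n).hasDerivAt _).comp θ (hasDerivAt_neg_sin_half_sq θ)
  have hF' := ((normJacobi α β n).derivative.hasDerivAt _).comp θ (hasDerivAt_neg_sin_half_sq θ)
  refine ((hasDerivAt_liouWeight α β h).mul ((hr.mul hF).sub
    (((hasDerivAt_sin_half θ).mul (hasDerivAt_cos_half θ)).mul hF'))).congr_deriv ?_
  have hode := normJacobi_ode hα β n (-sin (θ / 2) ^ 2)
  have hsc := sin_sq_add_cos_sq (θ / 2)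
  simp only [Pi.mul_apply, Pi.sub_apply, Function.comp]
  unfold liouJacobi jacobiPot jacobiFreq liouLogDeriv
  have hP : sin (θ / 2) * halfCot θ = cos (θ / 2) := by unfold halfCot; field_simp
  have hT : cos (θ / 2) * halfTan θ = sin (θ / 2) := by unfold halfTan; field_simp
  have hPT := halfCot_mul_halfTan h
  set s := sin (θ / 2)
  set c := cos (θ / 2)
  set P := halfCot θ
  set T := halfTan θ
  set w := liouWeight α β θ
  set F0 := (normJacobi α β n).eval (-s ^ 2)
  set F1 := (normJacobi α β n).derivative.eval (-s ^ 2)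
  set F2 := (normJacobi α β n).derivative.derivative.eval (-s ^ 2)
  have hc2 : c ^ 2 = 1 - s ^ 2 := by linarith
  have e1 : s * c * P = 1 - s ^ 2 := by rw [mul_right_comm, hP]; linarith
  have e2 : s * c * T = s ^ 2 := by rw [mul_assoc, hT]; ring
  linear_combination (-w) * hode - (w * F0 * (α + 1 / 2) * (β + 1 / 2) / 2) * hPT
    - w * F1 * (α + 1 / 2) * e1 + w * F1 * (β + 1 / 2) * e2 +
    (w * F2 * s ^ 2 - w * F1 / 2) * hc2

lemma tendsto_jacobiFreq (α β : ℝ) : Tendsto (jacobiFreq α β) atTop atTop :=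
  tendsto_atTop_add_const_right _ _ tendsto_natCast_atTop_atTop

lemma tendsto_mul_sin_div (c : ℝ) : Tendsto (fun x : ℝ => x * sin (c / x)) atTop (𝓝 c) := by
  rcases eq_or_ne c 0 with rfl | hc
  · simp
  have h : Tendsto (fun x : ℝ => c * sinc (c / x)) atTop (𝓝 (c * sinc 0)) :=
    ((continuous_sinc.tendsto 0).comp (tendsto_const_nhds.div_atTop tendsto_id)).const_mul c
  rw [sinc_zero, mul_one] at h
  refine h.congr' ?_
  filter_upwards [eventually_gt_atTop 0] with x hx
  rw [sinc_of_ne_zero (by positivity)]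
  field_simp

/-- The coefficients of the even entire function `z ↦ z ^ (-α) * J_α z`, up to normalisation. -/
noncomputable def besselCoeff (α : ℝ) (ℓ : ℕ) : ℝ :=
  ∏ j ∈ Finset.range ℓ, 1 / ((α + 1 + j) * (j + 1))

lemma besselCoeff_nonneg {α : ℝ} (hα : -1 < α) (ℓ : ℕ) : 0 ≤ besselCoeff α ℓ :=
  Finset.prod_nonneg fun j _ => by
    have := j.cast_nonneg (α := ℝ)
    have : 0 < α + 1 + j := by linarith
    positivity

lemma besselCoeff_le {α : ℝ} (hα : -1 < α) (ℓ : ℕ) :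
    besselCoeff α ℓ ≤ (1 / (α + 1)) ^ ℓ / ℓ.factorial := by
  induction ℓ with
  | zero => simp [besselCoeff]
  | succ ℓ ih =>
    have h0 : 0 < α + 1 := by linarith
    have hl := ℓ.cast_nonneg (α := ℝ)
    unfold besselCoeff at ih ⊢
    rw [Finset.prod_range_succ, Nat.factorial_succ]
    calc _ ≤ (1 / (α + 1)) ^ ℓ / ℓ.factorial * (1 / ((α + 1) * (ℓ + 1))) := by
          have : 1 / ((α + 1 + ℓ) * (ℓ + 1)) ≤ 1 / ((α + 1) * ((ℓ : ℝ) + 1)) :=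
            one_div_le_one_div_of_le (by positivity) (by nlinarith)
          exact mul_le_mul ih this (by positivity) (by positivity)
      _ = _ := by push_cast; rw [pow_succ]; field_simp

lemma summable_besselCoeff {α : ℝ} (hα : -1 < α) (x : ℝ) :
    Summable fun ℓ => besselCoeff α ℓ * x ^ ℓ := by
  refine Summable.of_norm_bounded (Real.summable_pow_div_factorial (1 / (α + 1) * |x|)) fun ℓ => ?_
  rw [norm_mul, norm_pow, Real.norm_eq_abs, Real.norm_eq_abs, abs_of_nonneg (besselCoeff_nonneg hα ℓ),
    mul_pow]
  calc _ ≤ (1 / (α + 1)) ^ ℓ / ℓ.factorial * |x| ^ ℓ := by gcongr; exact besselCoeff_le hα ℓ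
    _ = _ := by ring

lemma summable_besselCoeff_succ {α : ℝ} (hα : -1 < α) (x : ℝ) :
    Summable fun ℓ => besselCoeff α (ℓ + 1) * (ℓ + 1) * x ^ ℓ := by
  have h0 : 0 < α + 1 := by linarith
  refine Summable.of_norm_bounded
    ((Real.summable_pow_div_factorial (1 / (α + 1) * |x|)).mul_left (1 / (α + 1))) fun ℓ => ?_
  rw [norm_mul, norm_mul, norm_pow, Real.norm_eq_abs, Real.norm_eq_abs, Real.norm_eq_abs,
    abs_of_nonneg (besselCoeff_nonneg hα _), mul_pow, abs_of_nonneg (by positivity)]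
  calc _ ≤ (1 / (α + 1)) ^ (ℓ + 1) / (ℓ + 1).factorial * (ℓ + 1) * |x| ^ ℓ := by
        gcongr; exact besselCoeff_le hα _
    _ = _ := by rw [Nat.factorial_succ, pow_succ]; push_cast; field_simp

noncomputable def besselSeries (α M : ℝ) : ℝ := ∑' ℓ, besselCoeff α ℓ * (-(M / 2) ^ 2) ^ ℓ

noncomputable def besselSeriesDeriv (α M : ℝ) : ℝ :=
  ∑' ℓ : ℕ, besselCoeff α (ℓ + 1) * (ℓ + 1) * (-(M / 2) ^ 2) ^ ℓ

lemma exists_besselSeries_ne_zero {α : ℝ} (hα : -1 < α) : ∃ M > 0, besselSeries α M ≠ 0 := by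
  have h : Tendsto (besselSeries α) (𝓝[>] 0) (𝓝 (∑' ℓ, besselCoeff α ℓ * (0 : ℝ) ^ ℓ)) := by
    refine tendsto_tsum_of_dominated_convergence (summable_besselCoeff hα (1 / 4)) (fun ℓ => ?_) ?_
    · have : Continuous fun M : ℝ => besselCoeff α ℓ * (-(M / 2) ^ 2) ^ ℓ := by fun_prop
      simpa using (this.tendsto 0).mono_left nhdsWithin_le_nhds
    · filter_upwards [Ioo_mem_nhdsGT (zero_lt_one (α := ℝ))] with M hM ℓ
      rw [norm_mul, norm_pow, Real.norm_eq_abs, Real.norm_eq_abs,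
        abs_of_nonneg (besselCoeff_nonneg hα ℓ), abs_neg, abs_of_nonneg (by positivity)]
      have := besselCoeff_nonneg hα ℓ
      gcongr
      nlinarith [hM.1, hM.2]
  rw [tsum_eq_single 0 (fun ℓ hℓ => by simp [hℓ])] at h
  have h1 : (besselCoeff α 0 * (0 : ℝ) ^ 0) ≠ 0 := by simp [besselCoeff]
  obtain ⟨M, hM, hM'⟩ := ((h.eventually_ne h1).and self_mem_nhdsWithin).exists
  exact ⟨M, hM', hM⟩

lemma tendsto_hyperCoeff (α β : ℝ) (ℓ : ℕ) :
    Tendsto (fun n => hyperCoeff α β n ℓ / (jacobiFreq α β n ^ 2) ^ ℓ) atTop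
      (𝓝 (besselCoeff α ℓ)) := by
  have h : ∀ j : ℕ, Tendsto (fun n : ℕ => ((n - j) * (n + α + β + 1 + j)) /
      ((α + 1 + j) * (j + 1)) / jacobiFreq α β n ^ 2) atTop (𝓝 (1 / ((α + 1 + j) * (j + 1)))) := by
    intro j
    have h1 : Tendsto (fun n : ℕ => (1 - (j + (α + β + 1) / 2) ^ 2 / jacobiFreq α β n ^ 2) /
        ((α + 1 + j) * (j + 1))) atTop (𝓝 ((1 - 0) / ((α + 1 + j) * (j + 1)))) :=
      (tendsto_const_nhds.sub (tendsto_const_nhds.div_atTop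
        ((tendsto_pow_atTop two_ne_zero).comp (tendsto_jacobiFreq α β)))).div_const _
    rw [sub_zero] at h1
    refine h1.congr' ?_
    filter_upwards [(tendsto_jacobiFreq α β).eventually_gt_atTop 0] with n hn
    rw [div_right_comm]
    congr 1
    rw [eq_div_iff (by positivity), sub_mul, div_mul_cancel₀ _ (by positivity)]
    unfold jacobiFreq
    ring
  have := tendsto_finsetProd (Finset.range ℓ) fun j _ => h j
  refine this.congr fun n => ?_
  rw [Finset.prod_div_distrib, Finset.prod_const, Finset.card_range, hyperCoeff]

lemma abs_hyperCoeff_le {α β : ℝ} (hα : -1 < α) {n : ℕ} (hn : 0 < n + α + β + 1)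
    (hκ : 0 < jacobiFreq α β n) (ℓ : ℕ) :
    |hyperCoeff α β n ℓ / (jacobiFreq α β n ^ 2) ^ ℓ| ≤ besselCoeff α ℓ := by
  rcases lt_or_ge n ℓ with h | h
  · rw [hyperCoeff_eq_zero h, zero_div, abs_zero]
    exact besselCoeff_nonneg hα ℓ
  have hfac : ∀ j ∈ Finset.range ℓ, 0 ≤ ((n - j) * (n + α + β + 1 + j)) / ((α + 1 + j) * (j + 1)) ∧
      ((n - j) * (n + α + β + 1 + j)) / ((α + 1 + j) * (j + 1)) ≤
        jacobiFreq α β n ^ 2 * (1 / ((α + 1 + j) * (j + 1))) := by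
    intro j hj
    have hj0 := j.cast_nonneg (α := ℝ)
    have hjn : (j : ℝ) ≤ n := by
      exact_mod_cast (Finset.mem_range.1 hj).le.trans h
    have h1 : 0 < α + 1 + j := by linarith
    have h2 : 0 ≤ (n : ℝ) - j := by linarith
    have h3 : 0 ≤ n + α + β + 1 + j := by linarith
    refine ⟨by positivity, ?_⟩
    rw [mul_one_div]
    gcongr
    unfold jacobiFreq
    nlinarith [sq_nonneg (j + (α + β + 1) / 2)]
  rw [abs_div, abs_of_pos (show 0 < (jacobiFreq α β n ^ 2) ^ ℓ by positivity),
    div_le_iff₀ (by positivity), mul_comm]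
  have h0 : 0 ≤ hyperCoeff α β n ℓ := Finset.prod_nonneg fun j hj => (hfac j hj).1
  rw [abs_of_nonneg h0]
  calc hyperCoeff α β n ℓ ≤ ∏ j ∈ Finset.range ℓ,
        jacobiFreq α β n ^ 2 * (1 / ((α + 1 + j) * (j + 1))) :=
        Finset.prod_le_prod (fun j hj => (hfac j hj).1) fun j hj => (hfac j hj).2
    _ = _ := by rw [Finset.prod_mul_distrib, Finset.prod_const, Finset.card_range, besselCoeff]

lemma eval_normJacobi_eq_tsum (α β : ℝ) (n : ℕ) (y : ℝ) :
    (normJacobi α β n).eval y = ∑' ℓ, hyperCoeff α β n ℓ * y ^ ℓ := by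
  rw [tsum_eq_sum (s := Finset.range (n + 1)) fun ℓ hℓ => by
    rw [hyperCoeff_eq_zero (by simpa [Nat.lt_succ_iff] using hℓ), zero_mul]]
  simp [normJacobi, Polynomial.eval_finsetSum]

lemma eval_derivative_normJacobi_eq_tsum (α β : ℝ) (n : ℕ) (y : ℝ) :
    (normJacobi α β n).derivative.eval y =
      ∑' ℓ : ℕ, hyperCoeff α β n (ℓ + 1) * (ℓ + 1) * y ^ ℓ := by
  rw [tsum_eq_sum (s := Finset.range n) fun ℓ hℓ => by
    rw [hyperCoeff_eq_zero (by simp at hℓ; omega), zero_mul, zero_mul]]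
  have h : (normJacobi α β n).derivative.natDegree < n + 1 := by
    refine lt_of_le_of_lt (Polynomial.natDegree_derivative_le _) ?_
    have : (normJacobi α β n).natDegree ≤ n :=
      Polynomial.natDegree_sum_le_of_forall_le _ _ fun i hi =>
        (Polynomial.natDegree_monomial_le _).trans (by simpa [Nat.lt_succ_iff] using hi)
    omega
  rw [Polynomial.eval_eq_sum_range' h, Finset.sum_range_succ]
  simp [Polynomial.coeff_derivative, coeff_normJacobi, hyperCoeff_eq_zero]

lemma tendsto_freq_sq_mul_sin_sq (α β M : ℝ) :
    Tendsto (fun n => jacobiFreq α β n ^ 2 * -sin (M / jacobiFreq α β n / 2) ^ 2) atTop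
      (𝓝 (-(M / 2) ^ 2)) := by
  have h := (((tendsto_mul_sin_div (M / 2)).comp (tendsto_jacobiFreq α β)).pow 2).neg
  refine h.congr fun n => ?_
  simp only [Function.comp]
  rw [div_right_comm]; ring

lemma abs_freq_sq_mul_sin_sq_le {κ M : ℝ} (hκ : 0 < κ) :
    |κ ^ 2 * -sin (M / κ / 2) ^ 2| ≤ (M / 2) ^ 2 := by
  rw [abs_mul, abs_neg, abs_of_nonneg (sq_nonneg κ), abs_of_nonneg (sq_nonneg _)]
  have h : sin (M / κ / 2) ^ 2 ≤ (M / κ / 2) ^ 2 := sq_le_sq.2 abs_sin_le_abs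
  calc _ ≤ κ ^ 2 * (M / κ / 2) ^ 2 := by gcongr
    _ = _ := by field_simp

/-- The Mehler-Heine limit. -/
lemma tendsto_normJacobi {α : ℝ} (hα : -1 < α) (β M : ℝ) :
    Tendsto (fun n => (normJacobi α β n).eval (-sin (M / jacobiFreq α β n / 2) ^ 2)) atTop
      (𝓝 (besselSeries α M)) := by
  simp only [eval_normJacobi_eq_tsum]
  refine tendsto_tsum_of_dominated_convergence (summable_besselCoeff hα ((M / 2) ^ 2))
    (fun ℓ => ?_) ?_
  · refine ((tendsto_hyperCoeff α β ℓ).mul ((tendsto_freq_sq_mul_sin_sq α β M).pow ℓ)).congr' ?_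
    filter_upwards [(tendsto_jacobiFreq α β).eventually_gt_atTop 0] with n hn
    rw [mul_pow, ← mul_assoc, div_mul_cancel₀ _ (by positivity)]
  · filter_upwards [(tendsto_jacobiFreq α β).eventually_gt_atTop 0,
      (tendsto_natCast_atTop_atTop (R := ℝ)).eventually_gt_atTop (-(α + β + 1))] with n hn hn' ℓ
    have e : hyperCoeff α β n ℓ * (-sin (M / jacobiFreq α β n / 2) ^ 2) ^ ℓ =
        hyperCoeff α β n ℓ / (jacobiFreq α β n ^ 2) ^ ℓ *
        (jacobiFreq α β n ^ 2 * -sin (M / jacobiFreq α β n / 2) ^ 2) ^ ℓ := by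
      rw [mul_pow (jacobiFreq α β n ^ 2), ← mul_assoc, div_mul_cancel₀ _ (by positivity)]
    rw [e, norm_mul, norm_pow, Real.norm_eq_abs, Real.norm_eq_abs]
    have h1 := abs_hyperCoeff_le hα (β := β) (n := n) (by linarith) hn ℓ
    have h2 := abs_freq_sq_mul_sin_sq_le (M := M) hn
    have := besselCoeff_nonneg hα ℓ
    gcongr

lemma tendsto_derivative_normJacobi {α : ℝ} (hα : -1 < α) (β M : ℝ) :
    Tendsto (fun n => (normJacobi α β n).derivative.eval (-sin (M / jacobiFreq α β n / 2) ^ 2) /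
      jacobiFreq α β n ^ 2) atTop (𝓝 (besselSeriesDeriv α M)) := by
  simp only [eval_derivative_normJacobi_eq_tsum, ← tsum_div_const]
  refine tendsto_tsum_of_dominated_convergence (summable_besselCoeff_succ hα ((M / 2) ^ 2))
    (fun ℓ => ?_) ?_
  · refine (((tendsto_hyperCoeff α β (ℓ + 1)).mul_const ((ℓ : ℝ) + 1)).mul
      ((tendsto_freq_sq_mul_sin_sq α β M).pow ℓ)).congr' ?_
    filter_upwards [(tendsto_jacobiFreq α β).eventually_gt_atTop 0] with n hn
    rw [mul_pow, pow_succ (jacobiFreq α β n ^ 2) ℓ]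
    field_simp
  · filter_upwards [(tendsto_jacobiFreq α β).eventually_gt_atTop 0,
      (tendsto_natCast_atTop_atTop (R := ℝ)).eventually_gt_atTop (-(α + β + 1))] with n hn hn' ℓ
    have e : hyperCoeff α β n (ℓ + 1) * (ℓ + 1) * (-sin (M / jacobiFreq α β n / 2) ^ 2) ^ ℓ /
        jacobiFreq α β n ^ 2 = hyperCoeff α β n (ℓ + 1) / (jacobiFreq α β n ^ 2) ^ (ℓ + 1) * (ℓ + 1) *
        (jacobiFreq α β n ^ 2 * -sin (M / jacobiFreq α β n / 2) ^ 2) ^ ℓ := by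
      rw [mul_pow (jacobiFreq α β n ^ 2), pow_succ (jacobiFreq α β n ^ 2) ℓ]
      field_simp
    rw [e, norm_mul, norm_mul, norm_pow, Real.norm_eq_abs, Real.norm_eq_abs, Real.norm_eq_abs,
      abs_of_nonneg (show 0 ≤ (ℓ : ℝ) + 1 by positivity)]
    have h1 := abs_hyperCoeff_le hα (β := β) (n := n) (by linarith) hn (ℓ + 1)
    have h2 := abs_freq_sq_mul_sin_sq_le (M := M) hn
    have := besselCoeff_nonneg hα (ℓ + 1)
    gcongr

lemma abs_jacobiPot_le (α β : ℝ) {θ : ℝ} (h : θ ∈ Set.Ioc 0 (π / 2)) :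
    |jacobiPot α β θ| ≤ (|1 / 4 - α ^ 2| + |1 / 4 - β ^ 2|) * π ^ 2 / 4 / θ ^ 2 := by
  have hθ : θ ∈ Set.Ioo 0 π := ⟨h.1, by linarith [h.2, pi_pos]⟩
  have hs := sin_half_pos hθ
  have hc := cos_half_pos hθ
  have h1 : θ / π ≤ sin (θ / 2) := by
    have := mul_le_sin (x := θ / 2) (by linarith [h.1]) (by linarith [h.2, pi_pos])
    calc _ = 2 / π * (θ / 2) := by ring
      _ ≤ _ := this
  have h2 : θ / π ≤ cos (θ / 2) := by
    refine h1.trans ?_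
    rw [← sin_pi_div_two_sub]
    exact sin_le_sin_of_le_of_le_pi_div_two (by linarith [h.1, pi_pos]) (by linarith [h.1])
      (by linarith [h.2])
  have hθπ : 0 < θ / π := div_pos h.1 pi_pos
  have e1 : 1 + halfCot θ ^ 2 = 1 / sin (θ / 2) ^ 2 := by
    unfold halfCot; field_simp; rw [sin_sq_add_cos_sq]
  have e2 : 1 + halfTan θ ^ 2 = 1 / cos (θ / 2) ^ 2 := by
    unfold halfTan; field_simp; rw [cos_sq_add_sin_sq]
  have b1 : 1 / sin (θ / 2) ^ 2 ≤ 1 / (θ / π) ^ 2 := by gcongr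
  have b2 : 1 / cos (θ / 2) ^ 2 ≤ 1 / (θ / π) ^ 2 := by gcongr
  unfold jacobiPot
  rw [e1, e2, abs_div, abs_of_pos (show (0 : ℝ) < 4 by norm_num)]
  calc _ ≤ (|1 / 4 - α ^ 2| * (1 / (θ / π) ^ 2) + |1 / 4 - β ^ 2| * (1 / (θ / π) ^ 2)) / 4 := by
        gcongr
        refine (abs_add_le _ _).trans ?_
        rw [abs_mul, abs_mul, abs_of_pos (show 0 < 1 / sin (θ / 2) ^ 2 by positivity),
          abs_of_pos (show 0 < 1 / cos (θ / 2) ^ 2 by positivity)]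
        gcongr
    _ = _ := by field_simp

/-- The amplitude of `exp (i κ θ)` in the Liouville form of the Jacobi polynomial. -/
noncomputable def jacobiWave (α β : ℝ) (n : ℕ) (θ : ℝ) : ℂ :=
  Complex.I * (liouJacobi α β n θ * -(Complex.I * jacobiFreq α β n) - liouJacobiDeriv α β n θ) *
    Complex.exp (-(Complex.I * jacobiFreq α β n) * θ)

lemma hasDerivAt_jacobiWave {α : ℝ} (hα : -1 < α) (β : ℝ) (n : ℕ) {θ : ℝ} (h : θ ∈ Set.Ioo 0 π) :
    HasDerivAt (jacobiWave α β n) (Complex.I * liouJacobi α β n θ * jacobiPot α β θ *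
      Complex.exp (-(Complex.I * jacobiFreq α β n) * θ)) θ := by
  have hE : HasDerivAt (fun x : ℝ => Complex.exp (-(Complex.I * jacobiFreq α β n) * x))
      (-(Complex.I * jacobiFreq α β n) *
        Complex.exp (-(Complex.I * jacobiFreq α β n) * θ)) θ := by
    refine (((hasDerivAt_id θ).ofReal_comp.const_mul
      (-(Complex.I * jacobiFreq α β n))).cexp).congr_deriv ?_
    simp only [id]; push_cast; ring
  refine (hasDerivAt_riccati (hasDerivAt_liouJacobi α β n h) (hasDerivAt_liouJacobiDeriv hα β n h)
    (hasDerivAt_const θ (-(Complex.I * jacobiFreq α β n))) hE).congr_deriv ?_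
  push_cast
  ring_nf
  rw [Complex.I_pow_three]
  ring

lemma norm_deriv_jacobiWave_le {α β : ℝ} {n : ℕ} (hκ : 0 < jacobiFreq α β n) (θ : ℝ) :
    ‖Complex.I * liouJacobi α β n θ * jacobiPot α β θ *
      Complex.exp (-(Complex.I * jacobiFreq α β n) * θ)‖ ≤
      |jacobiPot α β θ| / jacobiFreq α β n * ‖jacobiWave α β n θ‖ := by
  refine norm_riccati_le ?_ (by positivity)
  rw [Complex.norm_real, Real.norm_eq_abs]
  simp [abs_of_pos hκ, hκ.ne']

lemma norm_jacobiWave_sub_le {α : ℝ} (hα : -1 < α) (β : ℝ) : ∃ K > 0, ∀ n : ℕ,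
    0 < jacobiFreq α β n → ∀ a b, 0 < a → a ≤ b → b ≤ π / 2 →
    ‖jacobiWave α β n b - jacobiWave α β n a‖ ≤
      (exp (K / (jacobiFreq α β n * a)) - 1) * ‖jacobiWave α β n a‖ ∧
    ‖jacobiWave α β n a - jacobiWave α β n b‖ ≤
      (exp (K / (jacobiFreq α β n * a)) - 1) * ‖jacobiWave α β n b‖ := by
  set K := (|1 / 4 - α ^ 2| + |1 / 4 - β ^ 2|) * π ^ 2 / 4 + 1 with hK
  have hK0 : 0 < K := by positivity
  refine ⟨K, hK0, fun n hκ a b ha hab hb => ?_⟩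
  set κ := jacobiFreq α β n
  have hZ : ∀ x ∈ Set.Icc a b, HasDerivAt (jacobiWave α β n) _ x := fun x hx =>
    hasDerivAt_jacobiWave hα β n ⟨by linarith [hx.1], by linarith [hx.2, pi_pos]⟩
  have hH : ∀ x ∈ Set.Icc a b, HasDerivAt (fun x => -(K / (κ * x))) (K / (κ * x ^ 2)) x := by
    intro x hx
    have hx0 : x ≠ 0 := by linarith [hx.1]
    refine (((hasDerivAt_const x K).div ((hasDerivAt_id x).const_mul κ)
      (mul_ne_zero hκ.ne' hx0)).neg).congr_deriv ?_
    simp only [id]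
    field_simp
    ring
  have hp : ∀ x ∈ Set.Icc a b, 0 ≤ K / (κ * x ^ 2) := fun x _ => by positivity
  have hbd : ∀ x ∈ Set.Icc a b, ‖Complex.I * liouJacobi α β n x * jacobiPot α β x *
      Complex.exp (-(Complex.I * jacobiFreq α β n) * x)‖ ≤
      K / (κ * x ^ 2) * ‖jacobiWave α β n x‖ := by
    intro x hx
    have hx0 : 0 < x := by linarith [hx.1]
    refine (norm_deriv_jacobiWave_le hκ x).trans ?_
    refine mul_le_mul_of_nonneg_right ?_ (norm_nonneg _)
    rw [mul_comm κ, ← div_div]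
    gcongr
    refine (abs_jacobiPot_le α β ⟨hx0, by linarith [hx.2]⟩).trans ?_
    gcongr
    linarith
  have hexp : exp (-(K / (κ * b)) - -(K / (κ * a))) - 1 ≤ exp (K / (κ * a)) - 1 := by
    have hb0 : 0 < b := by linarith
    have : 0 ≤ K / (κ * b) := by positivity
    gcongr
    linarith
  exact ⟨(norm_sub_le_of_norm_deriv_le hab hZ hH hp hbd).trans (by gcongr),
    (norm_sub_le_of_norm_deriv_le' hab hZ hH hp hbd).trans (by gcongr)⟩

/-- The Mehler–Heine limit of `jacobiWave α β n (M / κ)`, up to normalisation. -/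
noncomputable def besselWave (α M : ℝ) : ℂ :=
  exp ((α + 1 / 2) * log (M / 2)) * (Complex.I * (besselSeries α M * -Complex.I -
    ((α + 1 / 2) / M * besselSeries α M - M / 2 * besselSeriesDeriv α M : ℝ))) *
    Complex.exp (-(Complex.I * M))

lemma tendsto_jacobiWave {α : ℝ} (hα : -1 < α) (β : ℝ) {M : ℝ} (hM : 0 < M) :
    Tendsto (fun n => ((exp ((α + 1 / 2) * log (jacobiFreq α β n)) / jacobiFreq α β n : ℝ) : ℂ) *
      jacobiWave α β n (M / jacobiFreq α β n)) atTop (𝓝 (besselWave α M)) := by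
  have hκ := tendsto_jacobiFreq α β
  have hF := tendsto_normJacobi hα β M
  have hF' := tendsto_derivative_normJacobi hα β M
  have hz : Tendsto (fun n => M / jacobiFreq α β n / 2) atTop (𝓝 0) := by
    simpa using (hκ.const_div_atTop M).div_const 2
  have hs : Tendsto (fun n => jacobiFreq α β n * sin (M / jacobiFreq α β n / 2)) atTop
      (𝓝 (M / 2)) := by
    refine ((tendsto_mul_sin_div (M / 2)).comp hκ).congr fun n => ?_
    simp only [Function.comp]
    congr 2
    ring
  have hs0 : Tendsto (fun n => sin (M / jacobiFreq α β n / 2)) atTop (𝓝 0) := by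
    simpa [Function.comp_def] using (continuous_sin.tendsto 0).comp hz
  have hc : Tendsto (fun n => cos (M / jacobiFreq α β n / 2)) atTop (𝓝 1) := by
    simpa [Function.comp_def] using (continuous_cos.tendsto 0).comp hz
  have hW : Tendsto (fun n => exp ((α + 1 / 2) *
      log (jacobiFreq α β n * sin (M / jacobiFreq α β n / 2)) +
      (β + 1 / 2) * log (cos (M / jacobiFreq α β n / 2)))) atTop
      (𝓝 (exp ((α + 1 / 2) * log (M / 2)))) := by
    refine (continuous_exp.tendsto _).comp ?_
    have := ((hs.log (by positivity)).const_mul (α + 1 / 2)).add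
      ((hc.log one_ne_zero).const_mul (β + 1 / 2))
    simpa using this
  have hR : Tendsto (fun n => ((α + 1 / 2) * (cos (M / jacobiFreq α β n / 2) /
      (jacobiFreq α β n * sin (M / jacobiFreq α β n / 2))) -
      (β + 1 / 2) * (sin (M / jacobiFreq α β n / 2) / cos (M / jacobiFreq α β n / 2) *
        (jacobiFreq α β n)⁻¹)) / 2 *
      (normJacobi α β n).eval (-sin (M / jacobiFreq α β n / 2) ^ 2) -
      jacobiFreq α β n * sin (M / jacobiFreq α β n / 2) * cos (M / jacobiFreq α β n / 2) *
      ((normJacobi α β n).derivative.eval (-sin (M / jacobiFreq α β n / 2) ^ 2) /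
      jacobiFreq α β n ^ 2)) atTop (𝓝 (((α + 1 / 2) * (1 / (M / 2)) - (β + 1 / 2) * (0 / 1 * 0)) / 2 *
        besselSeries α M - M / 2 * 1 * besselSeriesDeriv α M)) :=
    (((((hc.div hs (by positivity)).const_mul _).sub
      (((hs0.div hc one_ne_zero).mul hκ.inv_tendsto_atTop).const_mul _)).div_const 2).mul hF).sub
      ((hs.mul hc).mul hF')
  have hlim := (hW.ofReal.mul ((((hF.ofReal.mul_const (-Complex.I)).sub hR.ofReal).const_mul
    Complex.I))).mul_const (Complex.exp (-(Complex.I * M)))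
  have e : ((α + 1 / 2) * (1 / (M / 2)) - (β + 1 / 2) * (0 / 1 * 0)) / 2 *
        besselSeries α M - M / 2 * 1 * besselSeriesDeriv α M =
        (α + 1 / 2) / M * besselSeries α M - M / 2 * besselSeriesDeriv α M := by
    field_simp; ring
  rw [e] at hlim
  refine hlim.congr' ?_
  filter_upwards [hκ.eventually_gt_atTop (M / π), hκ.eventually_gt_atTop 0] with n hn hn0
  have hθ : M / jacobiFreq α β n ∈ Set.Ioo 0 π := by
    refine ⟨by positivity, ?_⟩
    rw [div_lt_iff₀ hn0]; rwa [div_lt_iff₀' pi_pos] at hn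
  have hsp := sin_half_pos hθ
  have hcp := cos_half_pos hθ
  set κ := jacobiFreq α β n with hκdef
  have hκC : (κ : ℂ) ≠ 0 := Complex.ofReal_ne_zero.2 hn0.ne'
  have eW : exp ((α + 1 / 2) * log (κ * sin (M / κ / 2)) +
      (β + 1 / 2) * log (cos (M / κ / 2))) =
      exp ((α + 1 / 2) * log κ) * liouWeight α β (M / κ) := by
    rw [liouWeight, ← exp_add, log_mul hn0.ne' hsp.ne']
    congr 1; ring
  have eE : Complex.exp (-(Complex.I * κ) * (M / κ : ℝ)) = Complex.exp (-(Complex.I * M)) := by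
    congr 1; push_cast; field_simp
  have eR : ((α + 1 / 2) * (cos (M / κ / 2) / (κ * sin (M / κ / 2))) -
      (β + 1 / 2) * (sin (M / κ / 2) / cos (M / κ / 2) * κ⁻¹)) / 2 *
      (normJacobi α β n).eval (-sin (M / κ / 2) ^ 2) -
      κ * sin (M / κ / 2) * cos (M / κ / 2) *
      ((normJacobi α β n).derivative.eval (-sin (M / κ / 2) ^ 2) / κ ^ 2) =
      (liouLogDeriv α β (M / κ) * (normJacobi α β n).eval (-sin (M / κ / 2) ^ 2) -
    sin (M / κ / 2) * cos (M / κ / 2) *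
      (normJacobi α β n).derivative.eval (-sin (M / κ / 2) ^ 2)) / κ := by
    unfold liouLogDeriv halfCot halfTan
    field_simp
  rw [eW, eR]
  unfold jacobiWave liouJacobi liouJacobiDeriv
  rw [← hκdef, eE]
  push_cast
  field_simp

lemma exists_besselWave_ne_zero {α : ℝ} (hα : -1 < α) : ∃ m > 0, ∀ M ≥ m, besselWave α M ≠ 0 := by
  obtain ⟨m, hm, hG⟩ := exists_besselSeries_ne_zero hα
  obtain ⟨K, hK, hgr⟩ := norm_jacobiWave_sub_le hα 0
  have h0 : besselWave α m ≠ 0 := by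
    unfold besselWave
    refine mul_ne_zero (mul_ne_zero (Complex.ofReal_ne_zero.2 (exp_ne_zero _))
      (mul_ne_zero Complex.I_ne_zero fun h => hG ?_)) (Complex.exp_ne_zero _)
    simpa using congrArg Complex.im h
  refine ⟨m, hm, fun M hM h => h0 ?_⟩
  have hM0 : 0 < M := hm.trans_le hM
  have h1 := (tendsto_jacobiWave hα 0 hm).norm
  have h2 := ((tendsto_jacobiWave hα 0 hM0).norm).const_mul (exp (K / m))
  rw [h, norm_zero, mul_zero] at h2
  refine norm_le_zero_iff.1 (le_of_tendsto_of_tendsto h1 h2 ?_)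
  have hκ := tendsto_jacobiFreq α 0
  filter_upwards [hκ.eventually_ge_atTop (M / (π / 2)), hκ.eventually_gt_atTop 0] with n hn hn0
  have hb : M / jacobiFreq α 0 n ≤ π / 2 := by
    rw [div_le_iff₀ hn0]; rwa [div_le_iff₀' (by positivity)] at hn
  have h3 := (hgr n hn0 (m / jacobiFreq α 0 n) (M / jacobiFreq α 0 n) (by positivity)
    (by gcongr) hb).2
  rw [mul_div_cancel₀ _ hn0.ne'] at h3
  have h4 := norm_le_norm_sub_add (jacobiWave α 0 n (m / jacobiFreq α 0 n))
    (jacobiWave α 0 n (M / jacobiFreq α 0 n))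
  rw [norm_mul, norm_mul, ← mul_assoc, mul_comm (exp _), mul_assoc]
  gcongr
  linarith

/-- The deviation at `π / 2` of the leading-order phase from its limiting value. -/
noncomputable def leadAngle (α β : ℝ) (n : ℕ) : ℝ :=
  axisAngle (jacobiWave α β n (π / 2) * Complex.exp (Complex.I * ((α / 2 + 1 / 4) * π : ℝ)))

lemma eventually_leadAngle_sub_le {α : ℝ} (hα : -1 < α) (β : ℝ) {ε : ℝ} (hε : 0 < ε) :
    ∀ᶠ M in atTop, ∀ᶠ n in atTop, |leadAngle α β n -
      axisAngle (besselWave α M * Complex.exp (Complex.I * ((α / 2 + 1 / 4) * π : ℝ)))| ≤ ε := by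
  obtain ⟨m, hm, hne⟩ := exists_besselWave_ne_zero hα
  obtain ⟨K, hK, hgr⟩ := norm_jacobiWave_sub_le hα β
  have hlim : Tendsto (fun M => 2 * (exp (K / M) - 1)) atTop (𝓝 0) := by
    have h1 := (continuous_exp.tendsto 0).comp (tendsto_id.const_div_atTop K)
    simpa using (h1.sub_const 1).const_mul 2
  filter_upwards [hlim.eventually_le_const (half_pos hε), eventually_ge_atTop m] with M hMε hMm
  have hM0 : 0 < M := hm.trans_le hMm
  set c := Complex.exp (Complex.I * ((α / 2 + 1 / 4) * π : ℝ)) with hc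
  have hcn : ‖c‖ = 1 := by rw [hc, mul_comm, Complex.norm_exp_ofReal_mul_I]
  have hτ := ((continuousAt_axisAngle (mul_ne_zero (hne M hMm)
    (Complex.exp_ne_zero (Complex.I * ((α / 2 + 1 / 4) * π : ℝ))))).tendsto).comp
    ((tendsto_jacobiWave hα β hM0).mul_const c)
  have hκ := tendsto_jacobiFreq α β
  filter_upwards [hκ.eventually_ge_atTop (M / (π / 2)), hκ.eventually_gt_atTop 0,
    Metric.tendsto_nhds.1 hτ (ε / 2) (half_pos hε)] with n hn hn0 hτn
  have hb : M / jacobiFreq α β n ≤ π / 2 := by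
    rw [div_le_iff₀ hn0]; rwa [div_le_iff₀' (by positivity)] at hn
  have h1 := (hgr n hn0 (M / jacobiFreq α β n) (π / 2) (by positivity) hb le_rfl).1
  rw [mul_div_cancel₀ _ hn0.ne'] at h1
  have h2 : |leadAngle α β n - axisAngle (jacobiWave α β n (M / jacobiFreq α β n) * c)| ≤
      2 * (exp (K / M) - 1) := by
    refine axisAngle_sub_le (by linarith [add_one_le_exp (K / M), div_pos hK hM0]) ?_
    rw [← sub_mul, norm_mul, norm_mul, hcn, mul_one, mul_one]
    exact h1
  simp only [Function.comp, mul_assoc] at hτn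
  rw [axisAngle_real_mul (by positivity), Real.dist_eq] at hτn
  calc _ ≤ _ := abs_sub_le _ (axisAngle (jacobiWave α β n (M / jacobiFreq α β n) * c)) _
    _ ≤ ε / 2 + ε / 2 := add_le_add (h2.trans hMε) hτn.le
    _ = ε := by ring

lemma tendsto_leadAngle_sub {α : ℝ} (hα : -1 < α) (β β' : ℝ) :
    Tendsto (fun n => leadAngle α β n - leadAngle α β' n) atTop (𝓝 0) := by
  rw [Metric.tendsto_nhds]
  intro ε hε
  obtain ⟨M, h1, h2⟩ := ((eventually_leadAngle_sub_le hα β (show 0 < ε / 3 by positivity)).and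
    (eventually_leadAngle_sub_le hα β' (show 0 < ε / 3 by positivity))).exists
  filter_upwards [h1, h2] with n h1 h2
  rw [Real.dist_0_eq_abs]
  rw [abs_sub_comm] at h2
  linarith [abs_sub_le (leadAngle α β n) (axisAngle (besselWave α M *
    Complex.exp (Complex.I * ((α / 2 + 1 / 4) * π : ℝ)))) (leadAngle α β' n)]

lemma sin_sq_pi_div_four : sin (π / 2 / 2) ^ 2 = 1 / 2 := by
  rw [div_div, show (2 : ℝ) * 2 = 4 by norm_num, sin_pi_div_four, div_pow, sq_sqrt (by norm_num)]
  norm_num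

lemma sin_mul_cos_pi_div_four : sin (π / 2 / 2) * cos (π / 2 / 2) = 1 / 2 := by
  rw [← sin_sq_pi_div_four, div_div, show (2 : ℝ) * 2 = 4 by norm_num, cos_pi_div_four,
    sin_pi_div_four, sq]

lemma halfCot_pi_div_two : halfCot (π / 2) = 1 := by
  rw [halfCot, div_div, show (2 : ℝ) * 2 = 4 by norm_num, cos_pi_div_four, sin_pi_div_four,
    div_self (by positivity)]

lemma halfTan_pi_div_two : halfTan (π / 2) = 1 := by
  rw [halfTan, div_div, show (2 : ℝ) * 2 = 4 by norm_num, cos_pi_div_four, sin_pi_div_four,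
    div_self (by positivity)]

lemma liouJacobi_pi_div_two (α β : ℝ) (n : ℕ) : liouJacobi α β n (π / 2) =
    liouWeight α β (π / 2) * (normJacobi α β n).eval (-1 / 2) := by
  rw [liouJacobi, sin_sq_pi_div_four, neg_div]

lemma liouJacobiDeriv_pi_div_two (α β : ℝ) (n : ℕ) : liouJacobiDeriv α β n (π / 2) =
    liouWeight α β (π / 2) * ((α - β) / 2 * (normJacobi α β n).eval (-1 / 2) -
      (normJacobi α β n).derivative.eval (-1 / 2) / 2) := by
  rw [liouJacobiDeriv, liouLogDeriv, sin_sq_pi_div_four, neg_div, sin_mul_cos_pi_div_four,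
    halfCot_pi_div_two, halfTan_pi_div_two]
  ring

lemma leadAngle_symm {α β : ℝ} (hα : -1 < α) (hβ : -1 < β) (n : ℕ) :
    leadAngle β α n = leadAngle α β n := by
  obtain ⟨g, hg, h⟩ := exists_normJacobi_symm hα hβ n
  obtain ⟨hF, hF'⟩ := h (-1 / 2)
  rw [show (-1 : ℝ) - -1 / 2 = -1 / 2 by norm_num] at hF hF'
  have hw : liouWeight β α (π / 2) = liouWeight α β (π / 2) := by
    unfold liouWeight
    rw [div_div, show (2 : ℝ) * 2 = 4 by norm_num, cos_pi_div_four, sin_pi_div_four, add_comm]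
  have hu : liouJacobi β α n (π / 2) = g * liouJacobi α β n (π / 2) := by
    rw [liouJacobi_pi_div_two, liouJacobi_pi_div_two, hF, hw]; ring
  have hu' : liouJacobiDeriv β α n (π / 2) = -(g * liouJacobiDeriv α β n (π / 2)) := by
    rw [liouJacobiDeriv_pi_div_two, liouJacobiDeriv_pi_div_two, hF, hF', hw]; ring
  have hκ : jacobiFreq β α n = jacobiFreq α β n := by unfold jacobiFreq; ring
  have hph : Complex.exp (-(Complex.I * jacobiFreq α β n) * (π / 2 : ℝ)) *
      Complex.exp (Complex.I * ((β / 2 + 1 / 4) * π : ℝ)) = ((-1) ^ n : ℝ) *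
      (Complex.exp (Complex.I * jacobiFreq α β n * (π / 2 : ℝ)) *
      Complex.exp (-(Complex.I * ((α / 2 + 1 / 4) * π : ℝ)))) := by
    have e : ((-1) ^ n : ℝ) = Complex.exp (-(n * (π * Complex.I))) := by
      rw [Complex.exp_neg, Complex.exp_nat_mul, Complex.exp_pi_mul_I]
      push_cast
      rcases n.even_or_odd with h | h <;> simp [h.neg_one_pow]
    rw [e, ← Complex.exp_add, ← Complex.exp_add, ← Complex.exp_add]
    congr 1
    unfold jacobiFreq
    push_cast
    ring
  unfold leadAngle
  rw [← axisAngle_conj (jacobiWave α β n (π / 2) * _),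
    ← axisAngle_real_mul (mul_ne_zero hg (pow_ne_zero n (neg_ne_zero.2 one_ne_zero)) :
      g * (-1 : ℝ) ^ n ≠ 0) (starRingEnd ℂ _)]
  congr 1
  unfold jacobiWave
  rw [hu, hu', hκ, mul_assoc, hph]
  simp only [map_mul, map_sub, map_neg, Complex.conj_I, Complex.conj_ofReal, ← Complex.exp_conj]
  push_cast
  ring_nf

lemma leadAngle_neg_half (n : ℕ) : leadAngle (-1 / 2) (-1 / 2) n = 0 := by
  set Z := jacobiWave (-1 / 2) (-1 / 2) n
  have hZ : ∀ θ ∈ Set.Ioo 0 π, HasDerivAt Z 0 θ := fun θ hθ => by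
    refine (hasDerivAt_jacobiWave (by norm_num) (-1 / 2) n hθ).congr_deriv ?_
    have : jacobiPot (-1 / 2) (-1 / 2) θ = 0 := by unfold jacobiPot; norm_num
    simp [this]
  have hconst : ∀ θ ∈ Set.Ioo 0 π, Z θ = Z (π / 2) := fun θ hθ => by
    refine isOpen_Ioo.is_const_of_deriv_eq_zero (convex_Ioo 0 π).isPreconnected
      (fun x hx => (hZ x hx).differentiableAt.differentiableWithinAt) (fun x hx => (hZ x hx).deriv)
      hθ ⟨by positivity, by linarith [pi_pos]⟩
  set Y : ℝ → ℂ := fun θ => Complex.I * (((normJacobi (-1 / 2) (-1 / 2) n).eval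
    (-sin (θ / 2) ^ 2) : ℝ) * -(Complex.I * jacobiFreq (-1 / 2) (-1 / 2) n) -
    (-(sin (θ / 2) * cos (θ / 2) * (normJacobi (-1 / 2) (-1 / 2) n).derivative.eval
    (-sin (θ / 2) ^ 2)) : ℝ)) * Complex.exp (-(Complex.I * jacobiFreq (-1 / 2) (-1 / 2) n) * θ)
  have hY : Continuous Y := by
    have h1 : Continuous fun θ : ℝ => (normJacobi (-1 / 2) (-1 / 2) n).eval (-sin (θ / 2) ^ 2) :=
      (normJacobi (-1 / 2) (-1 / 2) n).continuous.comp (by fun_prop)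
    have h2 : Continuous fun θ : ℝ =>
        (normJacobi (-1 / 2) (-1 / 2) n).derivative.eval (-sin (θ / 2) ^ 2) :=
      (normJacobi (-1 / 2) (-1 / 2) n).derivative.continuous.comp (by fun_prop)
    fun_prop
  have hYZ : ∀ θ, Z θ = Y θ := fun θ => by
    have h0 : (-1 / 2 + 1 / 2 : ℝ) = 0 := by norm_num
    simp only [Z, Y, jacobiWave, liouJacobi, liouJacobiDeriv, liouWeight, liouLogDeriv, h0]
    simp
  have hlim : Tendsto Y (𝓝[>] 0) (𝓝 (Y 0)) := (hY.tendsto 0).mono_left nhdsWithin_le_nhds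
  have hlim' : Tendsto Y (𝓝[>] 0) (𝓝 (Z (π / 2))) := by
    refine tendsto_const_nhds.congr' ?_
    filter_upwards [Ioo_mem_nhdsGT pi_pos] with θ hθ
    rw [← hYZ, hconst θ hθ]
  have hv : Z (π / 2) = Y 0 := tendsto_nhds_unique hlim' hlim
  have h0 : (Z (π / 2)).im = 0 := by rw [hv]; simp [Y]
  have hγ : ((-1 / 2 / 2 + 1 / 4) * π : ℝ) = 0 := by ring
  unfold leadAngle
  rw [hγ]
  simp [axisAngle, Z, h0] 

lemma tendsto_leadAngle {α : ℝ} (hα : -1 < α) (β : ℝ) :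
    Tendsto (leadAngle α β) atTop (𝓝 0) := by
  have hh : (-1 : ℝ) < -1 / 2 := by norm_num
  have h := (tendsto_leadAngle_sub hα β (-1 / 2)).add (tendsto_leadAngle_sub hh α (-1 / 2))
  rw [add_zero] at h
  refine h.congr fun n => ?_
  rw [leadAngle_symm hα hh, leadAngle_neg_half]
  ring

/-- First derivative of half the potential. -/
noncomputable def halfPotD1 (α β θ : ℝ) : ℝ :=
  (-((1 / 4 - α ^ 2) * (halfCot θ + halfCot θ ^ 3)) +
    (1 / 4 - β ^ 2) * (halfTan θ + halfTan θ ^ 3)) / 8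

/-- Second derivative of half the potential. -/
noncomputable def halfPotD2 (α β θ : ℝ) : ℝ :=
  ((1 / 4 - α ^ 2) * (1 + 4 * halfCot θ ^ 2 + 3 * halfCot θ ^ 4) +
    (1 / 4 - β ^ 2) * (1 + 4 * halfTan θ ^ 2 + 3 * halfTan θ ^ 4)) / 16

/-- Third derivative of half the potential. -/
noncomputable def halfPotD3 (α β θ : ℝ) : ℝ :=
  (-((1 / 4 - α ^ 2) * (2 * halfCot θ + 5 * halfCot θ ^ 3 + 3 * halfCot θ ^ 5)) +
    (1 / 4 - β ^ 2) * (2 * halfTan θ + 5 * halfTan θ ^ 3 + 3 * halfTan θ ^ 5)) / 8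

/-- Fourth derivative of half the potential. -/
noncomputable def halfPotD4 (α β θ : ℝ) : ℝ :=
  ((1 / 4 - α ^ 2) * (2 + 17 * halfCot θ ^ 2 + 30 * halfCot θ ^ 4 + 15 * halfCot θ ^ 6) +
    (1 / 4 - β ^ 2) * (2 + 17 * halfTan θ ^ 2 + 30 * halfTan θ ^ 4 + 15 * halfTan θ ^ 6)) / 16

noncomputable def halfPot (α β θ : ℝ) : ℝ := jacobiPot α β θ / 2

/-- An antiderivative of half the potential. -/
noncomputable def phaseC1 (α β θ : ℝ) : ℝ :=
  (-((1 / 4 - α ^ 2) * halfCot θ) + (1 / 4 - β ^ 2) * halfTan θ) / 4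

noncomputable def phaseD3 (α β θ : ℝ) : ℝ := -halfPotD2 α β θ / 4 - halfPot α β θ ^ 2 / 2

/-- An antiderivative of `phaseD3`. -/
noncomputable def phaseC3 (α β θ : ℝ) : ℝ :=
  -halfPotD1 α β θ / 4 - (-((1 / 4 - α ^ 2) ^ 2 * (2 * halfCot θ + 2 * halfCot θ ^ 3 / 3)) +
    (1 / 4 - β ^ 2) ^ 2 * (2 * halfTan θ + 2 * halfTan θ ^ 3 / 3) +
    4 * (1 / 4 - α ^ 2) * (1 / 4 - β ^ 2) * (halfTan θ - halfCot θ)) / 128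

noncomputable def ampD4 (α β θ : ℝ) : ℝ :=
  halfPotD3 α β θ / 8 + halfPot α β θ * halfPotD1 α β θ

/-- The phase of the WKB approximation of third order. -/
noncomputable def phase (α β κ θ : ℝ) : ℝ := κ * θ + phaseC1 α β θ / κ + phaseC3 α β θ / κ ^ 3

noncomputable def phaseDeriv (α β κ θ : ℝ) : ℝ := κ + halfPot α β θ / κ + phaseD3 α β θ / κ ^ 3

/-- The logarithm of the inverse amplitude of the WKB approximation of third order. -/
noncomputable def logAmp (α β κ θ : ℝ) : ℝ :=
  -halfPot α β θ / 2 / κ ^ 2 + (halfPotD2 α β θ / 8 + halfPot α β θ ^ 2 / 2) / κ ^ 4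

noncomputable def logAmpDeriv (α β κ θ : ℝ) : ℝ :=
  -halfPotD1 α β θ / 2 / κ ^ 2 + ampD4 α β θ / κ ^ 4

section Derivatives

variable (α β κ : ℝ) {θ : ℝ}

lemma hasDerivAt_phaseC1 (h : θ ∈ Set.Ioo 0 π) :
    HasDerivAt (phaseC1 α β) (halfPot α β θ) θ := by
  have hP := hasDerivAt_halfCot h
  have hT := hasDerivAt_halfTan h
  refine ((((hP.const_mul (1 / 4 - α ^ 2)).neg).add
    (hT.const_mul (1 / 4 - β ^ 2))).div_const 4).congr_deriv ?_
  unfold halfPot jacobiPot; ring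

lemma hasDerivAt_halfPot (h : θ ∈ Set.Ioo 0 π) :
    HasDerivAt (halfPot α β) (halfPotD1 α β θ) θ := by
  have hP := hasDerivAt_halfCot h
  have hT := hasDerivAt_halfTan h
  refine (((((hP.pow 2).const_add 1).const_mul (1 / 4 - α ^ 2)).add
    (((hT.pow 2).const_add 1).const_mul (1 / 4 - β ^ 2))).div_const 4 |>.div_const 2).congr_deriv ?_
  unfold halfPotD1; push_cast; ring

lemma hasDerivAt_halfPotD1 (h : θ ∈ Set.Ioo 0 π) :
    HasDerivAt (halfPotD1 α β) (halfPotD2 α β θ) θ := by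
  have hP := hasDerivAt_halfCot h
  have hT := hasDerivAt_halfTan h
  refine ((((hP.add (hP.pow 3)).const_mul (1 / 4 - α ^ 2)).neg.add
    ((hT.add (hT.pow 3)).const_mul (1 / 4 - β ^ 2))).div_const 8).congr_deriv ?_
  unfold halfPotD2; push_cast; ring

lemma hasDerivAt_halfPotD2 (h : θ ∈ Set.Ioo 0 π) :
    HasDerivAt (halfPotD2 α β) (halfPotD3 α β θ) θ := by
  have hP := hasDerivAt_halfCot h
  have hT := hasDerivAt_halfTan h
  refine ((((((hP.pow 2).const_mul 4).const_add 1).add ((hP.pow 4).const_mul 3)).const_mul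
    (1 / 4 - α ^ 2)).add (((((hT.pow 2).const_mul 4).const_add 1).add
    ((hT.pow 4).const_mul 3)).const_mul (1 / 4 - β ^ 2)) |>.div_const 16).congr_deriv ?_
  unfold halfPotD3; push_cast; ring

lemma hasDerivAt_halfPotD3 (h : θ ∈ Set.Ioo 0 π) :
    HasDerivAt (halfPotD3 α β) (halfPotD4 α β θ) θ := by
  have hP := hasDerivAt_halfCot h
  have hT := hasDerivAt_halfTan h
  refine (((((hP.const_mul 2).add ((hP.pow 3).const_mul 5)).add ((hP.pow 5).const_mul 3)).const_mul
    (1 / 4 - α ^ 2)).neg.add ((((hT.const_mul 2).add ((hT.pow 3).const_mul 5)).add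
    ((hT.pow 5).const_mul 3)).const_mul (1 / 4 - β ^ 2)) |>.div_const 8).congr_deriv ?_
  unfold halfPotD4; push_cast; ring

lemma hasDerivAt_phaseD3 (h : θ ∈ Set.Ioo 0 π) : HasDerivAt (phaseD3 α β)
    (-halfPotD3 α β θ / 4 - halfPot α β θ * halfPotD1 α β θ) θ := by
  refine (((hasDerivAt_halfPotD2 α β h).neg.div_const 4).sub
    (((hasDerivAt_halfPot α β h).pow 2).div_const 2)).congr_deriv ?_
  push_cast; ring

lemma hasDerivAt_phaseC3 (h : θ ∈ Set.Ioo 0 π) :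
    HasDerivAt (phaseC3 α β) (phaseD3 α β θ) θ := by
  have hP := hasDerivAt_halfCot h
  have hT := hasDerivAt_halfTan h
  have hPT := halfCot_mul_halfTan h
  refine (((hasDerivAt_halfPotD1 α β h).neg.div_const 4).sub
    ((((((hP.const_mul 2).add (((hP.pow 3).const_mul 2).div_const 3)).const_mul
      ((1 / 4 - α ^ 2) ^ 2)).neg.add
      (((hT.const_mul 2).add (((hT.pow 3).const_mul 2).div_const 3)).const_mul
      ((1 / 4 - β ^ 2) ^ 2))).add
      ((hT.sub hP).const_mul (4 * (1 / 4 - α ^ 2) * (1 / 4 - β ^ 2)))).div_const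
      128)).congr_deriv ?_
  unfold phaseD3 halfPot jacobiPot; push_cast
  linear_combination (1 / 64) * (1 / 4 - α ^ 2) * (1 / 4 - β ^ 2) *
    (1 + halfCot θ * halfTan θ) * hPT

lemma hasDerivAt_ampD4 (h : θ ∈ Set.Ioo 0 π) : HasDerivAt (ampD4 α β)
    (halfPotD4 α β θ / 8 + halfPotD1 α β θ ^ 2 + halfPot α β θ * halfPotD2 α β θ) θ := by
  refine (((hasDerivAt_halfPotD3 α β h).div_const 8).add
    ((hasDerivAt_halfPot α β h).mul (hasDerivAt_halfPotD1 α β h))).congr_deriv ?_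
  ring

lemma hasDerivAt_phase (h : θ ∈ Set.Ioo 0 π) :
    HasDerivAt (phase α β κ) (phaseDeriv α β κ θ) θ := by
  refine ((((hasDerivAt_id θ).const_mul κ).add ((hasDerivAt_phaseC1 α β h).div_const κ)).add
    ((hasDerivAt_phaseC3 α β h).div_const (κ ^ 3))).congr_deriv ?_
  unfold phaseDeriv; ring

lemma hasDerivAt_phaseDeriv (h : θ ∈ Set.Ioo 0 π) : HasDerivAt (phaseDeriv α β κ)
    (halfPotD1 α β θ / κ +
      (-halfPotD3 α β θ / 4 - halfPot α β θ * halfPotD1 α β θ) / κ ^ 3) θ :=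
  (((hasDerivAt_halfPot α β h).div_const κ).const_add κ).add
    ((hasDerivAt_phaseD3 α β h).div_const (κ ^ 3))

lemma hasDerivAt_logAmp (h : θ ∈ Set.Ioo 0 π) :
    HasDerivAt (logAmp α β κ) (logAmpDeriv α β κ θ) θ := by
  refine (((hasDerivAt_halfPot α β h).neg.div_const 2 |>.div_const (κ ^ 2)).add
    ((((hasDerivAt_halfPotD2 α β h).div_const 8).add
    (((hasDerivAt_halfPot α β h).pow 2).div_const 2)).div_const (κ ^ 4))).congr_deriv ?_
  unfold logAmpDeriv ampD4; push_cast; ring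

lemma hasDerivAt_logAmpDeriv (h : θ ∈ Set.Ioo 0 π) : HasDerivAt (logAmpDeriv α β κ)
    (-halfPotD2 α β θ / 2 / κ ^ 2 + (halfPotD4 α β θ / 8 + halfPotD1 α β θ ^ 2 +
      halfPot α β θ * halfPotD2 α β θ) / κ ^ 4) θ :=
  ((hasDerivAt_halfPotD1 α β h).neg.div_const 2 |>.div_const (κ ^ 2)).add
    ((hasDerivAt_ampD4 α β h).div_const (κ ^ 4))

end Derivatives

lemma continuousOn_halfCot : ContinuousOn halfCot (Set.Ioo 0 π) := fun _ h =>
  (hasDerivAt_halfCot h).continuousAt.continuousWithinAt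

lemma continuousOn_halfTan : ContinuousOn halfTan (Set.Ioo 0 π) := fun _ h =>
  (hasDerivAt_halfTan h).continuousAt.continuousWithinAt

lemma exists_abs_le_of_continuousOn {f : ℝ → ℝ} (hf : ContinuousOn f (Set.Ioo 0 π)) {δ : ℝ}
    (hδ : 0 < δ) : ∃ K > 0, ∀ θ ∈ Set.Icc δ (π - δ), |f θ| ≤ K := by
  obtain ⟨K, hK⟩ := isCompact_Icc.exists_bound_of_continuousOn (s := Set.Icc δ (π - δ))
    (hf.mono fun x hx => ⟨by linarith [hx.1], by linarith [hx.2]⟩)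
  exact ⟨|K| + 1, by positivity, fun θ hθ => (hK θ hθ).trans (by linarith [le_abs_self K])⟩

/-- The defect in the Riccati equation of the logarithmic derivative of the WKB approximation. -/
noncomputable def wkbDefect (α β κ θ : ℝ) : ℂ :=
  (((halfPotD4 α β θ / 8 + halfPotD1 α β θ ^ 2 + halfPot α β θ * halfPotD2 α β θ +
    halfPotD1 α β θ ^ 2 / 4 - 2 * halfPot α β θ * phaseD3 α β θ) / κ ^ 4 +
    (-halfPotD1 α β θ * ampD4 α β θ - phaseD3 α β θ ^ 2) / κ ^ 6 +
    ampD4 α β θ ^ 2 / κ ^ 8 : ℝ) : ℂ) -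
  Complex.I * (((-halfPotD1 α β θ * phaseD3 α β θ + 2 * ampD4 α β θ * halfPot α β θ) / κ ^ 5 +
    2 * ampD4 α β θ * phaseD3 α β θ / κ ^ 7 : ℝ) : ℂ)

lemma continuousOn_halfPots (α β : ℝ) : ContinuousOn (halfPot α β) (Set.Ioo 0 π) ∧
    ContinuousOn (halfPotD1 α β) (Set.Ioo 0 π) ∧ ContinuousOn (halfPotD2 α β) (Set.Ioo 0 π) ∧
    ContinuousOn (halfPotD4 α β) (Set.Ioo 0 π) ∧ ContinuousOn (phaseD3 α β) (Set.Ioo 0 π) ∧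
    ContinuousOn (ampD4 α β) (Set.Ioo 0 π) := by
  have hP := continuousOn_halfCot
  have hT := continuousOn_halfTan
  have h0 : ContinuousOn (halfPot α β) (Set.Ioo 0 π) := fun _ h =>
    (hasDerivAt_halfPot α β h).continuousAt.continuousWithinAt
  refine ⟨h0, fun _ h => (hasDerivAt_halfPotD1 α β h).continuousAt.continuousWithinAt,
    fun _ h => (hasDerivAt_halfPotD2 α β h).continuousAt.continuousWithinAt, ?_,
    fun _ h => (hasDerivAt_phaseD3 α β h).continuousAt.continuousWithinAt,
    fun _ h => (hasDerivAt_ampD4 α β h).continuousAt.continuousWithinAt⟩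
  unfold halfPotD4
  fun_prop

lemma norm_wkbDefect_le (α β : ℝ) {δ : ℝ} (hδ : 0 < δ) : ∃ K > 0, ∀ κ ≥ (1 : ℝ),
    ∀ θ ∈ Set.Icc δ (π - δ), ‖wkbDefect α β κ θ‖ ≤ K / κ ^ 4 := by
  obtain ⟨h0, h1, h2, h4, h3, ha⟩ := continuousOn_halfPots α β
  obtain ⟨K1, hK1, b1⟩ := exists_abs_le_of_continuousOn
    (f := fun θ => halfPotD4 α β θ / 8 + halfPotD1 α β θ ^ 2 + halfPot α β θ * halfPotD2 α β θ +
    halfPotD1 α β θ ^ 2 / 4 - 2 * halfPot α β θ * phaseD3 α β θ) (by fun_prop) hδ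
  obtain ⟨K2, hK2, b2⟩ := exists_abs_le_of_continuousOn
    (f := fun θ => -halfPotD1 α β θ * ampD4 α β θ - phaseD3 α β θ ^ 2) (by fun_prop) hδ
  obtain ⟨K3, hK3, b3⟩ := exists_abs_le_of_continuousOn
    (f := fun θ => ampD4 α β θ ^ 2) (by fun_prop) hδ
  obtain ⟨K4, hK4, b4⟩ := exists_abs_le_of_continuousOn
    (f := fun θ => -halfPotD1 α β θ * phaseD3 α β θ + 2 * ampD4 α β θ * halfPot α β θ)
    (by fun_prop) hδ
  obtain ⟨K5, hK5, b5⟩ := exists_abs_le_of_continuousOn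
    (f := fun θ => 2 * ampD4 α β θ * phaseD3 α β θ) (by fun_prop) hδ
  refine ⟨K1 + K2 + K3 + K4 + K5, by positivity, fun κ hκ θ hθ => ?_⟩
  have hκ0 : 0 < κ := by linarith
  have key : ∀ (a K : ℝ) (j : ℕ), 0 < K → |a| ≤ K → 4 ≤ j → |a / κ ^ j| ≤ K / κ ^ 4 := by
    intro a K j hK ha hj
    rw [abs_div, abs_of_pos (by positivity : 0 < κ ^ j)]
    gcongr
  unfold wkbDefect
  refine (norm_sub_le _ _).trans ?_
  rw [norm_mul, Complex.norm_I, one_mul, Complex.norm_real, Complex.norm_real, Real.norm_eq_abs,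
    Real.norm_eq_abs]
  refine (add_le_add ((abs_add_le _ _).trans (add_le_add (abs_add_le _ _) le_rfl))
    (abs_add_le _ _)).trans ?_
  have e1 := key _ _ 4 hK1 (b1 θ hθ) (by norm_num)
  have e2 := key _ _ 6 hK2 (b2 θ hθ) (by norm_num)
  have e3 := key _ _ 8 hK3 (b3 θ hθ) (by norm_num)
  have e4 := key _ _ 5 hK4 (b4 θ hθ) (by norm_num)
  have e5 := key _ _ 7 hK5 (b5 θ hθ) (by norm_num)
  have e : (K1 + K2 + K3 + K4 + K5) / κ ^ 4 =
      K1 / κ ^ 4 + K2 / κ ^ 4 + K3 / κ ^ 4 + K4 / κ ^ 4 + K5 / κ ^ 4 := by ring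
  linarith

/-- The amplitude of `exp (i Φ)` in the Liouville form of the Jacobi polynomial, where `Φ` is the
phase of the WKB approximation. -/
noncomputable def refinedWave (α β : ℝ) (n : ℕ) (θ : ℝ) : ℂ :=
  Complex.I * (liouJacobi α β n θ * (logAmpDeriv α β (jacobiFreq α β n) θ -
      Complex.I * phaseDeriv α β (jacobiFreq α β n) θ) - liouJacobiDeriv α β n θ) *
    Complex.exp (logAmp α β (jacobiFreq α β n) θ - Complex.I * phase α β (jacobiFreq α β n) θ)

lemma hasDerivAt_refinedWave {α : ℝ} (hα : -1 < α) (β : ℝ) {n : ℕ} (hκ : jacobiFreq α β n ≠ 0)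
    {θ : ℝ} (h : θ ∈ Set.Ioo 0 π) :
    HasDerivAt (refinedWave α β n) (Complex.I * liouJacobi α β n θ *
      wkbDefect α β (jacobiFreq α β n) θ * Complex.exp (logAmp α β (jacobiFreq α β n) θ -
        Complex.I * phase α β (jacobiFreq α β n) θ)) θ := by
  set κ := jacobiFreq α β n with hκd
  have hE : HasDerivAt (fun x : ℝ => Complex.exp (logAmp α β κ x - Complex.I * phase α β κ x))
      ((logAmpDeriv α β κ θ - Complex.I * phaseDeriv α β κ θ) *
        Complex.exp (logAmp α β κ θ - Complex.I * phase α β κ θ)) θ := by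
    refine (((hasDerivAt_logAmp α β κ h).ofReal_comp.sub
      ((hasDerivAt_phase α β κ h).ofReal_comp.const_mul Complex.I)).cexp).congr_deriv ?_
    simp only [Pi.sub_apply]
    ring
  have hφ : HasDerivAt (fun x : ℝ => (logAmpDeriv α β κ x : ℂ) - Complex.I * phaseDeriv α β κ x)
      _ θ := (hasDerivAt_logAmpDeriv α β κ h).ofReal_comp.sub
      ((hasDerivAt_phaseDeriv α β κ h).ofReal_comp.const_mul Complex.I)
  refine (hasDerivAt_riccati (hasDerivAt_liouJacobi α β n h) (hasDerivAt_liouJacobiDeriv hα β n h)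
    hφ hE).congr_deriv ?_
  congr 2
  have hq : jacobiPot α β θ = 2 * halfPot α β θ := by unfold halfPot; ring
  rw [← hκd, hq]
  unfold wkbDefect logAmpDeriv phaseDeriv
  have hκC : (κ : ℂ) ≠ 0 := Complex.ofReal_ne_zero.2 hκ
  have hd3 : phaseD3 α β θ = -halfPotD2 α β θ / 4 - halfPot α β θ ^ 2 / 2 := rfl
  have ha4 : ampD4 α β θ = halfPotD3 α β θ / 8 + halfPot α β θ * halfPotD1 α β θ := rfl
  have e3 : halfPotD3 α β θ = 8 * (ampD4 α β θ - halfPot α β θ * halfPotD1 α β θ) := by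
    rw [ha4]; ring
  have e2 : halfPotD2 α β θ = -4 * (phaseD3 α β θ + halfPot α β θ ^ 2 / 2) := by
    rw [hd3]; ring
  rw [e3, e2]
  push_cast
  field_simp
  ring_nf
  simp only [Complex.I_sq]
  ring

lemma half_le_phaseDeriv (α β : ℝ) {δ : ℝ} (hδ : 0 < δ) : ∃ K ≥ (1 : ℝ), ∀ κ ≥ K,
    ∀ θ ∈ Set.Icc δ (π - δ), κ / 2 ≤ phaseDeriv α β κ θ := by
  obtain ⟨h0, -, -, -, h3, -⟩ := continuousOn_halfPots α β
  obtain ⟨K1, hK1, b1⟩ := exists_abs_le_of_continuousOn h0 hδ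
  obtain ⟨K2, hK2, b2⟩ := exists_abs_le_of_continuousOn h3 hδ
  refine ⟨1 + 2 * K1 + 2 * K2, by linarith, fun κ hκ θ hθ => ?_⟩
  have hκ1 : 1 ≤ κ := by linarith
  have hκ0 : 0 < κ := by linarith
  have e1 : |halfPot α β θ / κ| ≤ K1 := by
    rw [abs_div, abs_of_pos hκ0]
    exact (div_le_self (abs_nonneg _) hκ1).trans (b1 θ hθ)
  have e2 : |phaseD3 α β θ / κ ^ 3| ≤ K2 := by
    rw [abs_div, abs_of_pos (by positivity : 0 < κ ^ 3)]
    exact (div_le_self (abs_nonneg _) (one_le_pow₀ hκ1)).trans (b2 θ hθ)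
  unfold phaseDeriv
  linarith [(abs_le.1 e1).1, (abs_le.1 e2).1]

lemma norm_refinedWave_sub_le {α : ℝ} (hα : -1 < α) (β : ℝ) {δ : ℝ} (hδ : 0 < δ) (hδ' : δ ≤ π / 2) :
    ∃ K ≥ (1 : ℝ), ∀ n : ℕ, K ≤ jacobiFreq α β n → ∀ θ ∈ Set.Icc δ (π - δ),
      jacobiFreq α β n / 2 ≤ phaseDeriv α β (jacobiFreq α β n) θ ∧
      ‖refinedWave α β n θ - refinedWave α β n (π / 2)‖ ≤
        K / jacobiFreq α β n ^ 5 * ‖refinedWave α β n (π / 2)‖ := by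
  obtain ⟨K1, hK1, b1⟩ := norm_wkbDefect_le α β hδ
  obtain ⟨K2, hK2, b2⟩ := half_le_phaseDeriv α β hδ
  have hπ : 0 < 4 * K1 * π := by positivity
  refine ⟨K2 + 4 * K1 * π, by linarith, fun n hκ θ hθ => ?_⟩
  set κ := jacobiFreq α β n with hκd
  have hκ1 : 1 ≤ κ := by linarith
  have hκ0 : 0 < κ := by linarith
  refine ⟨b2 κ (by linarith) θ hθ, ?_⟩
  have hsub : Set.Icc δ (π - δ) ⊆ Set.Ioo 0 π := fun x hx =>
    ⟨by linarith [hx.1], by linarith [hx.2]⟩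
  have hbd : ∀ x ∈ Set.Icc δ (π - δ), ‖Complex.I * liouJacobi α β n x *
      wkbDefect α β κ x * Complex.exp (logAmp α β κ x - Complex.I * phase α β κ x)‖ ≤
      2 * K1 / κ ^ 5 * ‖refinedWave α β n x‖ := by
    intro x hx
    refine norm_riccati_le ?_ (by positivity)
    have h1 := b2 κ (by linarith) x hx
    have him : ((logAmpDeriv α β (jacobiFreq α β n) x : ℂ) -
      Complex.I * phaseDeriv α β (jacobiFreq α β n) x).im = -phaseDeriv α β κ x := by simp [hκd]
    rw [him, abs_neg, abs_of_pos (by linarith)]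
    calc _ ≤ K1 / κ ^ 4 := b1 κ hκ1 x hx
      _ = 2 * K1 / κ ^ 5 * (κ / 2) := by field_simp
      _ ≤ _ := by gcongr
  have hmid : π / 2 ∈ Set.Icc δ (π - δ) := ⟨hδ', by linarith⟩
  have hexp : ∀ d, 0 ≤ d → d ≤ π → exp (2 * K1 / κ ^ 5 * d) - 1 ≤ (K2 + 4 * K1 * π) / κ ^ 5 := by
    intro d hd hd'
    have e0 : 2 * K1 / κ ^ 5 * d ≤ 2 * K1 * π / κ ^ 5 := by
      rw [div_mul_eq_mul_div]; gcongr
    have e1 : 2 * K1 * π / κ ^ 5 ≤ 1 := by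
      rw [div_le_one (by positivity)]
      calc _ ≤ κ := by linarith
        _ ≤ _ := le_self_pow₀ hκ1 (by norm_num)
    have e3 : 0 ≤ 2 * K1 / κ ^ 5 * d := by positivity
    have e2 := (le_abs_self _).trans (abs_exp_sub_one_le (x := 2 * K1 / κ ^ 5 * d)
      (by rw [abs_of_nonneg e3]; linarith))
    rw [abs_of_nonneg e3] at e2
    calc _ ≤ _ := e2
      _ ≤ 2 * (2 * K1 * π / κ ^ 5) := by gcongr
      _ = 4 * K1 * π / κ ^ 5 := by ring
      _ ≤ _ := by gcongr; linarith
  have hH : ∀ x : ℝ, HasDerivAt (fun x => 2 * K1 / κ ^ 5 * x) (2 * K1 / κ ^ 5) x := fun x => by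
    simpa using (hasDerivAt_id x).const_mul (2 * K1 / κ ^ 5)
  rcases le_total (π / 2) θ with hle | hle
  · have hs : Set.Icc (π / 2) θ ⊆ Set.Icc δ (π - δ) := Set.Icc_subset_Icc hmid.1 hθ.2
    refine (norm_sub_le_of_norm_deriv_le hle
      (fun x hx => hasDerivAt_refinedWave hα β hκ0.ne' (hsub (hs hx))) (fun x _ => hH x)
      (fun x _ => by positivity) (fun x hx => hbd x (hs hx))).trans ?_
    rw [← mul_sub]
    gcongr
    exact hexp _ (by linarith) (by linarith [hθ.2, pi_pos])
  · have hs : Set.Icc θ (π / 2) ⊆ Set.Icc δ (π - δ) := Set.Icc_subset_Icc hθ.1 hmid.2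
    refine (norm_sub_le_of_norm_deriv_le' hle
      (fun x hx => hasDerivAt_refinedWave hα β hκ0.ne' (hsub (hs hx))) (fun x _ => hH x)
      (fun x _ => by positivity) (fun x hx => hbd x (hs hx))).trans ?_
    rw [← mul_sub]
    gcongr
    exact hexp _ (by linarith) (by linarith [hθ.1, pi_pos])

section CentralAsymptotics

open Asymptotics

lemma isBigO_zpow_of_eq {f : ℝ → ℝ} (q : ℝ → ℝ) {c : ℤ} (hq : ContinuousAt q 0)
    (h : ∀ κ > 0, f κ = κ ^ c * q κ⁻¹) : f =O[atTop] fun κ : ℝ => κ ^ c := by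
  have h1 : (fun κ : ℝ => q κ⁻¹) =O[atTop] fun _ => (1 : ℝ) :=
    (hq.tendsto.comp tendsto_inv_atTop_zero).isBigO_one ℝ
  have h2 := (isBigO_refl (fun κ : ℝ => κ ^ c) atTop).mul h1
  simp only [mul_one] at h2
  refine h2.congr' ?_ .rfl
  filter_upwards [eventually_gt_atTop 0] with κ hκ using (h κ hκ).symm

lemma isBigO_zpow_mono {f : ℝ → ℝ} {a b : ℤ} (hf : f =O[atTop] fun κ : ℝ => κ ^ a)
    (hab : a ≤ b) : f =O[atTop] fun κ : ℝ => κ ^ b := by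
  refine hf.trans (IsBigO.of_bound 1 ?_)
  filter_upwards [eventually_ge_atTop 1] with κ hκ
  have : 0 < κ := by linarith
  rw [norm_of_nonneg (by positivity), norm_of_nonneg (by positivity), one_mul]
  exact zpow_le_zpow_right₀ hκ hab

lemma isBigO_zpow_mul {f g : ℝ → ℝ} {a b c : ℤ} (hf : f =O[atTop] fun κ : ℝ => κ ^ a)
    (hg : g =O[atTop] fun κ : ℝ => κ ^ b) (hc : a + b ≤ c) :
    (fun κ => f κ * g κ) =O[atTop] fun κ : ℝ => κ ^ c := by
  refine isBigO_zpow_mono (a := a + b) ((hf.mul hg).congr' .rfl ?_) hc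
  filter_upwards [eventually_gt_atTop 0] with κ hκ using (zpow_add₀ hκ.ne' a b).symm

lemma eventually_abs_le_of_isBigO_zpow {f : ℝ → ℝ} {a : ℤ}
    (hf : f =O[atTop] fun κ : ℝ => κ ^ a) :
    ∃ K > 0, ∀ᶠ κ : ℝ in atTop, |f κ| ≤ K * κ ^ a := by
  obtain ⟨K, hK, h⟩ := hf.exists_pos
  refine ⟨K, hK, ?_⟩
  filter_upwards [h.bound, eventually_gt_atTop 0] with κ h1 hκ
  rwa [norm_eq_abs, norm_of_nonneg (by positivity)] at h1

/-- The phase derivative at `π / 2`, with `d` half the potential there. -/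
noncomputable def centralPhaseDeriv (d κ : ℝ) : ℝ := κ + d / κ + -(d + d ^ 2) / 2 / κ ^ 3

/-- The derivative at `π / 2` of the logarithm of the inverse amplitude. -/
noncomputable def centralLogAmpDeriv (μ d κ : ℝ) : ℝ := -μ / 2 / κ ^ 2 + μ * (5 / 8 + d) / κ ^ 4

/-- The jump of the phase correction at `π / 2` from `κ` to `κ + 1`. -/
noncomputable def centralPhaseJump (μ d κ : ℝ) : ℝ :=
  (μ / (κ + 1) + -μ * (3 + 4 * d) / 12 / (κ + 1) ^ 3) - (μ / κ + -μ * (3 + 4 * d) / 12 / κ ^ 3)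

/-- The diagonal coefficient of the ladder relation at `π / 2` in the refined amplitude. -/
noncomputable def ladderU (μ d κ : ℝ) : ℝ := (κ + 1 / 2) * centralLogAmpDeriv μ d (κ + 1) - μ

/-- The off-diagonal coefficient of the ladder relation at `π / 2` in the refined amplitude. -/
noncomputable def ladderW (μ d κ : ℝ) : ℝ :=
  μ * centralLogAmpDeriv μ d (κ + 1) + (κ + 1 / 2) * ((κ + 1 / 2) ^ 2 - (1 / 4 - 2 * d))

variable (μ d : ℝ)

lemma isBigO_centralPhaseDeriv : centralPhaseDeriv d =O[atTop] fun κ : ℝ => κ ^ (1 : ℤ) := by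
  refine isBigO_zpow_of_eq (fun w => 1 + d * w ^ 2 + -(d + d ^ 2) / 2 * w ^ 4)
    (by fun_prop) fun κ hκ => ?_
  unfold centralPhaseDeriv
  field_simp

lemma isBigO_centralPhaseDeriv_succ :
    (fun κ => centralPhaseDeriv d (κ + 1)) =O[atTop] fun κ : ℝ => κ ^ (1 : ℤ) := by
  refine isBigO_zpow_of_eq (fun w => (1 + w) + d * w ^ 2 / (1 + w) +
    -(d + d ^ 2) / 2 * w ^ 4 / (1 + w) ^ 3)
    (by fun_prop (disch := norm_num)) fun κ hκ => ?_
  unfold centralPhaseDeriv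
  field_simp

lemma isBigO_centralLogAmpDeriv :
    centralLogAmpDeriv μ d =O[atTop] fun κ : ℝ => κ ^ (-2 : ℤ) := by
  refine isBigO_zpow_of_eq (fun w => -μ / 2 + μ * (5 / 8 + d) * w ^ 2)
    (by fun_prop) fun κ hκ => ?_
  unfold centralLogAmpDeriv
  rw [zpow_neg, zpow_ofNat]
  field_simp

lemma isBigO_centralLogAmpDeriv_succ :
    (fun κ => centralLogAmpDeriv μ d (κ + 1)) =O[atTop] fun κ : ℝ => κ ^ (-2 : ℤ) := by
  refine isBigO_zpow_of_eq (fun w => -μ / 2 / (1 + w) ^ 2 + μ * (5 / 8 + d) * w ^ 2 / (1 + w) ^ 4)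
    (by fun_prop (disch := norm_num)) fun κ hκ => ?_
  unfold centralLogAmpDeriv
  rw [zpow_neg, zpow_ofNat]
  field_simp

lemma isBigO_centralPhaseJump :
    centralPhaseJump μ d =O[atTop] fun κ : ℝ => κ ^ (-2 : ℤ) := by
  refine isBigO_zpow_of_eq (fun w => -μ / (1 + w) -
      -μ * (3 + 4 * d) / 12 * (3 * w ^ 2 + 3 * w ^ 3 + w ^ 4) / (1 + w) ^ 3)
    (by fun_prop (disch := norm_num)) fun κ hκ => ?_
  unfold centralPhaseJump
  rw [zpow_neg, zpow_ofNat]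
  field_simp
  ring

lemma isBigO_add_half : (fun κ : ℝ => κ + 1 / 2) =O[atTop] fun κ : ℝ => κ ^ (1 : ℤ) := by
  refine isBigO_zpow_of_eq (fun w => 1 + w / 2) (by fun_prop) fun κ hκ => ?_
  field_simp

lemma isBigO_const_zpow_zero (a : ℝ) : (fun _ : ℝ => a) =O[atTop] fun κ : ℝ => κ ^ (0 : ℤ) :=
  isBigO_zpow_of_eq (fun _ => a) (by fun_prop) fun κ _ => by simp

lemma isBigO_ladderU : ladderU μ d =O[atTop] fun κ : ℝ => κ ^ (0 : ℤ) :=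
  (isBigO_zpow_mul isBigO_add_half (isBigO_centralLogAmpDeriv_succ μ d) (by norm_num)).sub
    (isBigO_const_zpow_zero μ)

lemma isBigO_ladderW : ladderW μ d =O[atTop] fun κ : ℝ => κ ^ (3 : ℤ) := by
  have h2 : (fun κ : ℝ => (κ + 1 / 2) ^ 2 - (1 / 4 - 2 * d)) =O[atTop]
      fun κ : ℝ => κ ^ (2 : ℤ) := by
    simp_rw [sq]
    exact (isBigO_zpow_mul isBigO_add_half isBigO_add_half (by norm_num)).sub
      (isBigO_zpow_mono (isBigO_const_zpow_zero _) (by norm_num))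
  exact (isBigO_zpow_mul (isBigO_const_zpow_zero μ) (isBigO_centralLogAmpDeriv_succ μ d)
    (by norm_num)).add (isBigO_zpow_mul isBigO_add_half h2 (by norm_num))

lemma isBigO_ladder_defect_im : (fun κ => ladderU μ d κ -
      centralPhaseJump μ d κ * ((κ + 1 / 2) * centralPhaseDeriv d (κ + 1))) =O[atTop]
    fun κ : ℝ => κ ^ (-4 : ℤ) := by
  refine isBigO_zpow_of_eq (fun w =>
    μ * ((-75 - 172 * d - 72 * d ^ 2) + (-246 - 546 * d - 228 * d ^ 2) * w + (-309 - 644 * d -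
      238 * d ^ 2 + 24 * d ^ 3) * w ^ 2 + (-186 - 361 * d - 109 * d ^ 2 + 36 * d ^ 3) * w ^ 3
      + (-54 - 99 * d - 21 * d ^ 2 + 20 * d ^ 3) * w ^ 4 + (-6 - 11 * d - d ^ 2 + 4 * d ^ 3) *
      w ^ 5) / (48 * (1 + w) ^ 6))
    (by fun_prop (disch := norm_num)) fun κ hκ => ?_
  obtain ⟨w, hw, rfl⟩ : ∃ w : ℝ, 0 < w ∧ κ = w⁻¹ := ⟨κ⁻¹, by positivity, by simp⟩
  unfold ladderU centralPhaseJump centralPhaseDeriv centralLogAmpDeriv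
  have e : w⁻¹ + 1 = (1 + w) / w := by field_simp
  rw [zpow_neg, zpow_ofNat, inv_inv, e]
  field_simp
  ring

lemma isBigO_ladder_defect_re : (fun κ => ladderW μ d κ -
      (κ + 1 / 2) * centralPhaseDeriv d (κ + 1) * centralPhaseDeriv d κ -
      centralPhaseJump μ d κ * (μ * centralPhaseDeriv d (κ + 1) +
        ladderU μ d κ * centralPhaseDeriv d κ)) =O[atTop]
    fun κ : ℝ => κ ^ (-3 : ℤ) := by
  refine isBigO_zpow_of_eq (fun w =>
    ((768 * d + 1152 * d ^ 2 + 384 * d ^ 3 + 480 * μ ^ 2) + (4224 * d + 6336 * d ^ 2 + 2112 *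
      d ^ 3 + 2640 * μ ^ 2) * w + (9792 * d + 14688 * d ^ 2 + 4800 * d ^ 3 - 96 * d ^ 4 + 4800
      * μ ^ 2 - 1920 * μ ^ 2 * d) * w ^ 2 + (12384 * d + 18576 * d ^ 2 + 5760 * d ^ 3 - 432 *
      d ^ 4 + 2964 * μ ^ 2 - 5680 * μ ^ 2 * d + 1248 * μ ^ 2 * d ^ 2) * w ^ 3 + (9216 * d +
      13824 * d ^ 2 + 3840 * d ^ 3 - 768 * d ^ 4 - 678 * μ ^ 2 - 4120 * μ ^ 2 * d + 5328 * μ ^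
      2 * d ^ 2) * w ^ 4 + (4032 * d + 6048 * d ^ 2 + 1344 * d ^ 3 - 672 * d ^ 4 - 1614 * μ ^
      2 + 1212 * μ ^ 2 * d + 6208 * μ ^ 2 * d ^ 2 - 1248 * μ ^ 2 * d ^ 3) * w ^ 5 + (960 * d +
      1440 * d ^ 2 + 192 * d ^ 3 - 288 * d ^ 4 - 678 * μ ^ 2 + 2042 * μ ^ 2 * d + 1056 * μ ^ 2
      * d ^ 2 - 3120 * μ ^ 2 * d ^ 3) * w ^ 6 + (96 * d + 144 * d ^ 2 - 48 * d ^ 4 - 96 * μ ^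
      2 - 176 * μ ^ 2 * d - 2786 * μ ^ 2 * d ^ 2 - 2824 * μ ^ 2 * d ^ 3 + 192 * μ ^ 2 * d ^ 4)
      * w ^ 7 + (-843 * μ ^ 2 * d - 2225 * μ ^ 2 * d ^ 2 - 1140 * μ ^ 2 * d ^ 3 + 288 * μ ^ 2
      * d ^ 4) * w ^ 8 + (-345 * μ ^ 2 * d - 685 * μ ^ 2 * d ^ 2 - 180 * μ ^ 2 * d ^ 3 + 160 *
      μ ^ 2 * d ^ 4) * w ^ 9 + (-45 * μ ^ 2 * d - 81 * μ ^ 2 * d ^ 2 - 4 * μ ^ 2 * d ^ 3 + 32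
      * μ ^ 2 * d ^ 4) * w ^ 10) / (384 * (1 + w) ^ 7))
    (by fun_prop (disch := norm_num)) fun κ hκ => ?_
  obtain ⟨w, hw, rfl⟩ : ∃ w : ℝ, 0 < w ∧ κ = w⁻¹ := ⟨κ⁻¹, by positivity, by simp⟩
  unfold ladderW ladderU centralPhaseJump centralPhaseDeriv centralLogAmpDeriv
  have e : w⁻¹ + 1 = (1 + w) / w := by field_simp
  rw [zpow_neg, zpow_ofNat, inv_inv, e]
  field_simp
  ring

lemma isBigO_ladder_defect_mixed : (fun κ => μ * centralPhaseDeriv d (κ + 1) +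
      centralPhaseJump μ d κ * ladderW μ d κ +
      ((κ + 1 / 2) * centralPhaseDeriv d (κ + 1) + centralPhaseJump μ d κ * ladderU μ d κ) *
        centralLogAmpDeriv μ d κ) =O[atTop]
    fun κ : ℝ => κ ^ (-3 : ℤ) := by
  refine isBigO_zpow_of_eq (fun w =>
    μ * ((2400 + 5504 * d + 2304 * d ^ 2) + (16128 + 37568 * d + 15744 * d ^ 2) * w + (47040 +
      110368 * d + 46528 * d ^ 2 - 1920 * μ ^ 2) * w ^ 2 + (77760 + 182304 * d + 77088 * d ^ 2
      - 768 * d ^ 3 - 8640 * μ ^ 2) * w ^ 3 + (79680 + 185264 * d + 77456 * d ^ 2 - 3456 * d ^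
      3 - 9120 * μ ^ 2 + 9600 * μ ^ 2 * d) * w ^ 4 + (51840 + 118720 * d + 47488 * d ^ 2 -
      6144 * d ^ 3 + 8400 * μ ^ 2 + 33600 * μ ^ 2 * d) * w ^ 5 + (20928 + 46912 * d + 16800 *
      d ^ 2 - 5376 * d ^ 3 + 21000 * μ ^ 2 + 35200 * μ ^ 2 * d - 9216 * μ ^ 2 * d ^ 2) * w ^ 6
      + (4800 + 10464 * d + 2912 * d ^ 2 - 2304 * d ^ 3 + 11340 * μ ^ 2 + 4000 * μ ^ 2 * d -
      23040 * μ ^ 2 * d ^ 2) * w ^ 7 + (480 + 1008 * d + 144 * d ^ 2 - 384 * d ^ 3 - 2070 * μ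
      ^ 2 - 17960 * μ ^ 2 * d - 21760 * μ ^ 2 * d ^ 2 + 1536 * μ ^ 2 * d ^ 3) * w ^ 8 + (-4485
      * μ ^ 2 - 14140 * μ ^ 2 * d - 9600 * μ ^ 2 * d ^ 2 + 2304 * μ ^ 2 * d ^ 3) * w ^ 9 +
      (-1725 * μ ^ 2 - 4460 * μ ^ 2 * d - 1920 * μ ^ 2 * d ^ 2 + 1280 * μ ^ 2 * d ^ 3) * w ^
      10 + (-225 * μ ^ 2 - 540 * μ ^ 2 * d - 128 * μ ^ 2 * d ^ 2 + 256 * μ ^ 2 * d ^ 3) * w ^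
      11) / (1536 * (1 + w) ^ 7))
    (by fun_prop (disch := norm_num)) fun κ hκ => ?_
  obtain ⟨w, hw, rfl⟩ : ∃ w : ℝ, 0 < w ∧ κ = w⁻¹ := ⟨κ⁻¹, by positivity, by simp⟩
  unfold ladderW ladderU centralPhaseJump centralPhaseDeriv centralLogAmpDeriv
  have e : w⁻¹ + 1 = (1 + w) / w := by field_simp
  rw [zpow_neg, zpow_ofNat, inv_inv, e]
  field_simp
  ring

end CentralAsymptotics

section LadderStep

open Asymptotics

variable (μ d : ℝ)

lemma abs_sin_sub_self_le {x : ℝ} (hx : |x| ≤ 1) : |sin x - x| ≤ |x| ^ 3 := by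
  have h1 := Real.sin_bound hx
  have h2 : sin x - x = (sin x - (x - x ^ 3 / 6)) - x ^ 3 / 6 := by ring
  have h3 : |x ^ 3 / 6| = |x| ^ 3 / 6 := by rw [abs_div, abs_pow]; norm_num
  have h4 : |x| ^ 4 ≤ |x| ^ 3 := pow_le_pow_of_le_one (abs_nonneg x) hx (by norm_num)
  have h5 : |x| ^ 5 ≤ |x| ^ 3 := pow_le_pow_of_le_one (abs_nonneg x) hx (by norm_num)
  rw [h2]
  refine (abs_sub _ _).trans ?_
  rw [h3]
  linarith [pow_nonneg (abs_nonneg x) 3]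

lemma abs_cos_sub_one_le (x : ℝ) : |cos x - 1| ≤ |x| ^ 2 := by
  rw [abs_le, sq_abs]
  constructor <;> nlinarith [one_sub_sq_div_two_le_cos (x := x), cos_le_one x]

lemma tendsto_centralPhaseJump : Tendsto (centralPhaseJump μ d) atTop (𝓝 0) :=
  (isBigO_centralPhaseJump μ d).trans_tendsto (tendsto_zpow_atTop_zero (by norm_num))

lemma isBigO_sin_centralPhaseJump_sub :
    (fun κ => sin (centralPhaseJump μ d κ) - centralPhaseJump μ d κ) =O[atTop]
      fun κ : ℝ => κ ^ (-6 : ℤ) := by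
  have h := isBigO_centralPhaseJump μ d
  refine IsBigO.trans (IsBigO.of_bound 1 ?_)
    (isBigO_zpow_mul h (isBigO_zpow_mul h h le_rfl) (by norm_num))
  filter_upwards [(tendsto_centralPhaseJump μ d).eventually (Metric.ball_mem_nhds 0 one_pos)]
    with κ hκ
  rw [dist_zero_right, norm_eq_abs] at hκ
  rw [norm_eq_abs, norm_eq_abs, one_mul, abs_mul, abs_mul]
  exact (abs_sin_sub_self_le hκ.le).trans_eq (by ring)

lemma isBigO_cos_centralPhaseJump_sub :
    (fun κ => cos (centralPhaseJump μ d κ) - 1) =O[atTop] fun κ : ℝ => κ ^ (-4 : ℤ) := by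
  have h := isBigO_centralPhaseJump μ d
  refine IsBigO.trans (IsBigO.of_bound 1 (.of_forall fun κ => ?_))
    (isBigO_zpow_mul h h (by norm_num))
  rw [norm_eq_abs, norm_eq_abs, one_mul, abs_mul]
  exact (abs_cos_sub_one_le _).trans_eq (by ring)

/-- The real factor by which the ladder relation scales the wave at `π / 2`. -/
noncomputable def ladderFactor (κ : ℝ) : ℝ :=
  cos (centralPhaseJump μ d κ) * ((κ + 1 / 2) * centralPhaseDeriv d (κ + 1)) +
    sin (centralPhaseJump μ d κ) * ladderU μ d κ

lemma eventually_half_le_centralPhaseDeriv :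
    ∀ᶠ κ : ℝ in atTop, κ / 2 ≤ centralPhaseDeriv d κ := by
  have h : (fun κ => d / κ + -(d + d ^ 2) / 2 / κ ^ 3) =O[atTop] fun κ : ℝ => κ ^ (-1 : ℤ) := by
    refine isBigO_zpow_of_eq (fun w => d + -(d + d ^ 2) / 2 * w ^ 2) (by fun_prop) fun κ hκ => ?_
    rw [zpow_neg_one]
    field_simp
  have h0 := h.trans_tendsto (tendsto_zpow_atTop_zero (by norm_num))
  filter_upwards [h0.eventually (Metric.ball_mem_nhds 0 one_pos), eventually_ge_atTop 2]
    with κ h1 h2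
  rw [dist_zero_right, norm_eq_abs, abs_lt] at h1
  unfold centralPhaseDeriv
  linarith [h1.1]

lemma eventually_sq_le_ladderFactor : ∀ᶠ κ : ℝ in atTop, κ ^ 2 / 8 ≤ ladderFactor μ d κ := by
  have hs : Tendsto (fun κ => sin (centralPhaseJump μ d κ) * ladderU μ d κ) atTop (𝓝 0) := by
    refine IsBigO.trans_tendsto (IsBigO.trans (IsBigO.of_bound 1 (.of_forall fun κ => ?_))
      (isBigO_zpow_mul (c := -2) (isBigO_centralPhaseJump μ d) (isBigO_ladderU μ d) (by norm_num)))
      (tendsto_zpow_atTop_zero (by norm_num))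
    rw [one_mul, norm_mul, norm_mul]
    exact mul_le_mul_of_nonneg_right abs_sin_le_abs (norm_nonneg _)
  have hc : Tendsto (fun κ => cos (centralPhaseJump μ d κ)) atTop (𝓝 1) := by
    have h := (continuous_cos.tendsto 0).comp (tendsto_centralPhaseJump μ d)
    rwa [cos_zero] at h
  filter_upwards [hs.eventually (Metric.ball_mem_nhds 0 one_pos),
    hc.eventually (lt_mem_nhds (show (1 / 2 : ℝ) < 1 by norm_num)), eventually_ge_atTop 3,
    (tendsto_atTop_add_const_right atTop 1 tendsto_id).eventually
      (eventually_half_le_centralPhaseDeriv d)] with κ h1 h2 h3 h4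
  rw [dist_zero_right, norm_eq_abs, abs_lt] at h1
  simp only [id] at h4
  have h5 : κ ^ 2 / 2 ≤ (κ + 1 / 2) * centralPhaseDeriv d (κ + 1) := by
    nlinarith
  unfold ladderFactor
  nlinarith [h1.1]

lemma eventually_ladder_defects_le : ∃ K > 0, ∀ᶠ κ : ℝ in atTop,
    |cos (centralPhaseJump μ d κ) * ladderU μ d κ - sin (centralPhaseJump μ d κ) *
      ((κ + 1 / 2) * centralPhaseDeriv d (κ + 1))| ≤ K * κ ^ (-4 : ℤ) ∧
    |cos (centralPhaseJump μ d κ) * ladderW μ d κ - sin (centralPhaseJump μ d κ) *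
      (μ * centralPhaseDeriv d (κ + 1)) - ladderFactor μ d κ * centralPhaseDeriv d κ| ≤
        K * κ ^ (-3 : ℤ) ∧
    |cos (centralPhaseJump μ d κ) * (μ * centralPhaseDeriv d (κ + 1)) +
      sin (centralPhaseJump μ d κ) * ladderW μ d κ +
        ladderFactor μ d κ * centralLogAmpDeriv μ d κ| ≤ K * κ ^ (-3 : ℤ) := by
  have hs := isBigO_sin_centralPhaseJump_sub μ d
  have hc := isBigO_cos_centralPhaseJump_sub μ d
  have hP := isBigO_centralPhaseDeriv d
  have hPs := isBigO_centralPhaseDeriv_succ d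
  have hH := isBigO_centralLogAmpDeriv μ d
  have hU := isBigO_ladderU μ d
  have hW := isBigO_ladderW μ d
  have hm := isBigO_add_half
  have hμ := isBigO_const_zpow_zero μ
  have hmP := isBigO_zpow_mul (c := 2) hm hPs (by norm_num)
  have hT := (isBigO_zpow_mul (c := 1) hμ hPs (by norm_num)).add
    (isBigO_zpow_mul (c := 1) hU hP (by norm_num))
  have r2 := isBigO_ladder_defect_re μ d
  have hQ := (isBigO_zpow_mono (b := -1) r2 (by norm_num)).add
    (isBigO_zpow_mul (c := -1) (isBigO_centralPhaseJump μ d) hT (by norm_num))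
  have hμH := isBigO_zpow_mul (c := 1) hPs ((isBigO_zpow_mono (b := 0) hμ (by norm_num)).add
    (isBigO_zpow_mul (c := 0) hm hH (by norm_num))) (by norm_num)
  have hWH := hW.add (isBigO_zpow_mul (c := 3) hU hH (by norm_num))
  obtain ⟨K1, hK1, e1⟩ := eventually_abs_le_of_isBigO_zpow
    (((isBigO_ladder_defect_im μ d).add (isBigO_zpow_mul (c := -4) hc hU (by norm_num))).sub
      (isBigO_zpow_mul (c := -4) hs hmP (by norm_num)))
  obtain ⟨K2, hK2, e2⟩ := eventually_abs_le_of_isBigO_zpow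
    ((r2.sub (isBigO_zpow_mul (c := -3) hs hT (by norm_num))).add
      (isBigO_zpow_mul (c := -3) hc hQ (by norm_num)))
  obtain ⟨K3, hK3, e3⟩ := eventually_abs_le_of_isBigO_zpow
    (((isBigO_ladder_defect_mixed μ d).add
      (isBigO_zpow_mul (c := -3) hc hμH (by norm_num))).add
      (isBigO_zpow_mul (c := -3) hs hWH (by norm_num)))
  refine ⟨K1 + K2 + K3, by positivity, ?_⟩
  filter_upwards [e1, e2, e3, eventually_gt_atTop 0] with κ h1 h2 h3 hκ
  have p3 : 0 < κ ^ (-3 : ℤ) := by positivity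
  have p4 : 0 < κ ^ (-4 : ℤ) := by positivity
  refine ⟨?_, ?_, ?_⟩
  · refine Eq.trans_le (congrArg abs ?_) (h1.trans (by gcongr; linarith))
    ring
  · refine Eq.trans_le (congrArg abs ?_) (h2.trans (by gcongr; linarith))
    unfold ladderFactor
    ring
  · refine Eq.trans_le (congrArg abs ?_) (h3.trans (by gcongr; linarith))
    unfold ladderFactor
    ring

lemma norm_ladder_step_sub_le : ∃ K > 0, ∀ᶠ κ : ℝ in atTop, 0 < ladderFactor μ d κ ∧
    ∀ X V X' V' : ℝ, X' = μ * X + (κ + 1 / 2) * V →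
      V' = μ * V - (κ + 1 / 2) * ((κ + 1 / 2) ^ 2 - (1 / 4 - 2 * d)) * X →
      ‖-(sin (centralPhaseJump μ d κ) + Complex.I * cos (centralPhaseJump μ d κ) : ℂ) *
          (X' * centralPhaseDeriv d (κ + 1) +
            Complex.I * (X' * centralLogAmpDeriv μ d (κ + 1) - V')) -
        ladderFactor μ d κ * (X * centralPhaseDeriv d κ +
          Complex.I * (X * centralLogAmpDeriv μ d κ - V))‖ ≤
      K / κ ^ 6 * ‖(ladderFactor μ d κ * (X * centralPhaseDeriv d κ +
          Complex.I * (X * centralLogAmpDeriv μ d κ - V)) : ℂ)‖ := by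
  obtain ⟨K, hK, h⟩ := eventually_ladder_defects_le μ d
  have hH : Tendsto (centralLogAmpDeriv μ d) atTop (𝓝 0) :=
    (isBigO_centralLogAmpDeriv μ d).trans_tendsto (tendsto_zpow_atTop_zero (by norm_num))
  refine ⟨48 * K, by positivity, ?_⟩
  filter_upwards [h, eventually_half_le_centralPhaseDeriv d, eventually_sq_le_ladderFactor μ d,
    eventually_ge_atTop 2, hH.eventually (Metric.ball_mem_nhds 0 one_pos)]
    with κ ⟨h1, h2, h3⟩ hP hr hκ hHκ
  rw [dist_zero_right, norm_eq_abs] at hHκ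
  have hκ0 : 0 < κ := by linarith
  have hr0 : 0 < ladderFactor μ d κ := lt_of_lt_of_le (by positivity) hr
  refine ⟨hr0, fun X V X' V' hX' hV' => ?_⟩
  set r := ladderFactor μ d κ
  set P := centralPhaseDeriv d κ
  set H := centralLogAmpDeriv μ d κ
  set ε := centralPhaseJump μ d κ
  set R := ‖(X * P + Complex.I * (X * H - V) : ℂ)‖ with hR
  set A := cos ε * ladderU μ d κ - sin ε * ((κ + 1 / 2) * centralPhaseDeriv d (κ + 1))
  set B := cos ε * ladderW μ d κ - sin ε * (μ * centralPhaseDeriv d (κ + 1)) - r * P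
  set D := cos ε * (μ * centralPhaseDeriv d (κ + 1)) + sin ε * ladderW μ d κ + r * H
  have key : -(sin ε + Complex.I * cos ε : ℂ) * (X' * centralPhaseDeriv d (κ + 1) +
      Complex.I * (X' * centralLogAmpDeriv μ d (κ + 1) - V')) -
      r * (X * P + Complex.I * (X * H - V)) =
      ((X * B + V * A : ℝ) : ℂ) - Complex.I * ((X * D : ℝ) : ℂ) := by
    have er : r = cos ε * ((κ + 1 / 2) * centralPhaseDeriv d (κ + 1)) +
      sin ε * ladderU μ d κ := rfl
    have hI := Complex.I_sq
    apply Complex.ext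
    · simp only [Complex.sub_re, Complex.mul_re, Complex.neg_re, Complex.add_re, Complex.ofReal_re,
        Complex.I_re, Complex.I_im, Complex.ofReal_im, Complex.neg_im, Complex.add_im,
        Complex.mul_im, Complex.sub_im]
      simp only [A, B, hX', hV', ladderU, ladderW]
      ring
    · simp only [Complex.sub_re, Complex.mul_re, Complex.neg_re, Complex.add_re, Complex.ofReal_re,
        Complex.I_re, Complex.I_im, Complex.ofReal_im, Complex.neg_im, Complex.add_im,
        Complex.mul_im, Complex.sub_im]
      simp only [D, hX', hV', ladderW]
      rw [er]
      simp only [ladderU]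
      ring
  have hre : |X * P| ≤ R := by
    have := Complex.abs_re_le_norm (X * P + Complex.I * (X * H - V) : ℂ)
    simpa using this
  have him : |X * H - V| ≤ R := by
    have := Complex.abs_im_le_norm (X * P + Complex.I * (X * H - V) : ℂ)
    simpa using this
  have hR0 : 0 ≤ R := norm_nonneg _
  have hX : |X| ≤ 2 * R / κ := by
    rw [abs_mul, abs_of_pos (by linarith : 0 < P)] at hre
    rw [le_div_iff₀ hκ0]
    nlinarith [abs_nonneg X]
  have hV : |V| ≤ 2 * R := by
    have e : V = X * H - (X * H - V) := by ring
    have e1 : |X * H| ≤ R := by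
      rw [abs_mul]
      rw [le_div_iff₀ hκ0] at hX
      nlinarith [abs_nonneg X, abs_nonneg H]
    rw [e]
    exact (abs_sub _ _).trans (by linarith)
  rw [key, norm_mul, Complex.norm_real, norm_eq_abs, abs_of_pos hr0, ← hR]
  have n1 : ‖((X * B + V * A : ℝ) : ℂ) - Complex.I * ((X * D : ℝ) : ℂ)‖ ≤
      |X| * |B| + |V| * |A| + |X| * |D| := by
    refine (norm_sub_le _ _).trans ?_
    rw [norm_mul, Complex.norm_I, one_mul, Complex.norm_real, Complex.norm_real, norm_eq_abs,
      norm_eq_abs, abs_mul X D, ← abs_mul X B, ← abs_mul V A]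
    linarith [abs_add_le (X * B) (V * A)]
  have z3 : κ ^ (-3 : ℤ) = 1 / κ ^ 3 := by rw [zpow_neg, zpow_ofNat, one_div]
  have z4 : κ ^ (-4 : ℤ) = 1 / κ ^ 4 := by rw [zpow_neg, zpow_ofNat, one_div]
  rw [z3] at h2 h3
  rw [z4] at h1
  have m1 : |X| * |B| ≤ 2 * R / κ * (K * (1 / κ ^ 3)) := by gcongr
  have m2 : |V| * |A| ≤ 2 * R * (K * (1 / κ ^ 4)) := by gcongr
  have m3 : |X| * |D| ≤ 2 * R / κ * (K * (1 / κ ^ 3)) := by gcongr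
  have m4 : 48 * K / κ ^ 6 * (κ ^ 2 / 8 * R) ≤ 48 * K / κ ^ 6 * (r * R) := by gcongr
  have m5 : 2 * R / κ * (K * (1 / κ ^ 3)) + 2 * R * (K * (1 / κ ^ 4)) +
      2 * R / κ * (K * (1 / κ ^ 3)) = 48 * K / κ ^ 6 * (κ ^ 2 / 8 * R) := by
    field_simp
    ring
  linarith

end LadderStep

section CentralAngle

variable (α β : ℝ)

lemma halfPot_pi_div_two : halfPot α β (π / 2) = 1 / 8 - (α ^ 2 + β ^ 2) / 4 := by
  unfold halfPot jacobiPot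
  rw [halfCot_pi_div_two, halfTan_pi_div_two]
  ring

lemma phaseDeriv_pi_div_two (κ : ℝ) :
    phaseDeriv α β κ (π / 2) = centralPhaseDeriv (halfPot α β (π / 2)) κ := by
  have h : phaseD3 α β (π / 2) = -(halfPot α β (π / 2) + halfPot α β (π / 2) ^ 2) / 2 := by
    unfold phaseD3 halfPotD2
    rw [halfPot_pi_div_two, halfCot_pi_div_two, halfTan_pi_div_two]
    ring
  unfold phaseDeriv centralPhaseDeriv
  rw [h]

lemma logAmpDeriv_pi_div_two (κ : ℝ) : logAmpDeriv α β κ (π / 2) =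
    centralLogAmpDeriv ((α ^ 2 - β ^ 2) / 4) (halfPot α β (π / 2)) κ := by
  have h1 : halfPotD1 α β (π / 2) = (α ^ 2 - β ^ 2) / 4 := by
    unfold halfPotD1
    rw [halfCot_pi_div_two, halfTan_pi_div_two]
    ring
  have h2 : ampD4 α β (π / 2) = (α ^ 2 - β ^ 2) / 4 * (5 / 8 + halfPot α β (π / 2)) := by
    unfold ampD4 halfPotD3
    rw [h1, halfCot_pi_div_two, halfTan_pi_div_two]
    ring
  unfold logAmpDeriv centralLogAmpDeriv
  rw [h1, h2]

lemma phase_pi_div_two (κ : ℝ) : phase α β κ (π / 2) = κ * (π / 2) +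
    ((α ^ 2 - β ^ 2) / 4 / κ +
      -((α ^ 2 - β ^ 2) / 4) * (3 + 4 * halfPot α β (π / 2)) / 12 / κ ^ 3) := by
  have h1 : phaseC1 α β (π / 2) = (α ^ 2 - β ^ 2) / 4 := by
    unfold phaseC1
    rw [halfCot_pi_div_two, halfTan_pi_div_two]
    ring
  have h2 : phaseC3 α β (π / 2) =
      -((α ^ 2 - β ^ 2) / 4) * (3 + 4 * halfPot α β (π / 2)) / 12 := by
    unfold phaseC3 halfPotD1
    rw [halfPot_pi_div_two, halfCot_pi_div_two, halfTan_pi_div_two]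
    ring
  unfold phase
  rw [h1, h2]
  ring

lemma phase_succ_pi_div_two (κ : ℝ) : phase α β (κ + 1) (π / 2) = phase α β κ (π / 2) + π / 2 +
    centralPhaseJump ((α ^ 2 - β ^ 2) / 4) (halfPot α β (π / 2)) κ := by
  rw [phase_pi_div_two, phase_pi_div_two]
  unfold centralPhaseJump
  ring

/-- The value at the origin of the Jacobi polynomial, in Liouville's normal form. -/
noncomputable def centralValue (n : ℕ) : ℝ := (normJacobi α β n).eval (-1 / 2)

/-- The slope at the origin of the Jacobi polynomial, in Liouville's normal form. -/
noncomputable def centralSlope (n : ℕ) : ℝ :=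
  (α - β) / 2 * (normJacobi α β n).eval (-1 / 2) - (normJacobi α β n).derivative.eval (-1 / 2) / 2

lemma central_ladder {α : ℝ} (hα : -1 < α) (β : ℝ) {n : ℕ} (hn : 0 < n + α + β + 1)
    (hκ : 0 < jacobiFreq α β n) :
    (n + α + β + 1) * (n + α + 1) * centralValue α β (n + 1) =
      (α ^ 2 - β ^ 2) / 4 * centralValue α β n +
        (jacobiFreq α β n + 1 / 2) * centralSlope α β n ∧
    (n + α + β + 1) * (n + α + 1) * centralSlope α β (n + 1) =
      (α ^ 2 - β ^ 2) / 4 * centralSlope α β n - (jacobiFreq α β n + 1 / 2) *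
        ((jacobiFreq α β n + 1 / 2) ^ 2 - (1 / 4 - 2 * halfPot α β (π / 2))) *
          centralValue α β n := by
  obtain ⟨h1, h2⟩ := normJacobi_ladder (β := β) hα hn rfl rfl rfl
  have hm : jacobiFreq α β n + 1 / 2 ≠ 0 := by positivity
  have hl : (n + α + β + 1) * (n + α + 1) * centralValue α β (n + 1) =
      (α ^ 2 - β ^ 2) / 4 * centralValue α β n +
        (jacobiFreq α β n + 1 / 2) * centralSlope α β n := by
    unfold centralValue centralSlope jacobiFreq
    linear_combination h1
  refine ⟨hl, mul_left_cancel₀ hm ?_⟩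
  rw [halfPot_pi_div_two]
  unfold centralValue centralSlope jacobiFreq at hl ⊢
  linear_combination (α ^ 2 - β ^ 2) / 4 * hl - (n + α + β + 1) * (n + α + 1) * h2

lemma refinedWave_pi_div_two (n : ℕ) : refinedWave α β n (π / 2) =
    (liouWeight α β (π / 2) * exp (logAmp α β (jacobiFreq α β n) (π / 2)) : ℝ) *
      ((centralValue α β n * centralPhaseDeriv (halfPot α β (π / 2)) (jacobiFreq α β n) +
        Complex.I * (centralValue α β n * centralLogAmpDeriv ((α ^ 2 - β ^ 2) / 4)
          (halfPot α β (π / 2)) (jacobiFreq α β n) - centralSlope α β n)) *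
        Complex.exp (-(Complex.I * phase α β (jacobiFreq α β n) (π / 2)))) := by
  have h1 : liouJacobi α β n (π / 2) = liouWeight α β (π / 2) * centralValue α β n :=
    liouJacobi_pi_div_two α β n
  have h2 : liouJacobiDeriv α β n (π / 2) = liouWeight α β (π / 2) * centralSlope α β n :=
    liouJacobiDeriv_pi_div_two α β n
  unfold refinedWave
  rw [h1, h2, phaseDeriv_pi_div_two, logAmpDeriv_pi_div_two, sub_eq_add_neg (logAmp _ _ _ _ : ℂ),
    Complex.exp_add]
  push_cast
  linear_combination -(liouWeight α β (π / 2) * centralValue α β n *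
    centralPhaseDeriv (halfPot α β (π / 2)) (jacobiFreq α β n) *
    Complex.exp (logAmp α β (jacobiFreq α β n) (π / 2)) *
    Complex.exp (-(Complex.I * phase α β (jacobiFreq α β n) (π / 2))) : ℂ) * Complex.I_sq

/-- The angle between the real axis and the refined wave at `π / 2`, rotated by the phase
shift at the endpoint. -/
noncomputable def centralAngle (n : ℕ) : ℝ :=
  axisAngle (refinedWave α β n (π / 2) * Complex.exp (Complex.I * ((α / 2 + 1 / 4) * π : ℝ)))

lemma liouWeight_pos (θ : ℝ) : 0 < liouWeight α β θ := exp_pos _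

lemma centralAngle_eq (n : ℕ) : centralAngle α β n = axisAngle
    ((centralValue α β n * centralPhaseDeriv (halfPot α β (π / 2)) (jacobiFreq α β n) +
      Complex.I * (centralValue α β n * centralLogAmpDeriv ((α ^ 2 - β ^ 2) / 4)
        (halfPot α β (π / 2)) (jacobiFreq α β n) - centralSlope α β n)) *
      Complex.exp (Complex.I *
        ((α / 2 + 1 / 4) * π - phase α β (jacobiFreq α β n) (π / 2) : ℝ))) := by
  have hw := liouWeight_pos α β (π / 2)
  unfold centralAngle
  rw [refinedWave_pi_div_two, mul_assoc _ _ (Complex.exp _), axisAngle_real_mul (by positivity),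
    mul_assoc _ (Complex.exp _), ← Complex.exp_add]
  congr 3
  push_cast
  ring

lemma eventually_abs_centralAngle_succ_sub_le {α : ℝ} (hα : -1 < α) (β : ℝ) :
    ∃ K > 0, ∀ᶠ n in atTop, |centralAngle α β (n + 1) - centralAngle α β n| ≤
      K / jacobiFreq α β n ^ 6 := by
  obtain ⟨K, hK, h⟩ := norm_ladder_step_sub_le ((α ^ 2 - β ^ 2) / 4) (halfPot α β (π / 2))
  refine ⟨2 * K, by positivity, ?_⟩
  filter_upwards [(tendsto_jacobiFreq α β).eventually h,
    (tendsto_jacobiFreq α β).eventually_gt_atTop 0,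
    (tendsto_natCast_atTop_atTop (R := ℝ)).eventually_gt_atTop (-(α + β + 1))]
    with n ⟨hr, hs⟩ hκ hn
  have hn' : 0 < n + α + β + 1 := by linarith
  obtain ⟨l1, l2⟩ := central_ladder hα β hn' hκ
  have hD : 0 < (n + α + β + 1) * (n + α + 1) := by
    have : (0 : ℝ) ≤ n := n.cast_nonneg
    have : 0 < n + α + 1 := by linarith
    positivity
  have key := hs _ _ _ _ l1 l2
  have hfreq : jacobiFreq α β (n + 1) = jacobiFreq α β n + 1 := by
    unfold jacobiFreq; push_cast; ring
  rw [centralAngle_eq, centralAngle_eq, hfreq, phase_succ_pi_div_two]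
  set ε := centralPhaseJump ((α ^ 2 - β ^ 2) / 4) (halfPot α β (π / 2)) (jacobiFreq α β n)
  set Φ := phase α β (jacobiFreq α β n) (π / 2)
  set κ := jacobiFreq α β n
  have he : Complex.exp (Complex.I * ((α / 2 + 1 / 4) * π - (Φ + π / 2 + ε) : ℝ)) =
      -(sin ε + Complex.I * cos ε : ℂ) *
        Complex.exp (Complex.I * ((α / 2 + 1 / 4) * π - Φ : ℝ)) := by
    have e1 : Complex.exp (-(Complex.I * (π / 2 + ε : ℝ))) = -(sin ε + Complex.I * cos ε : ℂ) := by
      rw [show -(Complex.I * (π / 2 + ε : ℝ)) = ((-(π / 2 + ε) : ℝ) : ℂ) * Complex.I by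
        push_cast; ring, Complex.exp_mul_I, ← Complex.ofReal_cos, ← Complex.ofReal_sin, cos_neg,
        sin_neg, add_comm (π / 2) ε, cos_add_pi_div_two, sin_add_pi_div_two]
      push_cast; ring
    rw [← e1, ← Complex.exp_add]
    congr 1
    push_cast; ring
  rw [he]
  set E := Complex.exp (Complex.I * ((α / 2 + 1 / 4) * π - Φ : ℝ)) with hE'
  rw [← axisAngle_real_mul hD.ne', ← axisAngle_real_mul hr.ne' (_ * E), mul_div_assoc]
  refine axisAngle_sub_le (by positivity) ?_
  have hE : ‖E‖ = 1 := by
    rw [hE', mul_comm, Complex.norm_exp_ofReal_mul_I]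
  rw [← mul_assoc (ladderFactor _ _ _ : ℂ), norm_mul _ E, hE, mul_one]
  have hmul (w : ℂ) : ‖w * E‖ = ‖w‖ := by rw [norm_mul, hE, mul_one]
  refine ((congrArg norm ?_).trans (hmul _)).trans_le key
  push_cast
  ring

lemma tendsto_centralAngle {α : ℝ} (hα : -1 < α) (β : ℝ) :
    Tendsto (centralAngle α β) atTop (𝓝 0) := by
  have hκ := tendsto_jacobiFreq α β
  set d := halfPot α β (π / 2) with hd
  set μ := (α ^ 2 - β ^ 2) / 4 with hμ
  have hη : Tendsto (fun n => μ / jacobiFreq α β n +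
      -μ * (3 + 4 * d) / 12 / jacobiFreq α β n ^ 3) atTop (𝓝 0) := by
    simpa using (hκ.const_div_atTop μ).add
      (((tendsto_pow_atTop (n := 3) (by norm_num)).comp hκ).const_div_atTop
        (-μ * (3 + 4 * d) / 12))
  have hH : Tendsto (fun n => centralLogAmpDeriv μ d (jacobiFreq α β n)) atTop (𝓝 0) :=
    ((isBigO_centralLogAmpDeriv μ d).trans_tendsto
      (tendsto_zpow_atTop_zero (by norm_num))).comp hκ
  have hP : Tendsto (fun n => centralPhaseDeriv d (jacobiFreq α β n) - jacobiFreq α β n) atTop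
      (𝓝 0) := by
    have := (hκ.const_div_atTop d).add
      (((tendsto_pow_atTop (n := 3) (by norm_num)).comp hκ).const_div_atTop
        (-(d + d ^ 2) / 2))
    rw [add_zero] at this
    refine this.congr fun n => ?_
    simp only [Function.comp, centralPhaseDeriv]
    ring
  have hE : Tendsto (fun n => Complex.exp (-(Complex.I * (μ / jacobiFreq α β n +
      -μ * (3 + 4 * d) / 12 / jacobiFreq α β n ^ 3 : ℝ))) - 1) atTop (𝓝 0) := by
    have h1 : Continuous fun x : ℝ => Complex.exp (-(Complex.I * x)) - 1 := by fun_prop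
    have h2 := (h1.tendsto 0).comp hη
    simpa [Function.comp_def] using h2
  have hsum := (((hP.abs.add hH.abs).add hE.norm)).const_mul 2
  simp only [abs_zero, norm_zero, add_zero, mul_zero] at hsum
  have hdiff : Tendsto (fun n => centralAngle α β n - leadAngle α β n) atTop (𝓝 0) := by
    refine squeeze_zero_norm' ?_ hsum
    filter_upwards [hκ.eventually_ge_atTop 1] with n hn
    set κ := jacobiFreq α β n with hκd
    set E := Complex.exp (-(Complex.I * (μ / κ + -μ * (3 + 4 * d) / 12 / κ ^ 3 : ℝ))) with hEd
    have hw := liouWeight_pos α β (π / 2)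
    have e1 : leadAngle α β n = axisAngle ((centralValue α β n * κ -
        Complex.I * centralSlope α β n) *
        Complex.exp (Complex.I * ((α / 2 + 1 / 4) * π - κ * (π / 2) : ℝ))) := by
      have h1 : liouJacobi α β n (π / 2) = liouWeight α β (π / 2) * centralValue α β n :=
        liouJacobi_pi_div_two α β n
      have h2 : liouJacobiDeriv α β n (π / 2) = liouWeight α β (π / 2) * centralSlope α β n :=
        liouJacobiDeriv_pi_div_two α β n
      have h3 : Complex.exp (Complex.I * ((α / 2 + 1 / 4) * π - κ * (π / 2) : ℝ)) =
          Complex.exp (-(Complex.I * κ) * (π / 2 : ℝ)) *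
            Complex.exp (Complex.I * ((α / 2 + 1 / 4) * π : ℝ)) := by
        rw [← Complex.exp_add]
        congr 1
        push_cast; ring
      unfold leadAngle jacobiWave
      rw [h1, h2, ← hκd, h3, ← axisAngle_real_mul hw.ne' ((_ - _) * _)]
      congr 1
      push_cast
      linear_combination -(liouWeight α β (π / 2) * centralValue α β n * κ *
        Complex.exp (-(Complex.I * κ) * (π / 2)) *
          Complex.exp (Complex.I * ((α / 2 + 1 / 4) * π)) : ℂ) * Complex.I_sq
    have e2 : Complex.exp (Complex.I * ((α / 2 + 1 / 4) * π - phase α β κ (π / 2) : ℝ)) =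
        E * Complex.exp (Complex.I * ((α / 2 + 1 / 4) * π - κ * (π / 2) : ℝ)) := by
      rw [hEd, ← Complex.exp_add, phase_pi_div_two, ← hμ, ← hd]
      congr 1
      push_cast; ring
    rw [centralAngle_eq, e1, ← hκd, ← hμ, ← hd, e2, norm_eq_abs]
    refine axisAngle_sub_le (by positivity) ?_
    set G := Complex.exp (Complex.I * ((α / 2 + 1 / 4) * π - κ * (π / 2) : ℝ)) with hGd
    have hG : ‖G‖ = 1 := by rw [hGd, mul_comm, Complex.norm_exp_ofReal_mul_I]
    have hEn : ‖E‖ = 1 := by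
      rw [hEd, show ∀ x : ℝ, -(Complex.I * x) = ((-x : ℝ) : ℂ) * Complex.I by
        intro x; push_cast; ring, Complex.norm_exp_ofReal_mul_I]
    set X := centralValue α β n
    set V := centralSlope α β n
    set P := centralPhaseDeriv d κ
    set H := centralLogAmpDeriv μ d κ
    have e3 : (X * P + Complex.I * (X * H - V)) * (E * G) - (X * κ - Complex.I * V) * G =
        ((X * (P - κ) + Complex.I * (X * H)) * E + (X * κ - Complex.I * V) * (E - 1)) * G := by
      ring
    have hX : |X| ≤ ‖(X * κ - Complex.I * V : ℂ)‖ := by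
      have h1 := Complex.abs_re_le_norm (X * κ - Complex.I * V : ℂ)
      have h2 : (X * κ - Complex.I * V : ℂ).re = X * κ := by simp
      rw [h2, abs_mul, abs_of_nonneg (by linarith : 0 ≤ κ)] at h1
      nlinarith [abs_nonneg X]
    rw [e3, norm_mul, norm_mul _ G, hG, mul_one, mul_one]
    refine (norm_add_le _ _).trans ?_
    rw [norm_mul, norm_mul _ (E - 1), hEn, mul_one]
    have h4 : ‖(X * (P - κ) + Complex.I * (X * H) : ℂ)‖ ≤ |X| * |P - κ| + |X| * |H| := by
      refine (norm_add_le _ _).trans (le_of_eq ?_)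
      rw [norm_mul, norm_mul, norm_mul, Complex.norm_I, one_mul, ← Complex.ofReal_sub,
        Complex.norm_real, Complex.norm_real, Complex.norm_real]
      rfl
    nlinarith [mul_le_mul_of_nonneg_right hX (abs_nonneg (P - κ)),
      mul_le_mul_of_nonneg_right hX (abs_nonneg H)]
  simpa using hdiff.add (tendsto_leadAngle hα β)

lemma eventually_centralAngle_le {α : ℝ} (hα : -1 < α) (β : ℝ) :
    ∃ K > 0, ∀ᶠ n in atTop, centralAngle α β n ≤ K / jacobiFreq α β n ^ 5 := by
  obtain ⟨K, hK, h⟩ := eventually_abs_centralAngle_succ_sub_le hα β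
  have hκ := tendsto_jacobiFreq α β
  refine ⟨7 * K, by positivity, ?_⟩
  obtain ⟨N, hN⟩ := (h.and (hκ.eventually_ge_atTop 1)).exists_forall_of_atTop
  have hm : Monotone fun n => centralAngle α β (n + N) - 7 * K / jacobiFreq α β (n + N) ^ 5 := by
    refine monotone_nat_of_le_succ fun n => ?_
    obtain ⟨h1, h2⟩ := hN (n + N) (by omega)
    have e : jacobiFreq α β (n + 1 + N) = jacobiFreq α β (n + N) + 1 := by
      unfold jacobiFreq; push_cast; ring
    rw [e, show n + 1 + N = n + N + 1 by ring]
    set κ := jacobiFreq α β (n + N)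
    have hκ0 : 0 < κ := by linarith
    have h3 : K / κ ^ 6 ≤ 7 * K / κ ^ 5 - 7 * K / (κ + 1) ^ 5 := by
      rw [div_sub_div _ _ (by positivity) (by positivity), div_le_div_iff₀ (by positivity)
        (by positivity)]
      have h4 : (κ + 1) ^ 5 ≤ 7 * κ * ((κ + 1) ^ 5 - κ ^ 5) := by
        have : 0 ≤ κ - 1 := by linarith
        obtain ⟨t, ht, hκt⟩ : ∃ t, 0 ≤ t ∧ κ = t + 1 := ⟨κ - 1, this, by ring⟩
        rw [hκt]
        rw [← sub_nonneg]
        ring_nf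
        positivity
      have h5 := mul_le_mul_of_nonneg_left h4 (show 0 ≤ K * κ ^ 5 by positivity)
      nlinarith
    have := (abs_le.1 h1).1
    linarith
  have ht : Tendsto (fun n => centralAngle α β (n + N) - 7 * K / jacobiFreq α β (n + N) ^ 5)
      atTop (𝓝 0) := by
    have h1 := (tendsto_centralAngle hα β).sub
      (((tendsto_pow_atTop (n := 5) (by norm_num)).comp hκ).const_div_atTop (7 * K))
    rw [sub_zero] at h1
    exact (tendsto_add_atTop_iff_nat N).2 h1
  filter_upwards [eventually_ge_atTop N] with n hn
  have := hm.ge_of_tendsto ht (n - N)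
  rw [Nat.sub_add_cancel hn] at this
  linarith

end CentralAngle

section Zeros

lemma abs_sub_le_mul_of_hasDerivAt {f f' : ℝ → ℝ} {a b K : ℝ}
    (hf : ∀ x ∈ Set.Icc a b, HasDerivAt f (f' x) x) (hK : ∀ x ∈ Set.Icc a b, |f' x| ≤ K)
    {x y : ℝ} (hx : x ∈ Set.Icc a b) (hy : y ∈ Set.Icc a b) : |f y - f x| ≤ K * |y - x| :=
  (convex_Icc a b).norm_image_sub_le_of_norm_hasDerivWithin_le
    (fun t ht => (hf t ht).hasDerivWithinAt) hK hx hy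

lemma abs_sub_sub_le_mul_sq_of_hasDerivAt {f f' f'' : ℝ → ℝ} {a b K : ℝ}
    (hf : ∀ x ∈ Set.Icc a b, HasDerivAt f (f' x) x)
    (hf' : ∀ x ∈ Set.Icc a b, HasDerivAt f' (f'' x) x) (hK : ∀ x ∈ Set.Icc a b, |f'' x| ≤ K)
    {x y : ℝ} (hx : x ∈ Set.Icc a b) (hy : y ∈ Set.Icc a b) :
    |f y - f x - f' x * (y - x)| ≤ K * |y - x| ^ 2 := by
  have hK0 : 0 ≤ K := (abs_nonneg _).trans (hK x hx)
  have hsub : Set.Icc (min x y) (max x y) ⊆ Set.Icc a b :=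
    Set.Icc_subset_Icc (le_min hx.1 hy.1) (max_le hx.2 hy.2)
  have h := abs_sub_le_mul_of_hasDerivAt (f := fun t => f t - f' x * t)
    (f' := fun t => f' t - f' x) (a := min x y) (b := max x y) (K := K * |y - x|)
    (fun t ht => ((hf t (hsub ht)).sub ((hasDerivAt_id t).const_mul (f' x))).congr_deriv (by ring))
    (fun t ht => (abs_sub_le_mul_of_hasDerivAt hf' hK hx (hsub ht)).trans
      (mul_le_mul_of_nonneg_left (Set.abs_sub_left_of_mem_uIcc ht) hK0))
    (x := x) (y := y) ⟨min_le_left _ _, le_max_left _ _⟩ ⟨min_le_right _ _, le_max_right _ _⟩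
  calc |f y - f x - f' x * (y - x)| = |f y - f' x * y - (f x - f' x * x)| := by congr 1; ring
    _ ≤ _ := h
    _ = _ := by ring

lemma cos_eq_halfCot {θ : ℝ} (h : θ ∈ Set.Ioo 0 π) :
    cos θ = (halfCot θ ^ 2 - 1) / (halfCot θ ^ 2 + 1) := by
  have hs := (sin_half_pos h).ne'
  have h1 := sin_sq_add_cos_sq (θ / 2)
  have h2 : cos θ = cos (θ / 2) ^ 2 - sin (θ / 2) ^ 2 := by
    rw [← cos_two_mul']; congr 1; ring
  unfold halfCot
  rw [h2, div_pow, div_sub_one (by positivity), div_add_one (by positivity),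
    div_div_div_cancel_right₀ (by positivity), add_comm, h1, div_one]

lemma sin_eq_halfCot {θ : ℝ} (h : θ ∈ Set.Ioo 0 π) :
    sin θ = 2 * halfCot θ / (halfCot θ ^ 2 + 1) := by
  have hs := (sin_half_pos h).ne'
  have h1 := sin_sq_add_cos_sq (θ / 2)
  have h2 : sin θ = 2 * sin (θ / 2) * cos (θ / 2) := by
    rw [← sin_two_mul]; congr 1; ring
  have h3 : halfCot θ ^ 2 + 1 = 1 / sin (θ / 2) ^ 2 := by
    unfold halfCot
    rw [div_pow, div_add_one (by positivity), add_comm, h1]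
  rw [h3, h2]
  unfold halfCot
  field_simp

lemma halfCot_pos {θ : ℝ} (h : θ ∈ Set.Ioo 0 π) : 0 < halfCot θ :=
  div_pos (cos_half_pos h) (sin_half_pos h)

lemma halfTan_eq_inv (θ : ℝ) : halfTan θ = (halfCot θ)⁻¹ := by
  unfold halfTan halfCot
  rw [inv_div]

lemma phaseC1_eq (α β : ℝ) {θ : ℝ} (h : θ ∈ Set.Ioo 0 π) :
    -phaseC1 α β θ = -(2 * β ^ 2 * cos θ + 2 * α ^ 2 * cos θ - cos θ - 2 * β ^ 2 + 2 * α ^ 2) /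
      (8 * sin θ) := by
  have hP := halfCot_pos h
  unfold phaseC1
  rw [halfTan_eq_inv, cos_eq_halfCot h, sin_eq_halfCot h]
  field_simp
  ring

lemma phaseC1_mul_halfPot_sub_phaseC3_eq (α β : ℝ) {θ : ℝ} (h : θ ∈ Set.Ioo 0 π) :
    phaseC1 α β θ * halfPot α β θ - phaseC3 α β θ = (1 / (384 * (sin θ) ^ 3)) *
      (-33 * cos θ - 36 * β ^ 2 * cos θ ^ 2 + 36 * α ^ 2 * cos θ ^ 2 + 24 * β ^ 4 * cos θ ^ 2 -
        24 * α ^ 4 * cos θ ^ 2 + 2 * cos θ ^ 3 + 84 * β ^ 2 * cos θ - 60 * α ^ 4 * cos θ -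
        60 * β ^ 4 * cos θ + 84 * α ^ 2 * cos θ + 4 * β ^ 4 * cos θ ^ 3 +
        4 * α ^ 4 * cos θ ^ 3 - 8 * β ^ 2 * cos θ ^ 3 + 40 * α ^ 2 - 8 * α ^ 2 * cos θ ^ 3 -
        40 * β ^ 2 + 32 * β ^ 4 - 32 * α ^ 4 + 24 * α ^ 2 * β ^ 2 * cos θ ^ 3 -
        24 * α ^ 2 * β ^ 2 * cos θ) := by
  have hP := halfCot_pos h
  unfold phaseC3 phaseC1 halfPot jacobiPot halfPotD1
  rw [halfTan_eq_inv, cos_eq_halfCot h, sin_eq_halfCot h]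
  field_simp
  ring

lemma phase_expansion (α β : ℝ) {δ : ℝ} (hδ : 0 < δ) : ∃ K > 0, ∀ κ ≥ K,
    ∀ θ₀ ∈ Set.Icc δ (π - δ), ∀ h : ℝ, |h| ≤ 1 / κ ^ 2 →
      let θ := θ₀ + -phaseC1 α β θ₀ / κ ^ 2 +
        (phaseC1 α β θ₀ * halfPot α β θ₀ - phaseC3 α β θ₀) / κ ^ 4 + h
      θ ∈ Set.Icc (δ / 2) (π - δ / 2) ∧
        |phase α β κ θ - κ * θ₀ - κ * h| ≤ K / κ ^ 5 + K * |h| / κ := by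
  have hδ2 : 0 < δ / 2 := by positivity
  have hmem {x : ℝ} (hx : x ∈ Set.Icc (δ / 2) (π - δ / 2)) : x ∈ Set.Ioo 0 π :=
    ⟨by linarith [hx.1], by linarith [hx.2]⟩
  obtain ⟨hc0, hc1, -, -, hc3, -⟩ := continuousOn_halfPots α β
  have hC1 : ContinuousOn (phaseC1 α β) (Set.Ioo 0 π) := fun _ h =>
    (hasDerivAt_phaseC1 α β h).continuousAt.continuousWithinAt
  have hC3 : ContinuousOn (phaseC3 α β) (Set.Ioo 0 π) := fun _ h =>
    (hasDerivAt_phaseC3 α β h).continuousAt.continuousWithinAt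
  obtain ⟨B1, hB1, b1⟩ := exists_abs_le_of_continuousOn hC1 hδ2
  obtain ⟨B2, hB2, b2⟩ := exists_abs_le_of_continuousOn
    (f := fun x => phaseC1 α β x * halfPot α β x - phaseC3 α β x) (by fun_prop) hδ2
  obtain ⟨L0, hL0, l0⟩ := exists_abs_le_of_continuousOn hc0 hδ2
  obtain ⟨L1, hL1, l1⟩ := exists_abs_le_of_continuousOn hc1 hδ2
  obtain ⟨L3, hL3, l3⟩ := exists_abs_le_of_continuousOn hc3 hδ2
  set S := B1 + B2 + 1 with hS
  have hS0 : 0 < S := by positivity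
  refine ⟨1 + 2 * S / δ + L0 + L0 * B2 + L1 * S ^ 2 + L3 * S, by positivity, ?_⟩
  intro κ hκ θ₀ hθ₀ h hh θ
  set K := 1 + 2 * S / δ + L0 + L0 * B2 + L1 * S ^ 2 + L3 * S with hK
  have hSδ : 0 < S / δ := by positivity
  have p1 : 0 < 2 * S / δ := by positivity
  have p2 : 0 < L0 * B2 := by positivity
  have p3 : 0 < L1 * S ^ 2 := by positivity
  have p4 : 0 < L3 * S := by positivity
  have hκ1 : 1 ≤ κ := by linarith
  have hκ0 : 0 < κ := by linarith
  have hθ₀' : θ₀ ∈ Set.Icc (δ / 2) (π - δ / 2) := ⟨by linarith [hθ₀.1], by linarith [hθ₀.2]⟩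
  have q1 := b1 θ₀ hθ₀'
  have q2 := b2 θ₀ hθ₀'
  have q0 := l0 θ₀ hθ₀'
  set t₁ := phaseC1 α β θ₀
  set t₂ := t₁ * halfPot α β θ₀ - phaseC3 α β θ₀ with ht₂
  have hs : |θ - θ₀| ≤ S / κ ^ 2 := by
    have e : θ - θ₀ = -t₁ / κ ^ 2 + t₂ / κ ^ 4 + h := by simp only [θ]; ring
    have e1 : |-t₁ / κ ^ 2| ≤ B1 / κ ^ 2 := by
      rw [abs_div, abs_neg, abs_of_pos (by positivity : 0 < κ ^ 2)]
      gcongr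
    have e2 : |t₂ / κ ^ 4| ≤ B2 / κ ^ 2 := by
      rw [abs_div, abs_of_pos (by positivity : 0 < κ ^ 4)]
      gcongr
      norm_num
    rw [e, hS, add_div, add_div]
    exact (abs_add_le _ _).trans (add_le_add ((abs_add_le _ _).trans (add_le_add e1 e2)) hh)
  have hθ : θ ∈ Set.Icc (δ / 2) (π - δ / 2) := by
    have h1 : S / κ ^ 2 ≤ δ / 2 := by
      have h2 : 2 * S ≤ κ * δ := by
        rw [← div_le_iff₀ hδ]
        linarith
      rw [div_le_iff₀ (by positivity)]
      nlinarith [mul_pos hκ0 hδ]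
    have h2 := abs_le.1 (hs.trans h1)
    exact ⟨by linarith [hθ₀.1], by linarith [hθ₀.2]⟩
  refine ⟨hθ, ?_⟩
  have r1 := abs_sub_sub_le_mul_sq_of_hasDerivAt (fun x hx => hasDerivAt_phaseC1 α β (hmem hx))
    (fun x hx => hasDerivAt_halfPot α β (hmem hx)) l1 hθ₀' hθ
  have r3 := abs_sub_le_mul_of_hasDerivAt (fun x hx => hasDerivAt_phaseC3 α β (hmem hx)) l3 hθ₀' hθ
  have e : phase α β κ θ - κ * θ₀ - κ * h =
      (phaseC1 α β θ - t₁ - halfPot α β θ₀ * (θ - θ₀)) / κ + (phaseC3 α β θ - phaseC3 α β θ₀) / κ ^ 3 +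
        (halfPot α β θ₀ * t₂ / κ ^ 5 + halfPot α β θ₀ * h / κ) := by
    have e0 : θ - θ₀ = -t₁ / κ ^ 2 + t₂ / κ ^ 4 + h := by simp only [θ]; ring
    have e1 : κ * θ = κ * θ₀ + -t₁ / κ + t₂ / κ ^ 3 + κ * h := by
      have hθd : θ = θ₀ + -t₁ / κ ^ 2 + t₂ / κ ^ 4 + h := rfl
      rw [hθd]
      field_simp
    unfold phase
    rw [e1, e0, ht₂]
    field_simp
    ring
  have s1 : |(phaseC1 α β θ - t₁ - halfPot α β θ₀ * (θ - θ₀)) / κ| ≤ L1 * S ^ 2 / κ ^ 5 := by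
    rw [abs_div, abs_of_pos hκ0, div_le_iff₀ hκ0]
    refine r1.trans ?_
    calc L1 * |θ - θ₀| ^ 2 ≤ L1 * (S / κ ^ 2) ^ 2 := by gcongr
      _ = _ := by field_simp
  have s3 : |(phaseC3 α β θ - phaseC3 α β θ₀) / κ ^ 3| ≤ L3 * S / κ ^ 5 := by
    rw [abs_div, abs_of_pos (by positivity : 0 < κ ^ 3), div_le_iff₀ (by positivity)]
    refine r3.trans ?_
    calc L3 * |θ - θ₀| ≤ L3 * (S / κ ^ 2) := by gcongr
      _ = _ := by field_simp
  have s4 : |halfPot α β θ₀ * t₂ / κ ^ 5| ≤ L0 * B2 / κ ^ 5 := by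
    rw [abs_div, abs_mul, abs_of_pos (by positivity : 0 < κ ^ 5)]
    gcongr
  have s5 : |halfPot α β θ₀ * h / κ| ≤ K * |h| / κ := by
    rw [abs_div, abs_mul, abs_of_pos hκ0]
    gcongr
    linarith
  have s6 : L1 * S ^ 2 / κ ^ 5 + L3 * S / κ ^ 5 + L0 * B2 / κ ^ 5 ≤ K / κ ^ 5 := by
    rw [← add_div, ← add_div]
    gcongr
    linarith
  rw [e]
  refine (abs_add_le _ _).trans ?_
  linarith [abs_add_le ((phaseC1 α β θ - t₁ - halfPot α β θ₀ * (θ - θ₀)) / κ)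
    ((phaseC3 α β θ - phaseC3 α β θ₀) / κ ^ 3),
    abs_add_le (halfPot α β θ₀ * t₂ / κ ^ 5) (halfPot α β θ₀ * h / κ)]

lemma liouJacobi_near_cos {α : ℝ} (hα : -1 < α) (β : ℝ) {δ : ℝ} (hδ : 0 < δ) (hδ' : δ ≤ π / 2) :
    ∃ K > 0, ∀ᶠ n in atTop, ∃ a : ℝ, ∀ θ ∈ Set.Icc δ (π - δ), ∃ p > 0,
      |p * liouJacobi α β n θ - a * cos (phase α β (jacobiFreq α β n) θ - (α / 2 + 1 / 4) * π)| ≤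
        K / jacobiFreq α β n ^ 5 * |a| := by
  obtain ⟨K1, hK1, h1⟩ := norm_refinedWave_sub_le hα β hδ hδ'
  obtain ⟨K2, hK2, h2⟩ := eventually_centralAngle_le hα β
  have hκ := tendsto_jacobiFreq α β
  refine ⟨2 * (K1 + K2), by positivity, ?_⟩
  filter_upwards [h2, hκ.eventually_ge_atTop K1, hκ.eventually_ge_atTop (2 * K2)] with n hn hκ1 hκ2
  set κ := jacobiFreq α β n with hκd
  have hκ0 : 1 ≤ κ := by linarith
  have hκ5 : κ ≤ κ ^ 5 := le_self_pow₀ hκ0 (by norm_num)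
  set γ := (α / 2 + 1 / 4) * π with hγ
  set z₀ := refinedWave α β n (π / 2) with hz₀
  set w := z₀ * Complex.exp (Complex.I * (γ : ℝ)) with hw
  have hE (x : ℝ) : ‖Complex.exp (Complex.I * x)‖ = 1 := by
    rw [mul_comm, Complex.norm_exp_ofReal_mul_I]
  have hwn : ‖w‖ = ‖z₀‖ := by rw [hw, norm_mul, hE, mul_one]
  have hb : |w.im| ≤ K2 / κ ^ 5 * ‖z₀‖ := by
    rcases eq_or_ne w 0 with h0 | h0
    · rw [h0]; simp; positivity
    · have h3 : |w.im| / ‖w‖ ≤ K2 / κ ^ 5 := hn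
      rwa [div_le_iff₀ (norm_pos_iff.2 h0), hwn] at h3
  have ha : ‖z₀‖ ≤ 2 * |w.re| := by
    have h3 : K2 / κ ^ 5 ≤ 1 / 2 := by
      rw [div_le_iff₀ (by positivity)]; linarith
    have h4 := Complex.norm_le_abs_re_add_abs_im w
    rw [hwn] at h4
    nlinarith [norm_nonneg z₀]
  refine ⟨w.re, fun θ hθ => ?_⟩
  obtain ⟨hΦ, hz⟩ := h1 n hκ1 θ hθ
  rw [← hκd] at hΦ hz
  refine ⟨exp (logAmp α β κ θ) * phaseDeriv α β κ θ,
    mul_pos (exp_pos _) (by linarith), ?_⟩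
  set Φ := phase α β κ θ with hΦd
  have e1 : exp (logAmp α β κ θ) * phaseDeriv α β κ θ * liouJacobi α β n θ =
      (refinedWave α β n θ * Complex.exp (Complex.I * Φ)).re := by
    have e2 : refinedWave α β n θ * Complex.exp (Complex.I * Φ) =
        (exp (logAmp α β κ θ) * phaseDeriv α β κ θ * liouJacobi α β n θ : ℝ) +
        Complex.I * (exp (logAmp α β κ θ) * (liouJacobi α β n θ * logAmpDeriv α β κ θ -
          liouJacobiDeriv α β n θ) : ℝ) := by
      unfold refinedWave
      rw [← hκd, ← hΦd, mul_assoc, ← Complex.exp_add, sub_add_cancel]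
      push_cast
      linear_combination -(liouJacobi α β n θ * phaseDeriv α β κ θ *
        Complex.exp (logAmp α β κ θ) : ℂ) * Complex.I_sq
    rw [e2, Complex.add_re, Complex.ofReal_re, Complex.re_mul_ofReal, Complex.I_re, zero_mul,
      add_zero]
  have e3 : refinedWave α β n θ * Complex.exp (Complex.I * Φ) =
      w * Complex.exp (Complex.I * (Φ - γ : ℝ)) +
        (refinedWave α β n θ - z₀) * Complex.exp (Complex.I * Φ) := by
    rw [hw, mul_assoc, ← Complex.exp_add, ← mul_add]
    push_cast
    rw [add_sub_cancel]
    ring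
  have e4 : (w * Complex.exp (Complex.I * (Φ - γ : ℝ))).re =
      w.re * cos (Φ - γ) - w.im * sin (Φ - γ) := by
    rw [mul_comm Complex.I, Complex.mul_re, Complex.exp_ofReal_mul_I_re,
      Complex.exp_ofReal_mul_I_im]
  have e5 : |((refinedWave α β n θ - z₀) * Complex.exp (Complex.I * Φ)).re| ≤
      K1 / κ ^ 5 * ‖z₀‖ := by
    refine (Complex.abs_re_le_norm _).trans ?_
    rw [norm_mul, hE, mul_one]
    exact hz
  rw [e1, e3, Complex.add_re, e4]
  have e6 : |w.im * sin (Φ - γ)| ≤ K2 / κ ^ 5 * ‖z₀‖ := by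
    rw [abs_mul]
    exact (mul_le_of_le_one_right (abs_nonneg _) (abs_sin_le_one _)).trans hb
  set q := ((refinedWave α β n θ - z₀) * Complex.exp (Complex.I * Φ)).re
  have e7 : w.re * cos (Φ - γ) - w.im * sin (Φ - γ) + q - w.re * cos (Φ - γ) =
    q - w.im * sin (Φ - γ) := by ring
  rw [e7]
  refine (abs_sub _ _).trans ((add_le_add e5 e6).trans ?_)
  calc K1 / κ ^ 5 * ‖z₀‖ + K2 / κ ^ 5 * ‖z₀‖ = (K1 + K2) / κ ^ 5 * ‖z₀‖ := by ring
    _ ≤ (K1 + K2) / κ ^ 5 * (2 * |w.re|) := by gcongr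
    _ = _ := by ring

end Zeros

lemma exists_zero_liouJacobi {α : ℝ} (hα : -1 < α) (β : ℝ) {δ : ℝ} (hδ : 0 < δ)
    (hδ' : δ < π / 2) :
    ∃ C > 0, ∀ᶠ n in atTop, ∀ j : ℕ, ∀ θ₀ ∈ Set.Icc δ (π - δ),
      jacobiFreq α β n * θ₀ = (j + α / 2 - 1 / 4) * π →
      ∃ θ ∈ Set.Ioo 0 π, liouJacobi α β n θ = 0 ∧
        |θ - (θ₀ + -phaseC1 α β θ₀ / jacobiFreq α β n ^ 2 +
          (phaseC1 α β θ₀ * halfPot α β θ₀ - phaseC3 α β θ₀) / jacobiFreq α β n ^ 4)| ≤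
          C / jacobiFreq α β n ^ 6 := by
  obtain ⟨K, hK, hphase⟩ := phase_expansion α β hδ
  obtain ⟨L, hL, hcos⟩ := liouJacobi_near_cos hα β (half_pos hδ) (by linarith)
  have hκ := tendsto_jacobiFreq α β
  set C := 2 * K + 4 * L + 1 with hC
  refine ⟨C, by positivity, ?_⟩
  filter_upwards [hcos, hκ.eventually_ge_atTop K, hκ.eventually_ge_atTop (2 * C),
    hκ.eventually_ge_atTop (4 * K), hκ.eventually_ge_atTop 1] with n hn hκK hκC hκK4 hκ1
  set κ := jacobiFreq α β n with hκd
  intro j θ₀ hθ₀ hκθ₀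
  obtain ⟨a, ha⟩ := hn
  set c := θ₀ + -phaseC1 α β θ₀ / κ ^ 2 +
    (phaseC1 α β θ₀ * halfPot α β θ₀ - phaseC3 α β θ₀) / κ ^ 4 with hc
  have hκ0 : 0 < κ := by linarith
  have hC0 : 0 < C := by positivity
  have key (s h : ℝ) (hs : s ^ 2 = 1) (hh : h = s * (C / κ ^ 6)) :
      c + h ∈ Set.Ioo 0 π ∧ (a = 0 → liouJacobi α β n (c + h) = 0) ∧
      0 ≤ s * ((-1) ^ j * a) * liouJacobi α β n (c + h) := by
    have hs1 : |s| = 1 := by rwa [← sq_eq_sq₀ (abs_nonneg s) zero_le_one, sq_abs, one_pow]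
    have hha : |h| = C / κ ^ 6 := by
      rw [hh, abs_mul, hs1, one_mul, abs_of_pos (by positivity)]
    have hκ3 : κ ≤ κ ^ 4 := le_self_pow₀ hκ1 (by norm_num)
    have hκ5 : κ ≤ κ ^ 5 := le_self_pow₀ hκ1 (by norm_num)
    have hh2 : |h| ≤ 1 / κ ^ 2 := by
      rw [hha, div_le_div_iff₀ (by positivity) (by positivity)]
      calc C * κ ^ 2 ≤ κ ^ 4 * κ ^ 2 := by gcongr; linarith
        _ = 1 * κ ^ 6 := by ring
    obtain ⟨hmem, hΦ⟩ := hphase κ hκK θ₀ hθ₀ h hh2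
    rw [← hc] at hmem hΦ
    have hπ := pi_pos
    refine ⟨⟨by linarith [hmem.1], by linarith [hmem.2]⟩, ?_⟩
    obtain ⟨p, hp, hpu⟩ := ha (c + h) hmem
    refine ⟨fun h0 => ?_, ?_⟩
    · rw [h0, zero_mul, sub_zero, abs_zero, mul_zero, abs_nonpos_iff] at hpu
      exact (mul_eq_zero.1 hpu).resolve_left hp.ne'
    set y := phase α β κ (c + h) - κ * θ₀ with hy
    -- in units of `κ⁻⁵`, `s * y` is `C` up to `K + C / 4`
    have hlow : s * y ∈ Set.Icc (2 * L / κ ^ 5) 1 := by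
      have h1 : K * |h| / κ ≤ (C / 4) / κ ^ 5 := by
        rw [hha, div_le_div_iff₀ hκ0 (by positivity)]
        have : K * (C / κ ^ 6) * κ ^ 5 = K * C / κ := by field_simp
        rw [this, div_le_iff₀ hκ0]
        have : 4 * K ≤ κ * κ := by nlinarith
        nlinarith
      have h2 : |s * y - C / κ ^ 5| ≤ (K + C / 4) / κ ^ 5 := by
        have e : s * y - C / κ ^ 5 = s * (y - κ * h) := by
          rw [hh]
          field_simp
          linear_combination C * hs
        rw [e, abs_mul, hs1, one_mul, add_div]
        linarith
      rw [abs_le] at h2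
      constructor
      · have : 2 * L / κ ^ 5 ≤ C / κ ^ 5 - (K + C / 4) / κ ^ 5 := by
          rw [← sub_div]
          gcongr
          linarith
        linarith [h2.1]
      · have : C / κ ^ 5 + (K + C / 4) / κ ^ 5 ≤ 1 := by
          rw [← add_div, div_le_one (by positivity)]
          linarith
        linarith [h2.2]
    have hsin : L / κ ^ 5 ≤ s * sin y := by
      have e : s * sin y = sin (s * y) := by
        rcases eq_or_eq_neg_of_sq_eq_sq s 1 (by rw [hs, one_pow]) with rfl | rfl <;> simp
      have h0 : 0 ≤ s * y := (by positivity : 0 ≤ 2 * L / κ ^ 5).trans hlow.1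
      have h1 := mul_le_sin h0 (by linarith [hlow.2, two_le_pi])
      have h2 : 1 / 2 ≤ 2 / π := by
        rw [div_le_div_iff₀ (by norm_num) hπ]
        linarith [pi_le_four]
      rw [e]
      calc L / κ ^ 5 = 1 / 2 * (2 * L / κ ^ 5) := by ring
        _ ≤ 2 / π * (s * y) := mul_le_mul h2 hlow.1 (by positivity) (by positivity)
        _ ≤ _ := h1
    have hcosy : cos (phase α β κ (c + h) - (α / 2 + 1 / 4) * π) = (-1) ^ j * sin y := by
      have e : phase α β κ (c + h) - (α / 2 + 1 / 4) * π = y - π / 2 + j * π := by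
        rw [hy, hκθ₀]; ring
      rw [e, cos_add_nat_mul_pi, cos_sub_pi_div_two]
    rw [hcosy] at hpu
    set b := (-1) ^ j * a with hb
    have hba : |a| = |b| := by rw [hb, abs_mul, abs_pow, abs_neg, abs_one, one_pow, one_mul]
    have e : a * ((-1) ^ j * sin y) = b * sin y := by rw [hb]; ring
    rw [e, hba] at hpu
    have hmain : 0 ≤ p * (s * b * liouJacobi α β n (c + h)) := by
      set r := p * liouJacobi α β n (c + h) - b * sin y with hr
      have h1 : |s * b * r| ≤ L / κ ^ 5 * b ^ 2 := by
        rw [abs_mul, abs_mul, hs1, one_mul, ← sq_abs b]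
        calc |b| * |r| ≤ |b| * (L / κ ^ 5 * |b|) := by gcongr
          _ = _ := by ring
      have h2 : L / κ ^ 5 * b ^ 2 ≤ s * sin y * b ^ 2 := by gcongr
      have h3 : p * (s * b * liouJacobi α β n (c + h)) = s * sin y * b ^ 2 + s * b * r := by
        rw [hr]; ring
      rw [h3]
      linarith [(abs_le.1 h1).1]
    exact nonneg_of_mul_nonneg_right hmain hp
  set H := C / κ ^ 6 with hH
  have hH0 : 0 < H := by positivity
  obtain ⟨m1, z1, u1⟩ := key 1 H (by norm_num) (by ring)
  obtain ⟨m2, -, u2⟩ := key (-1) (-H) (by norm_num) (by ring)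
  set b := (-1) ^ j * a with hbd
  have hsub : Set.Icc (c + -H) (c + H) ⊆ Set.Ioo 0 π := fun x hx =>
    ⟨m2.1.trans_le hx.1, hx.2.trans_lt m1.2⟩
  have hcont : ContinuousOn (liouJacobi α β n) (Set.Icc (c + -H) (c + H)) := fun x hx =>
    (hasDerivAt_liouJacobi α β n (hsub hx)).continuousAt.continuousWithinAt
  have hle : c + -H ≤ c + H := by linarith
  have hzero : ∃ x ∈ Set.Icc (c + -H) (c + H), liouJacobi α β n x = 0 := by
    rcases eq_or_ne a 0 with ha0 | ha0
    · exact ⟨c + H, Set.right_mem_Icc.2 hle, z1 ha0⟩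
    have hb : b ≠ 0 := mul_ne_zero (by simp) ha0
    rcases hb.lt_or_gt with hb | hb
    · exact intermediate_value_Icc' hle hcont ⟨by nlinarith, by nlinarith⟩
    · exact intermediate_value_Icc hle hcont ⟨by nlinarith, by nlinarith⟩
  obtain ⟨x, hx, hx0⟩ := hzero
  refine ⟨x, hsub hx, hx0, abs_le.2 ⟨by linarith [hx.1], by linarith [hx.2]⟩⟩

theorem jacobi_zeros_elementary_expansion (α β : ℝ) (hα : -1 < α) (hβ : -1 < β)
    (δ : ℝ) (hδ : δ ∈ Set.Ioo 0 (π / 2)) :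
    ∃ C > (0 : ℝ), ∃ N : ℕ, ∀ n : ℕ, N ≤ n → ∀ k : ℕ, 1 ≤ k → k ≤ n →
      let κ := (n : ℝ) + (α + β + 1) / 2
      let θ₀ := ((n : ℝ) + 1 - (k : ℝ) + α / 2 - 1 / 4) * π / κ
      θ₀ ∈ Set.Icc δ (π - δ) →
        let x := Real.cos θ₀
        let θ₁ := -(2 * β ^ 2 * x + 2 * α ^ 2 * x - x - 2 * β ^ 2 + 2 * α ^ 2) /
          (8 * Real.sin θ₀)
        let θ₂ := (1 / (384 * (Real.sin θ₀) ^ 3)) *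
          (-33 * x - 36 * β ^ 2 * x ^ 2 + 36 * α ^ 2 * x ^ 2 + 24 * β ^ 4 * x ^ 2 -
            24 * α ^ 4 * x ^ 2 + 2 * x ^ 3 + 84 * β ^ 2 * x - 60 * α ^ 4 * x -
            60 * β ^ 4 * x + 84 * α ^ 2 * x + 4 * β ^ 4 * x ^ 3 + 4 * α ^ 4 * x ^ 3 -
            8 * β ^ 2 * x ^ 3 + 40 * α ^ 2 - 8 * α ^ 2 * x ^ 3 - 40 * β ^ 2 +
            32 * β ^ 4 - 32 * α ^ 4 + 24 * α ^ 2 * β ^ 2 * x ^ 3 -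
            24 * α ^ 2 * β ^ 2 * x)
        ∃ θstar ∈ Set.Ioo 0 π, jacobiP α β n (Real.cos θstar) = 0 ∧
          |θstar - θ₀ - θ₁ / κ ^ 2 - θ₂ / κ ^ 4| ≤ C / κ ^ 6 := by
  obtain ⟨C, hC, h⟩ := exists_zero_liouJacobi hα β hδ.1 hδ.2
  obtain ⟨N, hN⟩ := eventually_atTop.1
    (h.and ((tendsto_jacobiFreq α β).eventually_gt_atTop 0))
  refine ⟨C, hC, N, ?_⟩
  intro n hn k hk1 hkn κ θ₀ hθ₀ x θ₁ θ₂
  obtain ⟨hzero, hκ⟩ := hN n hn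
  change 0 < κ at hκ
  have hmem : θ₀ ∈ Set.Ioo 0 π := ⟨hδ.1.trans_le hθ₀.1, by linarith [hδ.1, hθ₀.2]⟩
  obtain ⟨θ, hθ, hu, hle⟩ := hzero (n + 1 - k) θ₀ hθ₀ (by
    rw [Nat.cast_sub (by omega)]
    push_cast
    exact mul_div_cancel₀ _ hκ.ne')
  refine ⟨θ, hθ, ?_, ?_⟩
  · have h0 := (mul_eq_zero.1 hu).resolve_left (liouWeight_pos α β θ).ne'
    have e : (cos θ - 1) / 2 = -sin (θ / 2) ^ 2 := by
      have h1 := cos_sq' (θ / 2)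
      have h2 := cos_sq (θ / 2)
      rw [mul_div_cancel₀ θ two_ne_zero] at h2
      linarith
    rw [jacobiP_eq hα β, e, h0, mul_zero]
  · rw [phaseC1_eq α β hmem, phaseC1_mul_halfPot_sub_phaseC3_eq α β hmem] at hle
    have e : θ - θ₀ - θ₁ / κ ^ 2 - θ₂ / κ ^ 4 = θ - (θ₀ + θ₁ / κ ^ 2 + θ₂ / κ ^ 4) := by ring
    rw [e]
    exact hle
end

section
/- Let J_ν(x) = Σ_{m=0}^∞ ((−1)^m/(m! Γ(m+ν+1)))(x/2)^{2m+ν}. For every real α > −1, every u > 0, and every λ > 0 with |1 − λ²| < 1, the series Σ_{m=0}^∞ (w^m/m!) J_{α+m}(u) with w = u(1 − λ²)/2 converges and J_α(λu) = λ^α Σ_{m=0}^∞ (w^m/m!) J_{α+m}(u). In particular, for u > 0 and h with |1 − (1 + h/u)²| < 1, J_α(u + h) = (1 + h/u)^α Σ_{m=0}^∞ (w^m/m!) J_{α+m}(u) with w = −h(2u + h)/(2u). -/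
open Real

/-- The Bessel function of the first kind, defined by its power series (via `rpow`). -/
noncomputable def besselJ (ν x : ℝ) : ℝ :=
  ∑' m : ℕ, ((-1 : ℝ) ^ m / ((Nat.factorial m : ℝ) * Real.Gamma ((m : ℝ) + ν + 1))) *
    (x / 2) ^ (2 * (m : ℝ) + ν)

theorem Real.exists_forall_inv_Gamma_natCast_add_le {s : ℝ} (hs : 0 < s) :
    ∃ C : ℝ, ∀ n : ℕ, |(Gamma ((n : ℝ) + s))⁻¹| ≤ C := by
  have hpos : ∀ n : ℕ, 0 < Gamma ((n : ℝ) + s) := fun n => Gamma_pos_of_pos (by positivity)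
  have hlow : ∀ n : ℕ, Gamma (1 + s) ≤ Gamma (((n + 1 : ℕ) : ℝ) + s) := by
    intro n
    induction n with
    | zero => simp
    | succ n ih =>
      have hrec : Gamma (((n + 1 + 1 : ℕ) : ℝ) + s) =
          (((n + 1 : ℕ) : ℝ) + s) * Gamma (((n + 1 : ℕ) : ℝ) + s) := by
        rw [← Gamma_add_one (by positivity)]
        congr 1
        push_cast
        ring
      have hone : 1 ≤ ((n + 1 : ℕ) : ℝ) + s := by
        push_cast
        linarith [(Nat.cast_nonneg n : (0 : ℝ) ≤ n)]
      rw [hrec]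
      exact ih.trans (le_mul_of_one_le_left (hpos _).le hone)
  refine ⟨max (Gamma s)⁻¹ (Gamma (1 + s))⁻¹, fun n => ?_⟩
  rw [abs_of_pos (inv_pos.2 (hpos n))]
  cases n with
  | zero => simp
  | succ n => exact le_max_of_le_right (inv_anti₀ (Gamma_pos_of_pos (by positivity)) (hlow n))

theorem hasSum_tsum_pow_div_factorial_mul (a b : ℝ) {c : ℕ → ℝ} {C : ℝ} (hc : ∀ n, |c n| ≤ C) :
    HasSum (fun m : ℕ => ∑' j : ℕ,
        a ^ m / (m.factorial : ℝ) * (b ^ j / (j.factorial : ℝ) * c (j + m)))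
      (∑' n : ℕ, (a + b) ^ n / (n.factorial : ℝ) * c n) := by
  set F : ℕ × ℕ → ℝ := fun p =>
    a ^ p.1 / (p.1.factorial : ℝ) * (b ^ p.2 / (p.2.factorial : ℝ) * c (p.2 + p.1)) with hF
  have hsum : Summable F := by
    have hprod : Summable fun p : ℕ × ℕ =>
        |a| ^ p.1 / (p.1.factorial : ℝ) * (|b| ^ p.2 / (p.2.factorial : ℝ)) :=
      (summable_pow_div_factorial |a|).mul_of_nonneg (summable_pow_div_factorial |b|)
        (fun _ => by positivity) (fun _ => by positivity)
    refine Summable.of_norm_bounded (hprod.mul_right C) fun p => ?_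
    rw [hF, Real.norm_eq_abs, abs_mul, abs_mul, abs_div, abs_div, abs_pow, abs_pow,
      Nat.abs_cast, Nat.abs_cast, ← mul_assoc]
    exact mul_le_mul_of_nonneg_left (hc _) (by positivity)
  have hdiag : ∑' p, F p = ∑' n : ℕ, (a + b) ^ n / (n.factorial : ℝ) * c n := by
    have hsigma := (Finset.HasAntidiagonal.sigmaAntidiagonalEquivProd (A := ℕ)).summable_iff.2 hsum
    rw [← (Finset.HasAntidiagonal.sigmaAntidiagonalEquivProd (A := ℕ)).tsum_eq F]
    refine (hsigma.tsum_sigma' fun n => (hasSum_fintype _).summable).trans (tsum_congr fun n => ?_)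
    rw [tsum_fintype]
    refine (Finset.sum_coe_sort (Finset.HasAntidiagonal.antidiagonal n) F).trans ?_
    rw [(Commute.all a b).add_pow', Finset.sum_div, Finset.sum_mul]
    refine Finset.sum_congr rfl fun p hp => ?_
    obtain rfl := Finset.HasAntidiagonal.mem_antidiagonal.1 hp
    have hchoose : ((p.1 + p.2).choose p.1 : ℝ) * p.1.factorial * p.2.factorial =
        (p.1 + p.2).factorial := by
      rw [Nat.choose_symm_add]
      exact_mod_cast Nat.add_choose_mul_factorial_mul_factorial p.1 p.2
    have h₁ : (p.1.factorial : ℝ) ≠ 0 := by positivity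
    have h₂ : (p.2.factorial : ℝ) ≠ 0 := by positivity
    have h₃ : ((p.1 + p.2).choose p.1 : ℝ) ≠ 0 := by
      exact_mod_cast (Nat.choose_pos (Nat.le_add_right _ _)).ne'
    simp only [hF]
    rw [← hchoose, nsmul_eq_mul, add_comm p.2 p.1]
    field_simp
  rw [← hdiag]
  exact hsum.hasSum.prod_fiberwise fun m => (hsum.prod_factor m).hasSum

theorem besselJ_eq_rpow_mul_tsum (ν : ℝ) {x : ℝ} (hx : x ≠ 0) :
    besselJ ν x = (x / 2) ^ ν *
      ∑' m : ℕ, (-(x / 2) ^ 2) ^ m / (m.factorial : ℝ) * (Gamma ((m : ℝ) + (ν + 1)))⁻¹ := by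
  rw [besselJ, ← tsum_mul_left]
  refine tsum_congr fun m => ?_
  have hpow : (x / 2) ^ (2 * (m : ℝ) + ν) = (x / 2) ^ ν * ((x / 2) ^ 2) ^ m := by
    rw [← pow_mul, ← rpow_add_natCast (div_ne_zero hx two_ne_zero)]
    congr 1
    push_cast
    ring
  rw [hpow, neg_pow ((x / 2) ^ 2) m, div_mul_eq_div_div, div_eq_mul_inv _ (Gamma _), add_assoc]
  ring

theorem Real.mul_rpow_of_ne_zero_of_pos {x y : ℝ} (hx : x ≠ 0) (hy : 0 < y) (z : ℝ) :
    (x * y) ^ z = x ^ z * y ^ z := by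
  rcases hx.lt_or_gt with hx' | hx'
  · rw [rpow_def_of_neg (mul_neg_of_neg_of_pos hx' hy), rpow_def_of_neg hx', rpow_def_of_pos hy,
      log_mul hx hy.ne', add_mul, exp_add]
    ring
  · exact mul_rpow hx'.le hy.le

theorem besselJ_hasSum_multiplication {α : ℝ} (hα : -1 < α) {u lam : ℝ} (hu : 0 < u) :
    HasSum (fun m : ℕ =>
        (u * (1 - lam ^ 2) / 2) ^ m / (Nat.factorial m : ℝ) * besselJ (α + m) u)
      ((u / 2) ^ α * ∑' n : ℕ,
        (-(lam * u / 2) ^ 2) ^ n / (n.factorial : ℝ) * (Gamma ((n : ℝ) + (α + 1)))⁻¹) := by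
  obtain ⟨C, hC⟩ := exists_forall_inv_Gamma_natCast_add_le (s := α + 1) (by linarith)
  have key := (hasSum_tsum_pow_div_factorial_mul ((1 - lam ^ 2) * (u / 2) ^ 2) (-(u / 2) ^ 2)
    hC).mul_left ((u / 2) ^ α)
  rw [show (1 - lam ^ 2) * (u / 2) ^ 2 + -(u / 2) ^ 2 = -(lam * u / 2) ^ 2 by ring] at key
  refine key.congr_fun ?_
  intro m
  rw [besselJ_eq_rpow_mul_tsum _ hu.ne', tsum_mul_left, rpow_add_natCast (by positivity)]
  have hGamma : ∀ j : ℕ, ((j + m : ℕ) : ℝ) + (α + 1) = (j : ℝ) + (α + m + 1) := fun j => by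
    push_cast
    ring
  have hpow : ((1 - lam ^ 2) * (u / 2) ^ 2) ^ m =
      (u * (1 - lam ^ 2) / 2) ^ m * (u / 2) ^ m := by
    rw [← mul_pow]
    ring
  simp only [hGamma]
  rw [hpow]
  generalize tsum (fun j : ℕ => (-(u / 2) ^ 2) ^ j / (j.factorial : ℝ) *
    (Gamma ((j : ℝ) + (α + m + 1)))⁻¹) = T
  ring

theorem besselJ_mul {α : ℝ} (hα : -1 < α) {u lam : ℝ} (hu : 0 < u) (hlam : lam ≠ 0) :
    besselJ α (lam * u) =
      lam ^ α * ∑' m : ℕ,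
        (u * (1 - lam ^ 2) / 2) ^ m / (Nat.factorial m : ℝ) * besselJ (α + m) u := by
  rw [(besselJ_hasSum_multiplication hα hu).tsum_eq,
    besselJ_eq_rpow_mul_tsum _ (mul_ne_zero hlam hu.ne'), ← mul_assoc,
    ← mul_rpow_of_ne_zero_of_pos hlam (half_pos hu), mul_div_assoc]

theorem bessel_multiplication_theorem (α : ℝ) (hα : -1 < α) :
    (∀ u : ℝ, 0 < u → ∀ lam : ℝ, 0 < lam → |1 - lam ^ 2| < 1 →
      Summable (fun m : ℕ =>
        (u * (1 - lam ^ 2) / 2) ^ m / (Nat.factorial m : ℝ) * besselJ (α + m) u) ∧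
      besselJ α (lam * u) =
        lam ^ α * ∑' m : ℕ,
          (u * (1 - lam ^ 2) / 2) ^ m / (Nat.factorial m : ℝ) * besselJ (α + m) u) ∧
    (∀ u : ℝ, 0 < u → ∀ h : ℝ, |1 - (1 + h / u) ^ 2| < 1 →
      besselJ α (u + h) =
        (1 + h / u) ^ α * ∑' m : ℕ,
          (-(h * (2 * u + h) / (2 * u))) ^ m / (Nat.factorial m : ℝ) *
            besselJ (α + m) u) := by
  refine ⟨fun u hu lam hlam _ => ⟨(besselJ_hasSum_multiplication hα hu).summable,
    besselJ_mul hα hu hlam.ne'⟩, fun u hu h hh => ?_⟩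
  have hne : 1 + h / u ≠ 0 := fun h0 => by simp [h0] at hh
  have hw : u * (1 - (1 + h / u) ^ 2) / 2 = -(h * (2 * u + h) / (2 * u)) := by
    field_simp
    ring
  have hmul : (1 + h / u) * u = u + h := by field_simp
  rw [← hw, ← hmul]
  exact besselJ_mul hα hu hne
end
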